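/- There is a ℂ-algebra isomorphism ψ' from U'_h(ĝl₂)_k (Reshetikhin–Semenov-Tian-Shansky realization) to U_h(ĝl₂)_k (Drinfeld-type realization), determined as follows. Using the Gauss decomposition L^±(z) = [[1,0],[e^±(z),1]] · diag(k₁^±(z), k₂^±(z)) · [[1,f^±(z)],[0,1]] of the generating matrices of U'_h(ĝl₂)_k — that is, k₁^±(z) = l₁₁^±(z), e^±(z) = l₂₁^±(z)·l₁₁^±(z)^{−1}, f^±(z) = l₁₁^±(z)^{−1}·l₁₂^±(z), k₂^±(z) = l₂₂^±(z) − l₂₁^±(z)l₁₁^±(z)^{−1}l₁₂^±(z) — the map ψ' sends, coefficientwise, k₁^±(z) and k₂^±(z) to the like-named generating series of U_h(ĝl₂)_k, e^+(z) to Σ_{n≤0} E[n]q^{kn/2}z^{−n}, e^−(z) to −Σ_{n≥1} E[n]q^{−kn/2}z^{−n}, f^+(z) to Σ_{n≤−1} F[n]q^{−kn/2}z^{−n}, and f^−(z) to −Σ_{n≥0} F[n]q^{kn/2}z^{−n}; equivalently ψ'[e^+(zq^{k/2}) − e^−(zq^{−k/2})] = E(z) and ψ'[f^+(zq^{−k/2})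 − f^−(zq^{k/2})] = F(z). This assignment is well defined on the generators l^±_{ij}[n] and extends to an isomorphism of ℂ-algebras. -/

import Mathlib

/-!
The quantum affine algebra `U_h(ĝl₂)_k` in the Drinfeld-type realization, presented by
generators and coefficientwise relations, and the centrality of the Fourier coefficients of
the series `k₁^±(z)·k₂^±(zq^{−2}) − 1`.

Conventions: `q = e^h` (with `Re h < 0`, so `0 < |q| < 1`), `q^c = exp(h·c)`.  The index
`i : Fin 2` with `i = 0` stands for the subscript `1` and `i = 1` for the subscript `2`.
The series are `E(z) = Σ_{n∈ℤ} E[n]z^{−n}`, `F(z) = Σ_{n∈ℤ} F[n]z^{−n}`,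
`k_i^+(z) = Σ_{n≥0} k_i^+[−n]zⁿ`, `k_i^−(z) = Σ_{n≥0} k_i^−[n]z^{−n}`, and every relation
below is the equality of the coefficient of a fixed monomial in `z, w` of the corresponding
relation between formal series.
-/

noncomputable section

open Finset

/-- `f(x) = ∏_{n=0}^∞ (1 − xq^{4n})(1 − xq^{4n+4})/(1 − xq^{4n+2})²`. -/
def fProd (q x : ℂ) : ℂ :=
  ∏' n : ℕ, ((1 - x * q ^ (4 * n)) * (1 - x * q ^ (4 * n + 4)) / (1 - x * q ^ (4 * n + 2)) ^ 2)

/-- The `m`-th Taylor coefficient at `0` of the ratio `t ↦ f(t·q^a)/f(t·q^b)`,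
where `q^c := exp(h·c)`; this is the coefficientwise expansion of the ratio of
`f`-series as a power series in `t = w/z`. -/
def ratioCoeff (h a b : ℂ) (m : ℕ) : ℂ :=
  iteratedDeriv m (fun t => fProd (Complex.exp h) (t * Complex.exp (h * a)) /
    fProd (Complex.exp h) (t * Complex.exp (h * b))) 0 / (m.factorial : ℂ)

/-- Generators of `U_h(ĝl₂)_k`: `E[n]`, `F[n]` (`n ∈ ℤ`), and the modes
`k_i^+[−n]`, `k_i^−[n]` (`i = 1,2`, `n ≥ 0`). -/
inductive GlGen : Type
  | E : ℤ → GlGen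
  | F : ℤ → GlGen
  | Kp : Fin 2 → ℕ → GlGen
  | Km : Fin 2 → ℕ → GlGen

/-- The free algebra on the generators. -/
abbrev GlFA : Type := FreeAlgebra ℂ GlGen

/-- `E[n]`. -/
def eG (n : ℤ) : GlFA := FreeAlgebra.ι ℂ (GlGen.E n)
/-- `F[n]`. -/
def fG (n : ℤ) : GlFA := FreeAlgebra.ι ℂ (GlGen.F n)
/-- The coefficient of `zⁿ` in `k_i^+(z)` (zero for `n < 0`). -/
def kpG (i : Fin 2) (n : ℤ) : GlFA := if 0 ≤ n then FreeAlgebra.ι ℂ (GlGen.Kp i n.toNat) else 0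
/-- The coefficient of `z⁻ⁿ` in `k_i^−(z)` (zero for `n < 0`). -/
def kmG (i : Fin 2) (n : ℤ) : GlFA := if 0 ≤ n then FreeAlgebra.ι ℂ (GlGen.Km i n.toNat) else 0

/-- Coefficients of the multiplicative inverse of a power series `Σ_{n≥0} a_n tⁿ`
with prescribed inverse `a0'` of the constant term:  `b₀ = a0'`,
`b_{n+1} = −a0'·Σ_{j≤n} a_{n+1−j} b_j`. -/
def seriesInv {R : Type*} [Ring R] (a : ℕ → R) (a0' : R) : ℕ → R
  | 0 => a0'
  | n + 1 => -(a0' * ∑ j ∈ (Finset.range (n + 1)).attach,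
      a (n + 1 - j.1) * seriesInv a a0' j.1)
termination_by n => n
decreasing_by exact Finset.mem_range.mp j.2

/-- Coefficients of `k₁^+(z)⁻¹` (formal inverse, with `k₁^+[0]⁻¹ = k₁^−[0]`). -/
def invKp1 : ℕ → GlFA := seriesInv (fun n => kpG 0 n) (kmG 0 0)
/-- Coefficients of `k₁^−(z)⁻¹` (formal inverse, with `k₁^−[0]⁻¹ = k₁^+[0]`). -/
def invKm1 : ℕ → GlFA := seriesInv (fun n => kmG 0 n) (kpG 0 0)

/-- The coefficient of `w⁻ᶜ` in `k₂^−(wq^{k/2})·k₁^−(wq^{k/2})⁻¹` (zero for `c < 0`). -/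
def AmSer (h k : ℂ) (c : ℤ) : GlFA :=
  if 0 ≤ c then
    Complex.exp (-(h * k) / 2 * (c : ℂ)) •
      ∑ j ∈ Finset.range (c.toNat + 1), kmG 1 (j : ℤ) * invKm1 (c.toNat - j)
  else 0

/-- The coefficient of `wᶜ` in `k₂^+(wq^{−k/2})·k₁^+(wq^{−k/2})⁻¹` (zero for `c < 0`). -/
def ApSer (h k : ℂ) (c : ℤ) : GlFA :=
  if 0 ≤ c then
    Complex.exp (-(h * k) / 2 * (c : ℂ)) •
      ∑ j ∈ Finset.range (c.toNat + 1), kpG 1 (j : ℤ) * invKp1 (c.toNat - j)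
  else 0

/-- The defining relations of `U_h(ĝl₂)_k`, written coefficientwise. -/
inductive GlRel (h k : ℂ) : GlFA → GlFA → Prop
  /- `k_i^+[0]k_i^−[0] = 1` -/
  | kpkm0 (i : Fin 2) : GlRel h k (kpG i 0 * kmG i 0) 1
  /- `k_i^−[0]k_i^+[0] = 1` -/
  | kmkp0 (i : Fin 2) : GlRel h k (kmG i 0 * kpG i 0) 1
  /- `k_i^+(z)k_j^+(w) = k_j^+(w)k_i^+(z)` -/
  | kpkp (i j : Fin 2) (a b : ℤ) : GlRel h k (kpG i a * kpG j b) (kpG j b * kpG i a)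
  /- `k_i^−(z)k_j^−(w) = k_j^−(w)k_i^−(z)` -/
  | kmkm (i j : Fin 2) (a b : ℤ) : GlRel h k (kmG i a * kmG j b) (kmG j b * kmG i a)
  /- `k_i^−(z)k_i^+(w) = (f((w/z)q^{−k})/f((w/z)q^k))·k_i^+(w)k_i^−(z)`,
     coefficient of `z⁻ᵃwᵇ`. -/
  | kmkp_diag (i : Fin 2) (a b : ℕ) : GlRel h k (kmG i (a : ℤ) * kpG i (b : ℤ))
      (∑ m ∈ Finset.range (min a b + 1),
        ratioCoeff h (-k) k m • (kpG i ((b : ℤ) - m) * kmG i ((a : ℤ) - m)))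
  /- `k₁^−(z)k₂^+(w) = (f((w/z)q^{k+2})/f((w/z)q^{−k+2}))·k₂^+(w)k₁^−(z)` -/
  | km1kp2 (a b : ℕ) : GlRel h k (kmG 0 (a : ℤ) * kpG 1 (b : ℤ))
      (∑ m ∈ Finset.range (min a b + 1),
        ratioCoeff h (k + 2) (-k + 2) m • (kpG 1 ((b : ℤ) - m) * kmG 0 ((a : ℤ) - m)))
  /- `k₂^−(z)k₁^+(w) = (f((w/z)q^{k−2})/f((w/z)q^{−k−2}))·k₁^+(w)k₂^−(z)` -/
  | km2kp1 (a b : ℕ) : GlRel h k (kmG 1 (a : ℤ) * kpG 0 (b : ℤ))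
      (∑ m ∈ Finset.range (min a b + 1),
        ratioCoeff h (k - 2) (-k - 2) m • (kpG 0 ((b : ℤ) - m) * kmG 1 ((a : ℤ) - m)))
  /- `(zq^{−k/2} − w)k₁^+(z)E(w) = (zq^{−k/2−1} − wq)E(w)k₁^+(z)`, coefficient of `zⁿw⁻ᵐ`. -/
  | kp1E (n m : ℤ) : GlRel h k
      (Complex.exp (h * (-k / 2)) • (kpG 0 (n - 1) * eG m) - kpG 0 n * eG (m + 1))
      (Complex.exp (h * (-k / 2 - 1)) • (eG m * kpG 0 (n - 1))
        - Complex.exp h • (eG (m + 1) * kpG 0 n))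
  /- `(zq^{k/2} − w)k₁^−(z)E(w) = (zq^{k/2−1} − wq)E(w)k₁^−(z)`, coefficient of `z⁻ⁿw⁻ᵐ`. -/
  | km1E (n m : ℤ) : GlRel h k
      (Complex.exp (h * (k / 2)) • (kmG 0 (n + 1) * eG m) - kmG 0 n * eG (m + 1))
      (Complex.exp (h * (k / 2 - 1)) • (eG m * kmG 0 (n + 1))
        - Complex.exp h • (eG (m + 1) * kmG 0 n))
  /- `(zq^{k/2−1} − wq)k₁^+(z)F(w) = (zq^{k/2} − w)F(w)k₁^+(z)` -/
  | kp1F (n m : ℤ) : GlRel h k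
      (Complex.exp (h * (k / 2 - 1)) • (kpG 0 (n - 1) * fG m)
        - Complex.exp h • (kpG 0 n * fG (m + 1)))
      (Complex.exp (h * (k / 2)) • (fG m * kpG 0 (n - 1)) - fG (m + 1) * kpG 0 n)
  /- `(zq^{−k/2−1} − wq)k₁^−(z)F(w) = (zq^{−k/2} − w)F(w)k₁^−(z)` -/
  | km1F (n m : ℤ) : GlRel h k
      (Complex.exp (h * (-k / 2 - 1)) • (kmG 0 (n + 1) * fG m)
        - Complex.exp h • (kmG 0 n * fG (m + 1)))
      (Complex.exp (h * (-k / 2)) • (fG m * kmG 0 (n + 1)) - fG (m + 1) * kmG 0 n)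
  /- `(zq^{−k/2} − w)k₂^+(z)E(w) = (zq^{−k/2+1} − wq^{−1})E(w)k₂^+(z)` -/
  | kp2E (n m : ℤ) : GlRel h k
      (Complex.exp (h * (-k / 2)) • (kpG 1 (n - 1) * eG m) - kpG 1 n * eG (m + 1))
      (Complex.exp (h * (-k / 2 + 1)) • (eG m * kpG 1 (n - 1))
        - Complex.exp (-h) • (eG (m + 1) * kpG 1 n))
  /- `(zq^{k/2} − w)k₂^−(z)E(w) = (zq^{k/2+1} − wq^{−1})E(w)k₂^−(z)` -/
  | km2E (n m : ℤ) : GlRel h k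
      (Complex.exp (h * (k / 2)) • (kmG 1 (n + 1) * eG m) - kmG 1 n * eG (m + 1))
      (Complex.exp (h * (k / 2 + 1)) • (eG m * kmG 1 (n + 1))
        - Complex.exp (-h) • (eG (m + 1) * kmG 1 n))
  /- `(zq^{k/2+1} − wq^{−1})k₂^+(z)F(w) = (zq^{k/2} − w)F(w)k₂^+(z)` -/
  | kp2F (n m : ℤ) : GlRel h k
      (Complex.exp (h * (k / 2 + 1)) • (kpG 1 (n - 1) * fG m)
        - Complex.exp (-h) • (kpG 1 n * fG (m + 1)))
      (Complex.exp (h * (k / 2)) • (fG m * kpG 1 (n - 1)) - fG (m + 1) * kpG 1 n)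
  /- `(zq^{−k/2+1} − wq^{−1})k₂^−(z)F(w) = (zq^{−k/2} − w)F(w)k₂^−(z)` -/
  | km2F (n m : ℤ) : GlRel h k
      (Complex.exp (h * (-k / 2 + 1)) • (kmG 1 (n + 1) * fG m)
        - Complex.exp (-h) • (kmG 1 n * fG (m + 1)))
      (Complex.exp (h * (-k / 2)) • (fG m * kmG 1 (n + 1)) - fG (m + 1) * kmG 1 n)
  /- `(z − wq²)E(z)E(w) = (zq² − w)E(w)E(z)`, coefficient of `z⁻ᵃw⁻ᵇ`. -/
  | EE (a b : ℤ) : GlRel h k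
      (eG (a + 1) * eG b - Complex.exp (2 * h) • (eG a * eG (b + 1)))
      (Complex.exp (2 * h) • (eG b * eG (a + 1)) - eG (b + 1) * eG a)
  /- `(zq² − w)F(z)F(w) = (z − wq²)F(w)F(z)` -/
  | FF (a b : ℤ) : GlRel h k
      (Complex.exp (2 * h) • (fG (a + 1) * fG b) - fG a * fG (b + 1))
      (fG b * fG (a + 1) - Complex.exp (2 * h) • (fG (b + 1) * fG a))
  /- `[E(z),F(w)] = (q−q⁻¹)(δ((w/z)qᵏ)k₂^−(wq^{k/2})k₁^−(wq^{k/2})⁻¹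
        − δ((w/z)q⁻ᵏ)k₂^+(wq^{−k/2})k₁^+(wq^{−k/2})⁻¹)`, coefficient of `z⁻ᵃw⁻ᵇ`. -/
  | EF (a b : ℤ) : GlRel h k
      (eG a * fG b - fG b * eG a)
      ((Complex.exp h - Complex.exp (-h)) •
        (Complex.exp (h * k * (a : ℂ)) • AmSer h k (a + b)
          - Complex.exp (-(h * k) * (a : ℂ)) • ApSer h k (-(a + b))))

/-- `U_h(ĝl₂)_k`: the quotient of the free algebra by the defining relations. -/
abbrev Uhgl2 (h k : ℂ) := RingQuot (GlRel h k)

/-- The canonical projection `GlFA → U_h(ĝl₂)_k`. -/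
def glMk (h k : ℂ) : GlFA →ₐ[ℂ] Uhgl2 h k := RingQuot.mkAlgHom ℂ (GlRel h k)

/-- The coefficient of `zⁿ` in `k₁^+(z)·k₂^+(zq^{−2}) − 1`. -/
def Cp (h : ℂ) (n : ℕ) : GlFA :=
  (∑ j ∈ Finset.range (n + 1),
      Complex.exp (-2 * h * ((n : ℂ) - (j : ℂ))) • (kpG 0 (j : ℤ) * kpG 1 ((n : ℤ) - j)))
    - (if n = 0 then 1 else 0)

/-- The coefficient of `z⁻ⁿ` in `k₁^−(z)·k₂^−(zq^{−2}) − 1`. -/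
def Cm (h : ℂ) (n : ℕ) : GlFA :=
  (∑ j ∈ Finset.range (n + 1),
      Complex.exp (2 * h * ((n : ℂ) - (j : ℂ))) • (kmG 0 (j : ℤ) * kmG 1 ((n : ℤ) - j)))
    - (if n = 0 then 1 else 0)

/-- Generators of `U'_h(ĝl₂)_k` (RS realization): the modes `l^+_{ij}[−n]` and
`l^−_{ij}[n]`, `i,j ∈ {1,2}` (here `0,1`), `n ≥ 0`.  The modes `l^+_{12}[0]` and
`l^−_{21}[0]` are set to zero by a relation below. -/
inductive RSGen : Type
  | p : Fin 2 → Fin 2 → ℕ → RSGen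
  | m : Fin 2 → Fin 2 → ℕ → RSGen

/-- The free algebra on the RS generators. -/
abbrev RSFA : Type := FreeAlgebra ℂ RSGen

/-- The coefficient of `zⁿ` in `l^+_{ij}(z)` (zero for `n < 0`). -/
def lpG (i j : Fin 2) (n : ℤ) : RSFA :=
  if 0 ≤ n then FreeAlgebra.ι ℂ (RSGen.p i j n.toNat) else 0

/-- The coefficient of `z⁻ⁿ` in `l^−_{ij}(z)` (zero for `n < 0`). -/
def lmG (i j : Fin 2) (n : ℤ) : RSFA :=
  if 0 ≤ n then FreeAlgebra.ι ℂ (RSGen.m i j n.toNat) else 0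

/-- The entry of the R-matrix `R(x)` (rows and columns indexed by
`(1,1),(1,2),(2,1),(2,2)`), as a function of `x`, with `q = e^h`:
`R(x) = f(x)·[[1,0,0,0],[0,(1−x)/(q−xq⁻¹),x(q−q⁻¹)/(q−xq⁻¹),0],
[0,(q−q⁻¹)/(q−xq⁻¹),(1−x)/(q−xq⁻¹),0],[0,0,0,1]]`. -/
def REnt (h : ℂ) (a b : Fin 2 × Fin 2) (x : ℂ) : ℂ :=
  fProd (Complex.exp h) x *
    (if a = b then
      (if a.1 = a.2 then 1 else (1 - x) / (Complex.exp h - x * Complex.exp (-h)))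
    else if a = ((0 : Fin 2), (1 : Fin 2)) ∧ b = ((1 : Fin 2), (0 : Fin 2)) then
      x * (Complex.exp h - Complex.exp (-h)) / (Complex.exp h - x * Complex.exp (-h))
    else if a = ((1 : Fin 2), (0 : Fin 2)) ∧ b = ((0 : Fin 2), (1 : Fin 2)) then
      (Complex.exp h - Complex.exp (-h)) / (Complex.exp h - x * Complex.exp (-h))
    else 0)

/-- The `m`-th Taylor coefficient at `0` of the entry `R(x)_{ab}`: the coefficientwise
power series expansion of the R-matrix in `x = z/w`. -/
def RC (h : ℂ) (a b : Fin 2 × Fin 2) (m : ℕ) : ℂ :=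
  iteratedDeriv m (REnt h a b) 0 / (m.factorial : ℂ)

/-- The defining relations of `U'_h(ĝl₂)_k`: the vanishing of `l^+_{12}[0]`, `l^−_{21}[0]`,
invertibility of the constant diagonal modes, and the RLL relations
`R(z/w)L₁^±(z)L₂^±(w) = L₂^±(w)L₁^±(z)R(z/w)` and
`R((z/w)q^{−k})L₁^+(z)L₂^−(w) = L₂^−(w)L₁^+(z)R((z/w)q^{k})`, written coefficientwise
(the coefficient of each monomial in `z, w`). -/
inductive RSRel (h k : ℂ) : RSFA → RSFA → Prop
  | p120 : RSRel h k (lpG 0 1 0) 0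
  | m210 : RSRel h k (lmG 1 0 0) 0
  | diagPM (i : Fin 2) : RSRel h k (lpG i i 0 * lmG i i 0) 1
  | diagMP (i : Fin 2) : RSRel h k (lmG i i 0 * lpG i i 0) 1
  /- `R(z/w)L₁^+(z)L₂^+(w) = L₂^+(w)L₁^+(z)R(z/w)`, coefficient of `z^α w^β`. -/
  | RLLpp (i a j b : Fin 2) (α β : ℤ) : RSRel h k
      (∑ kk : Fin 2, ∑ c : Fin 2, ∑ m ∈ Finset.range (α.toNat + 1),
        RC h (i, a) (kk, c) m • (lpG kk j (α - m) * lpG c b (β + m)))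
      (∑ kk : Fin 2, ∑ c : Fin 2, ∑ m ∈ Finset.range (α.toNat + 1),
        RC h (kk, c) (j, b) m • (lpG a c (β + m) * lpG i kk (α - m)))
  /- `R(z/w)L₁^−(z)L₂^−(w) = L₂^−(w)L₁^−(z)R(z/w)`, coefficient of `z^{−α} w^{−β}`. -/
  | RLLmm (i a j b : Fin 2) (α β : ℤ) : RSRel h k
      (∑ kk : Fin 2, ∑ c : Fin 2, ∑ m ∈ Finset.range (β.toNat + 1),
        RC h (i, a) (kk, c) m • (lmG kk j (α + m) * lmG c b (β - m)))
      (∑ kk : Fin 2, ∑ c : Fin 2, ∑ m ∈ Finset.range (β.toNat + 1),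
        RC h (kk, c) (j, b) m • (lmG a c (β - m) * lmG i kk (α + m)))
  /- `R((z/w)q^{−k})L₁^+(z)L₂^−(w) = L₂^−(w)L₁^+(z)R((z/w)q^{k})`,
     coefficient of `z^α w^{−β}`. -/
  | RLLpm (i a j b : Fin 2) (α β : ℤ) : RSRel h k
      (∑ kk : Fin 2, ∑ c : Fin 2, ∑ m ∈ Finset.range ((min α β).toNat + 1),
        (Complex.exp (-(h * k) * (m : ℂ)) * RC h (i, a) (kk, c) m) •
          (lpG kk j (α - m) * lmG c b (β - m)))
      (∑ kk : Fin 2, ∑ c : Fin 2, ∑ m ∈ Finset.range ((min α β).toNat + 1),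
        (Complex.exp ((h * k) * (m : ℂ)) * RC h (kk, c) (j, b) m) •
          (lmG a c (β - m) * lpG i kk (α - m)))

/-- `U'_h(ĝl₂)_k`: the quotient of the free algebra by the defining relations. -/
abbrev Uhgl2RS (h k : ℂ) := RingQuot (RSRel h k)

/-- The canonical projection `RSFA → U'_h(ĝl₂)_k`. -/
def rsMk (h k : ℂ) : RSFA →ₐ[ℂ] Uhgl2RS h k := RingQuot.mkAlgHom ℂ (RSRel h k)

/-- Coefficients of `l^+_{11}(z)⁻¹` (formal inverse, with `l^+_{11}[0]⁻¹ = l^−_{11}[0]`). -/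
def invLp11 : ℕ → RSFA := seriesInv (fun n => lpG 0 0 (n : ℤ)) (lmG 0 0 0)

/-- Coefficients of `l^−_{11}(z)⁻¹` (formal inverse, with `l^−_{11}[0]⁻¹ = l^+_{11}[0]`). -/
def invLm11 : ℕ → RSFA := seriesInv (fun n => lmG 0 0 (n : ℤ)) (lpG 0 0 0)

/-- The coefficient of `zⁿ` in `l^+_{22}(z) − l^+_{21}(z)·l^+_{11}(z)⁻¹·l^+_{12}(z)`. -/
def kk2p (n : ℕ) : RSFA :=
  lpG 1 1 (n : ℤ) - ∑ a ∈ Finset.range (n + 1), ∑ b ∈ Finset.range (n + 1 - a),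
    lpG 1 0 (a : ℤ) * invLp11 b * lpG 0 1 ((n : ℤ) - a - b)

/-- The coefficient of `z⁻ⁿ` in `l^−_{22}(z) − l^−_{21}(z)·l^−_{11}(z)⁻¹·l^−_{12}(z)`. -/
def kk2m (n : ℕ) : RSFA :=
  lmG 1 1 (n : ℤ) - ∑ a ∈ Finset.range (n + 1), ∑ b ∈ Finset.range (n + 1 - a),
    lmG 1 0 (a : ℤ) * invLm11 b * lmG 0 1 ((n : ℤ) - a - b)

/-- The coefficient of `zⁿ` in
`l^+_{11}(zq²)·(l^+_{22}(z) − l^+_{21}(z)l^+_{11}(z)⁻¹l^+_{12}(z)) − 1`. -/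
def Dp (h : ℂ) (n : ℕ) : RSFA :=
  (∑ j ∈ Finset.range (n + 1),
      Complex.exp (2 * h * (j : ℂ)) • (lpG 0 0 (j : ℤ) * kk2p (n - j)))
    - (if n = 0 then 1 else 0)

/-- The coefficient of `z⁻ⁿ` in
`l^−_{11}(zq²)·(l^−_{22}(z) − l^−_{21}(z)l^−_{11}(z)⁻¹l^−_{12}(z)) − 1`. -/
def Dm (h : ℂ) (n : ℕ) : RSFA :=
  (∑ j ∈ Finset.range (n + 1),
      Complex.exp (-2 * h * (j : ℂ)) • (lmG 0 0 (j : ℤ) * kk2m (n - j)))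
    - (if n = 0 then 1 else 0)

/-- The coefficient of `zⁿ` in the Gauss component `e^+(z) = l^+_{21}(z)·l^+_{11}(z)⁻¹`. -/
def epRS (n : ℕ) : RSFA :=
  ∑ j ∈ Finset.range (n + 1), lpG 1 0 (j : ℤ) * invLp11 (n - j)

/-- The coefficient of `z⁻ⁿ` in the Gauss component `e^−(z) = l^−_{21}(z)·l^−_{11}(z)⁻¹`. -/
def emRS (n : ℕ) : RSFA :=
  ∑ j ∈ Finset.range (n + 1), lmG 1 0 (j : ℤ) * invLm11 (n - j)

/-- The coefficient of `zⁿ` in the Gauss component `f^+(z) = l^+_{11}(z)⁻¹·l^+_{12}(z)`. -/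
def fpRS (n : ℕ) : RSFA :=
  ∑ j ∈ Finset.range (n + 1), invLp11 j * lpG 0 1 ((n : ℤ) - j)

/-- The coefficient of `z⁻ⁿ` in the Gauss component `f^−(z) = l^−_{11}(z)⁻¹·l^−_{12}(z)`. -/
def fmRS (n : ℕ) : RSFA :=
  ∑ j ∈ Finset.range (n + 1), invLm11 j * lmG 0 1 ((n : ℤ) - j)

section Proof

open PowerSeries (X C coeff constantCoeff)
open scoped PowerSeries

/-- The polynomial part of a six-vertex `R`-matrix, with coefficients in a commutative ring. -/
structure SixVertex (R : Type*) [CommRing R] where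
  (α α' β γ δ : R)
  det : β * β - γ * δ = α * α'

/-- The entries of a six-vertex `R`-matrix. -/
def SixVertex.ent {R : Type*} [CommRing R] (M : SixVertex R) (x y : Fin 2 × Fin 2) : R :=
  if x = y then (if x.1 = x.2 then M.α else M.β)
  else if x = ((0 : Fin 2), (1 : Fin 2)) ∧ y = ((1 : Fin 2), (0 : Fin 2)) then M.γ
  else if x = ((1 : Fin 2), (0 : Fin 2)) ∧ y = ((0 : Fin 2), (1 : Fin 2)) then M.δ
  else 0

/-- The matrix with Gauss components `k₁`, `e`, `f`, `k₂`. -/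
def gaussMat {B : Type*} [Ring B] (k₁ e f k₂ : B) (i j : Fin 2) : B :=
  if i = 0 then (if j = 0 then k₁ else k₁ * f) else (if j = 0 then e * k₁ else k₂ + e * k₁ * f)

section Abstract

variable {R B : Type*} [CommRing R] [Ring B] [Algebra R B]

/-- The exchange relation `φ R L₁ L'₂ = φ' L'₂ L₁ R'`. -/
def RLL (p p' : R) (M M' : SixVertex R) (l l' : Fin 2 → Fin 2 → B) : Prop :=
  ∀ i a j b, p • ∑ kk, ∑ c, M.ent (i, a) (kk, c) • (l kk j * l' c b) =
    p' • ∑ kk, ∑ c, M'.ent (kk, c) (j, b) • (l' a c * l i kk)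

/-- The exchange relations between the Gauss components of two generating matrices. -/
structure GaussRel (p p' : R) (M M' : SixVertex R) (k₁ e f k₂ k₁' e' f' k₂' : B) : Prop where
  h11 : (p * M.α) • (k₁ * k₁') = (p' * M'.α) • (k₁' * k₁)
  h12 : (p * M.β) • (k₁ * k₂') = (p' * M'.β) • (k₂' * k₁)
  h21 : (p * M.α * M.α' * M'.β) • (k₂ * k₁') = (p' * M'.α * M'.α' * M.β) • (k₁' * k₂)
  h22 : (p * M.α) • (k₂ * k₂') = (p' * M'.α) • (k₂' * k₂)
  e1 : M.β • (k₁ * e') = M.α • (e' * k₁) - M.γ • (e * k₁)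
  e1' : M.β • (k₁' * e) = M.α' • (e * k₁') + M.δ • (e' * k₁')
  e2 : M.β • (k₂ * e') = M.α' • (e' * k₂) + M.γ • (e * k₂)
  e2' : M.β • (k₂' * e) = M.α • (e * k₂') - M.δ • (e' * k₂')
  f1 : M'.β • (f' * k₁) = M'.α • (k₁ * f') - M'.δ • (k₁ * f)
  f1' : M'.β • (f * k₁') = M'.α' • (k₁' * f) + M'.γ • (k₁' * f')
  f2 : M'.β • (f' * k₂) = M'.α' • (k₂ * f') + M'.δ • (k₂ * f)
  f2' : M'.β • (f * k₂') = M'.α • (k₂' * f) - M'.γ • (k₂' * f')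
  ee : M.α • (e * e') - M.γ • (e * e) = M.α' • (e' * e) + M.δ • (e' * e')
  ff : M'.α • (f' * f) - M'.δ • (f * f) = M'.α' • (f * f') + M'.γ • (f' * f')
  ef : (p' * M'.β) • (k₁' * (e * f' - f' * e) * k₁) =
    (p' * M'.δ) • (k₁' * k₂) - (p * M.δ) • (k₁ * k₂')
  fe : (p * M.β) • (k₁ * (f * e' - e' * f) * k₁') =
    (p' * M'.γ) • (k₂' * k₁) - (p * M.γ) • (k₂ * k₁')

variable {p p' : R} {M M' : SixVertex R} {k₁ e f k₂ k₁' e' f' k₂' : B}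

lemma cancel_left {c : R} (hc : IsSMulRegular B c) {u x y : B} (hu : IsUnit u)
    (h : c • (u * x) = c • (u * y)) : x = y := hu.mul_left_cancel (hc h)

lemma cancel_right {c : R} (hc : IsSMulRegular B c) {u x y : B} (hu : IsUnit u)
    (h : c • (x * u) = c • (y * u)) : x = y := hu.mul_right_cancel (hc h)

set_option maxHeartbeats 1000000 in
theorem GaussRel.of_RLL (h : RLL p p' M M' (gaussMat k₁ e f k₂) (gaussMat k₁' e' f' k₂'))
    (hk : IsUnit k₁) (hk' : IsUnit k₁')
    (hp : IsSMulRegular B p) (hp' : IsSMulRegular B p')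
    (hα : IsSMulRegular B M.α) (hα' : IsSMulRegular B M'.α) (hβ' : IsSMulRegular B M'.β)
    (hβ : IsSMulRegular B M.β) :
    GaussRel p p' M M' k₁ e f k₂ k₁' e' f' k₂' := by
  obtain ⟨α, α', β, γ, δ, hd⟩ := M
  obtain ⟨a, a', b, g, d, hd'⟩ := M'
  have r11_11 := h 0 0 0 0
  have r12_11 := h 0 1 0 0
  have r21_11 := h 1 0 0 0
  have r22_11 := h 1 1 0 0
  have r11_12 := h 0 0 0 1
  have r12_12 := h 0 1 0 1
  have r21_12 := h 1 0 0 1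
  have r22_12 := h 1 1 0 1
  have r11_21 := h 0 0 1 0
  have r12_21 := h 0 1 1 0
  have r21_21 := h 1 0 1 0
  have r22_21 := h 1 1 1 0
  have r11_22 := h 0 0 1 1
  have r12_22 := h 0 1 1 1
  have r21_22 := h 1 0 1 1
  have r22_22 := h 1 1 1 1
  clear h
  simp [SixVertex.ent, gaussMat] at r11_11 r12_11 r21_11 r22_11 r11_12 r12_12 r21_12 r22_12 r11_21 r12_21 r21_21 r22_21 r11_22 r12_22 r21_22 r22_22
  simp only at hα hα' hβ hβ'
  have h11 : (p * α) • (k₁ * k₁') = (p' * a) • (k₁' * k₁) := by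
    linear_combination (norm := module) r11_11
  have e1 : β • (k₁ * e') = α • (e' * k₁) - γ • (e * k₁) := by
    refine cancel_right hp hk' ?_
    linear_combination (norm := skip) r12_11 - e' * h11
    simp only [mul_add, add_mul, mul_sub, sub_mul, smul_add, smul_sub, mul_smul_comm,
      smul_mul_assoc, mul_assoc, smul_smul]
    module
  have e1' : β • (k₁' * e) = α' • (e * k₁') + δ • (e' * k₁') := by
    refine cancel_right (hp'.mul hα') hk ?_
    linear_combination (norm := skip) -(β • r21_11) + (p * δ) • (e1 * k₁') + α' • (e * h11)
      + δ • (e' * h11) + (p * hd) • (e * (k₁ * k₁'))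
    simp only [mul_add, add_mul, mul_sub, sub_mul, smul_add, smul_sub, mul_smul_comm,
      smul_mul_assoc, mul_assoc, smul_smul]
    module
  have f1 : b • (f' * k₁) = a • (k₁ * f') - d • (k₁ * f) := by
    refine cancel_left hp' hk' ?_
    linear_combination (norm := skip) h11 * f' - r11_12
    simp only [mul_add, add_mul, mul_sub, sub_mul, smul_add, smul_sub, mul_smul_comm,
      smul_mul_assoc, mul_assoc, smul_smul]
    module
  have f1' : b • (f * k₁') = a' • (k₁' * f) + g • (k₁' * f') := by
    refine cancel_left (hp.mul hα) hk ?_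
    linear_combination (norm := skip) b • r11_21 + (p' * g) • (k₁' * f1) - a' • (h11 * f)
      - g • (h11 * f') + (p' * hd') • (k₁' * (k₁ * f))
    simp only [mul_add, add_mul, mul_sub, sub_mul, smul_add, smul_sub, mul_smul_comm,
      smul_mul_assoc, mul_assoc, smul_smul]
    module
  have ee : α • (e * e') - γ • (e * e) = α' • (e' * e) + δ • (e' * e') := by
    refine cancel_right (hp.mul hα) (hk.mul hk') ?_
    linear_combination (norm := skip) β • r22_11 - (p * α) • (e * e1 * k₁')
      + (p' * a) • (e' * e1' * k₁) - (α' • (e' * e) + δ • (e' * e')) * h11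
    simp only [mul_add, add_mul, mul_sub, sub_mul, smul_add, smul_sub, mul_smul_comm,
      smul_mul_assoc, mul_assoc, smul_smul]
    module
  have ff : a • (f' * f) - d • (f * f) = a' • (f * f') + g • (f' * f') := by
    refine cancel_left (hp'.mul hα') (hk'.mul hk) ?_
    linear_combination (norm := skip) -(p' * a) • (k₁' * f1 * f) - b • r11_22
      + (p * α) • (k₁ * f1' * f') + h11 * (a' • (f * f') + g • (f' * f'))
    simp only [mul_add, add_mul, mul_sub, sub_mul, smul_add, smul_sub, mul_smul_comm,
      smul_mul_assoc, mul_assoc, smul_smul]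
    module
  have h12 : (p * β) • (k₁ * k₂') = (p' * b) • (k₂' * k₁) := by
    linear_combination (norm := skip) r12_12 - p • (e1 * k₁' * f') - e' * h11 * f'
      + p' • (e' * k₁' * f1)
    simp only [mul_add, add_mul, mul_sub, sub_mul, smul_add, smul_sub, mul_smul_comm,
      smul_mul_assoc, mul_assoc, smul_smul]
    module
  have ef : (p' * b) • (k₁' * (e * f' - f' * e) * k₁) =
      (p' * d) • (k₁' * k₂) - (p * δ) • (k₁ * k₂') := by
    linear_combination (norm := skip) r21_12 - r21_11 * f' + p' • (k₁' * e * f1)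
    simp only [mul_add, add_mul, mul_sub, sub_mul, smul_add, smul_sub, mul_smul_comm,
      smul_mul_assoc, mul_assoc, smul_smul]
    module
  have fe : (p * β) • (k₁ * (f * e' - e' * f) * k₁') =
      (p' * g) • (k₂' * k₁) - (p * γ) • (k₂ * k₁') := by
    linear_combination (norm := skip) r12_21 - e' * r11_21 - p • (e1 * f * k₁')
    simp only [mul_add, add_mul, mul_sub, sub_mul, smul_add, smul_sub, mul_smul_comm,
      smul_mul_assoc, mul_assoc, smul_smul]
    module
  have e20 : (p' * b) • (k₂' * e * k₁) = p • ((α • e - δ • e') * (k₁ * k₂')) := by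
    linear_combination (norm := skip) -r22_12 + r22_11 * f' - p' • (e' * k₁' * e * f1) + e' * ef
    simp only [mul_add, add_mul, mul_sub, sub_mul, smul_add, smul_sub, mul_smul_comm,
      smul_mul_assoc, mul_assoc, smul_smul]
    module
  have e2' : β • (k₂' * e) = α • (e * k₂') - δ • (e' * k₂') := by
    refine cancel_right (hp'.mul hβ') hk ?_
    linear_combination (norm := skip) β • e20 + (α • e - δ • e') * h12
    simp only [mul_add, add_mul, mul_sub, sub_mul, smul_add, smul_sub, mul_smul_comm,
      smul_mul_assoc, mul_assoc, smul_smul]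
    module
  have f20 : (p * β) • (k₁ * f * k₂') = p' • (k₂' * k₁ * (a • f - g • f')) := by
    linear_combination (norm := skip) r12_22 - e' * r11_22 - p • (e1 * f * k₁' * f') - fe * f'
    simp only [mul_add, add_mul, mul_sub, sub_mul, smul_add, smul_sub, mul_smul_comm,
      smul_mul_assoc, mul_assoc, smul_smul]
    module
  have f2' : b • (f * k₂') = a • (k₂' * f) - g • (k₂' * f') := by
    refine cancel_left (hp.mul hβ) hk ?_
    linear_combination (norm := skip) b • f20 - h12 * (a • f - g • f')
    simp only [mul_add, add_mul, mul_sub, sub_mul, smul_add, smul_sub, mul_smul_comm,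
      smul_mul_assoc, mul_assoc, smul_smul]
    module
  have h21 : (p * α * α' * b) • (k₂ * k₁') = (p' * a * a' * β) • (k₁' * k₂) := by
    linear_combination (norm := skip) b • (β • r21_21 - δ • fe - (p * δ) • (e1 * f * k₁')
      - (α' • e + δ • e') * r11_21 + p' • (e1' * (b • (k₁ * f) + g • (f' * k₁))))
      - (β * g) • ef + (δ * g) • h12 - (p * b) • (hd • (k₂ * k₁' + e * k₁ * f * k₁'))
      + (p' * β) • (hd' • (k₁' * k₂))
    simp only [mul_add, add_mul, mul_sub, sub_mul, smul_add, smul_sub, mul_smul_comm,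
      smul_mul_assoc, mul_assoc, smul_smul]
    module
  have e2 : β • (k₂ * e') = α' • (e' * k₂) + γ • (e * k₂) := by
    refine cancel_right ((hp.mul hα).mul hβ') hk' ?_
    linear_combination (norm := skip) (b * β) • r22_21 - (α * b) • (e * fe) - (p * α * b) • (e * e1 * f * k₁')
      - (p * α * b) • (ee * k₁ * f * k₁') - b • ((α' • (e' * e) + δ • (e' * e')) * r11_21)
      + (p' * b) • (e' * e1' * (b • (k₁ * f) + g • (f' * k₁))) - (β * g) • (e' * ef) + (p' * b * g) • (e2' * k₁)
      + (δ * g) • (e' * h12) - e' * h21 + (p' * β) • (hd' • (e' * k₁' * k₂))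
    simp only [mul_add, add_mul, mul_sub, sub_mul, smul_add, smul_sub, mul_smul_comm,
      smul_mul_assoc, mul_assoc, smul_smul]
    module
  have f2 : b • (f' * k₂) = a' • (k₂ * f') + d • (k₂ * f) := by
    refine cancel_left (hp'.mul hα') hk' ?_
    linear_combination (norm := skip) -b • r21_22 + b • (r21_21 * f') + (p * δ) • (k₁ * f2')
      + (ef * (a • f - g • f'))
      + (p' * g) • (k₁' * e * f1 * f') - (p' * a) • (k₁' * e * f1 * f)
      - (p' * a) • (k₁' * e * k₁ * ff) + hd' • (p' • (k₁' * k₂ * f' + k₁' * e * k₁ * f * f'))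
    simp only [mul_add, add_mul, mul_sub, sub_mul, smul_add, smul_sub, mul_smul_comm,
      smul_mul_assoc, mul_assoc, smul_smul]
    module
  have h22 : (p * α) • (k₂ * k₂') = (p' * a) • (k₂' * k₂) := by
    refine hβ' ?_
    linear_combination (norm := skip) b • (r22_22 - r22_21 * f' - e' * r21_22 + e' * r21_21 * f')
      - p • ((α • e - δ • e') * k₁ * f2') + e20 * (a • f - g • f')
    simp only [mul_add, add_mul, mul_sub, sub_mul, smul_add, smul_sub, mul_smul_comm,
      smul_mul_assoc, mul_assoc, smul_smul]
    module
  exact ⟨h11, h12, h21, h22, e1, e1', e2, e2', f1, f1', f2, f2', ee, ff, ef, fe⟩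

set_option maxHeartbeats 1000000 in
theorem GaussRel.to_RLL (H : GaussRel p p' M M' k₁ e f k₂ k₁' e' f' k₂')
    (hβ' : IsSMulRegular B M'.β) (hβ : IsSMulRegular B M.β) :
    RLL p p' M M' (gaussMat k₁ e f k₂) (gaussMat k₁' e' f' k₂') := by
  obtain ⟨α, α', β, γ, δ, hd⟩ := M
  obtain ⟨a, a', b, g, d, hd'⟩ := M'
  obtain ⟨h11, h12, h21, h22, e1, e1', e2, e2', f1, f1', f2, f2', ee, ff, ef, fe⟩ := H
  simp only at h11 h12 h21 h22 e1 e1' e2 e2' f1 f1' f2 f2' ee ff ef fe hβ hβ'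
  have e20 : (p' * b) • (k₂' * e * k₁) = p • ((α • e - δ • e') * (k₁ * k₂')) := by
    refine hβ ?_
    linear_combination (norm := skip) (p' * b) • (e2' * k₁) - (α • e - δ • e') * h12
    simp only [mul_add, add_mul, mul_sub, sub_mul, smul_add, smul_sub, mul_smul_comm,
      smul_mul_assoc, mul_assoc, smul_smul]
    module
  have f20 : (p * β) • (k₁ * f * k₂') = p' • (k₂' * k₁ * (a • f - g • f')) := by
    refine hβ' ?_
    linear_combination (norm := skip) (p * β) • (k₁ * f2') + h12 * (a • f - g • f')
    simp only [mul_add, add_mul, mul_sub, sub_mul, smul_add, smul_sub, mul_smul_comm,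
      smul_mul_assoc, mul_assoc, smul_smul]
    module
  have r11_11 : p • α • (k₁ * k₁') =
      p' • a • (k₁' * k₁) := by
    linear_combination (norm := skip) h11
    simp only [mul_add, add_mul, mul_sub, sub_mul, smul_add, smul_sub, mul_smul_comm,
      smul_mul_assoc, mul_assoc, smul_smul]
    module
  have r12_11 : p • β • (k₁ * (e' * k₁')) + p • γ • (e * k₁ * k₁') =
      p' • a • (e' * k₁' * k₁) := by
    linear_combination (norm := skip) p • (e1 * k₁') + e' * h11
    simp only [mul_add, add_mul, mul_sub, sub_mul, smul_add, smul_sub, mul_smul_comm,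
      smul_mul_assoc, mul_assoc, smul_smul]
    module
  have r11_12 : p • α • (k₁ * (k₁' * f')) =
      p' • b • (k₁' * f' * k₁) + p' • d • (k₁' * (k₁ * f)) := by
    linear_combination (norm := skip) h11 * f' - p' • (k₁' * f1)
    simp only [mul_add, add_mul, mul_sub, sub_mul, smul_add, smul_sub, mul_smul_comm,
      smul_mul_assoc, mul_assoc, smul_smul]
    module
  have r21_11 : p • δ • (k₁ * (e' * k₁')) + p • β • (e * k₁ * k₁') =
      p' • a • (k₁' * (e * k₁)) := by
    refine (hβ) ?_
    linear_combination (norm := skip) (p * δ) • (e1 * k₁') + α' • (e * h11) + δ • (e' * h11) + (p * hd) • (e * (k₁ * k₁')) - (p' * a) • (e1' * k₁)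
    simp only [mul_add, add_mul, mul_sub, sub_mul, smul_add, smul_sub, mul_smul_comm,
      smul_mul_assoc, mul_assoc, smul_smul]
    module
  have r11_21 : p • α • (k₁ * f * k₁') =
      p' • g • (k₁' * f' * k₁) + p' • b • (k₁' * (k₁ * f)) := by
    refine (hβ') ?_
    linear_combination (norm := skip) (p * α) • (k₁ * f1') - ((p' * g) • (k₁' * f1) - a' • (h11 * f) - g • (h11 * f') + (p' * hd') • (k₁' * (k₁ * f)))
    simp only [mul_add, add_mul, mul_sub, sub_mul, smul_add, smul_sub, mul_smul_comm,
      smul_mul_assoc, mul_assoc, smul_smul]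
    module
  have r22_11 : p • α • (e * k₁ * (e' * k₁')) =
      p' • a • (e' * k₁' * (e * k₁)) := by
    refine (hβ) ?_
    linear_combination (norm := skip) (p * α) • (ee * (k₁ * k₁')) + ((p * α) • (e * e1 * k₁') - (p' * a) • (e' * e1' * k₁) + (α' • (e' * e) + δ • (e' * e')) * h11)
    simp only [mul_add, add_mul, mul_sub, sub_mul, smul_add, smul_sub, mul_smul_comm,
      smul_mul_assoc, mul_assoc, smul_smul]
    module
  have r11_22 : p • α • (k₁ * f * (k₁' * f')) =
      p' • a • (k₁' * f' * (k₁ * f)) := by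
    refine (hβ') ?_
    linear_combination (norm := skip) -((p' * a) • (k₁' * k₁ * ff)) + (-(p' * a) • (k₁' * f1 * f) + (p * α) • (k₁ * f1' * f') + h11 * (a' • (f * f') + g • (f' * f')))
    simp only [mul_add, add_mul, mul_sub, sub_mul, smul_add, smul_sub, mul_smul_comm,
      smul_mul_assoc, mul_assoc, smul_smul]
    module
  have r12_12 : p • β • (k₁ * (k₂' + e' * k₁' * f')) + p • γ • (e * k₁ * (k₁' * f')) =
      p' • b • ((k₂' + e' * k₁' * f') * k₁) + p' • d • (e' * k₁' * (k₁ * f)) := by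
    linear_combination (norm := skip) h12 + p • (e1 * k₁' * f') + e' * h11 * f' - p' • (e' * k₁' * f1)
    simp only [mul_add, add_mul, mul_sub, sub_mul, smul_add, smul_sub, mul_smul_comm,
      smul_mul_assoc, mul_assoc, smul_smul]
    module
  have r21_12 : p • δ • (k₁ * (k₂' + e' * k₁' * f')) + p • β • (e * k₁ * (k₁' * f')) =
      p' • b • (k₁' * f' * (e * k₁)) + p' • d • (k₁' * (k₂ + e * k₁ * f)) := by
    linear_combination (norm := skip) ef + r21_11 * f' - p' • (k₁' * e * f1)
    simp only [mul_add, add_mul, mul_sub, sub_mul, smul_add, smul_sub, mul_smul_comm,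
      smul_mul_assoc, mul_assoc, smul_smul]
    module
  have r12_21 : p • β • (k₁ * f * (e' * k₁')) + p • γ • ((k₂ + e * k₁ * f) * k₁') =
      p' • g • ((k₂' + e' * k₁' * f') * k₁) + p' • b • (e' * k₁' * (k₁ * f)) := by
    linear_combination (norm := skip) fe + e' * r11_21 + p • (e1 * f * k₁')
    simp only [mul_add, add_mul, mul_sub, sub_mul, smul_add, smul_sub, mul_smul_comm,
      smul_mul_assoc, mul_assoc, smul_smul]
    module
  have r22_12 : p • α • (e * k₁ * (k₂' + e' * k₁' * f')) =
      p' • b • ((k₂' + e' * k₁' * f') * (e * k₁)) + p' • d • (e' * k₁' * (k₂ + e * k₁ * f)) := by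
    linear_combination (norm := skip) -e20 + r22_11 * f' - p' • (e' * k₁' * e * f1) + e' * ef
    simp only [mul_add, add_mul, mul_sub, sub_mul, smul_add, smul_sub, mul_smul_comm,
      smul_mul_assoc, mul_assoc, smul_smul]
    module
  have r12_22 : p • β • (k₁ * f * (k₂' + e' * k₁' * f')) + p • γ • ((k₂ + e * k₁ * f) * (k₁' * f')) =
      p' • a • ((k₂' + e' * k₁' * f') * (k₁ * f)) := by
    linear_combination (norm := skip) f20 + e' * r11_22 + p • (e1 * f * k₁' * f') + fe * f'
    simp only [mul_add, add_mul, mul_sub, sub_mul, smul_add, smul_sub, mul_smul_comm,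
      smul_mul_assoc, mul_assoc, smul_smul]
    module
  have r21_21 : p • δ • (k₁ * f * (e' * k₁')) + p • β • ((k₂ + e * k₁ * f) * k₁') =
      p' • g • (k₁' * f' * (e * k₁)) + p' • b • (k₁' * (k₂ + e * k₁ * f)) := by
    refine (hβ'.mul hβ) ?_
    linear_combination (norm := skip) h21 + b • (δ • fe + (p * δ) • (e1 * f * k₁')
      + (α' • e + δ • e') * r11_21 - p' • (e1' * (b • (k₁ * f) + g • (f' * k₁))))
      + (β * g) • ef - (δ * g) • h12 + (p * b) • (hd • (k₂ * k₁' + e * k₁ * f * k₁'))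
      - (p' * β) • (hd' • (k₁' * k₂))
    simp only [mul_add, add_mul, mul_sub, sub_mul, smul_add, smul_sub, mul_smul_comm,
      smul_mul_assoc, mul_assoc, smul_smul]
    module
  have r22_21 : p • α • ((k₂ + e * k₁ * f) * (e' * k₁')) =
      p' • g • ((k₂' + e' * k₁' * f') * (e * k₁)) + p' • b • (e' * k₁' * (k₂ + e * k₁ * f)) := by
    refine (hβ'.mul hβ) ?_
    linear_combination (norm := skip) (p * α * b) • (e2 * k₁') + (α * b) • (e * fe) + (p * α * b) • (e * e1 * f * k₁')
      + (p * α * b) • (ee * k₁ * f * k₁') + b • ((α' • (e' * e) + δ • (e' * e')) * r11_21)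
      - (p' * b) • (e' * e1' * (b • (k₁ * f) + g • (f' * k₁))) + (β * g) • (e' * ef) - (p' * b * g) • (e2' * k₁)
      - (δ * g) • (e' * h12) + e' * h21 - (p' * β) • (hd' • (e' * k₁' * k₂))
    simp only [mul_add, add_mul, mul_sub, sub_mul, smul_add, smul_sub, mul_smul_comm,
      smul_mul_assoc, mul_assoc, smul_smul]
    module
  have r21_22 : p • δ • (k₁ * f * (k₂' + e' * k₁' * f')) + p • β • ((k₂ + e * k₁ * f) * (k₁' * f')) =
      p' • a • (k₁' * f' * (k₂ + e * k₁ * f)) := by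
    refine (hβ') ?_
    linear_combination (norm := skip) -((p' * a) • (k₁' * f2)) + b • (r21_21 * f') + (p * δ) • (k₁ * f2')
      + (ef * (a • f - g • f'))
      + (p' * g) • (k₁' * e * f1 * f') - (p' * a) • (k₁' * e * f1 * f)
      - (p' * a) • (k₁' * e * k₁ * ff) + hd' • (p' • (k₁' * k₂ * f' + k₁' * e * k₁ * f * f'))
    simp only [mul_add, add_mul, mul_sub, sub_mul, smul_add, smul_sub, mul_smul_comm,
      smul_mul_assoc, mul_assoc, smul_smul]
    module
  have r22_22 : p • α • ((k₂ + e * k₁ * f) * (k₂' + e' * k₁' * f')) =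
      p' • a • ((k₂' + e' * k₁' * f') * (k₂ + e * k₁ * f)) := by
    refine (hβ') ?_
    linear_combination (norm := skip) b • (h22 + r22_21 * f' + e' * r21_22 - e' * r21_21 * f')
      + p • ((α • e - δ • e') * k₁ * f2') - e20 * (a • f - g • f')
    simp only [mul_add, add_mul, mul_sub, sub_mul, smul_add, smul_sub, mul_smul_comm,
      smul_mul_assoc, mul_assoc, smul_smul]
    module
  intro i x j y
  fin_cases i <;> fin_cases x <;> fin_cases j <;> fin_cases y <;>
    simpa [SixVertex.ent, gaussMat]
end Abstract

section Series

variable {A : Type*} [Ring A]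

/-- The coefficients of a power series, extended by zero to negative indices. -/
def zc (P : A⟦X⟧) (n : ℤ) : A := if 0 ≤ n then coeff n.toNat P else 0

lemma zc_natCast (P : A⟦X⟧) (n : ℕ) : zc P n = coeff n P := by simp [zc]

lemma zc_zero_index (P : A⟦X⟧) : zc P 0 = constantCoeff P := by simp [zc]

lemma zc_of_neg (P : A⟦X⟧) {n : ℤ} (hn : n < 0) : zc P n = 0 := by simp [zc, hn]

lemma zc_mk (s : ℕ → A) (n : ℤ) : zc (PowerSeries.mk s) n = if 0 ≤ n then s n.toNat else 0 := by
  simp [zc]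

lemma zc_add (P Q : A⟦X⟧) (n : ℤ) : zc (P + Q) n = zc P n + zc Q n := by
  unfold zc; split_ifs <;> simp

lemma zc_sub (P Q : A⟦X⟧) (n : ℤ) : zc (P - Q) n = zc P n - zc Q n := by
  unfold zc; split_ifs <;> simp

lemma zc_neg (P : A⟦X⟧) (n : ℤ) : zc (-P) n = -zc P n := by
  unfold zc; split_ifs <;> simp

lemma zc_zero (n : ℤ) : zc (0 : A⟦X⟧) n = 0 := by
  unfold zc; split_ifs <;> simp

lemma zc_C_mul (a : A) (P : A⟦X⟧) (n : ℤ) : zc (C a * P) n = a * zc P n := by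
  unfold zc; split_ifs <;> simp

lemma zc_mul_C (a : A) (P : A⟦X⟧) (n : ℤ) : zc (P * C a) n = zc P n * a := by
  unfold zc; split_ifs <;> simp

lemma zc_C (a : A) (n : ℤ) : zc (C a) n = if n = 0 then a else 0 := by
  unfold zc
  rcases lt_trichotomy n 0 with hn | rfl | hn
  · simp [hn, hn.ne]
  · simp
  · rw [if_pos hn.le, if_neg hn.ne', PowerSeries.coeff_C, if_neg (by omega)]

lemma zc_X_mul (P : A⟦X⟧) (n : ℤ) : zc (X * P) n = zc P (n - 1) := by
  rcases lt_trichotomy n 0 with hn | rfl | hn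
  · rw [zc_of_neg _ hn, zc_of_neg _ (by omega)]
  · rw [zc_of_neg P (show (0 : ℤ) - 1 < 0 by omega)]; simp [zc]
  · obtain ⟨m, rfl⟩ : ∃ m : ℕ, n = (m + 1 : ℕ) := ⟨(n - 1).toNat, by omega⟩
    rw [zc_natCast, PowerSeries.coeff_succ_X_mul, ← zc_natCast]; push_cast; simp

lemma zc_ext {P Q : A⟦X⟧} (h : ∀ n : ℤ, zc P n = zc Q n) : P = Q := by
  ext n; simpa [zc_natCast] using h n

/-- Sums of a function over `0, …, n`, empty for negative `n`. -/
def zsum {M : Type*} [AddCommMonoid M] (n : ℤ) (s : ℤ → M) : M := ∑ i ∈ Finset.Icc 0 n, s i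

lemma zsum_natCast {M : Type*} [AddCommMonoid M] (n : ℕ) (s : ℤ → M) :
    zsum n s = ∑ i ∈ Finset.range (n + 1), s i := by
  unfold zsum
  symm
  refine Finset.sum_bij (fun i _ => (i : ℤ)) ?_ ?_ ?_ ?_
  · intro i hi; simp only [Finset.mem_range, Finset.mem_Icc] at hi ⊢; omega
  · intro i _ j _ h; exact_mod_cast h
  · intro b hb; simp at hb
    exact ⟨b.toNat, Finset.mem_range.2 (by omega), Int.toNat_of_nonneg hb.1⟩
  · intros; rfl

lemma zsum_of_neg {M : Type*} [AddCommMonoid M] {n : ℤ} (hn : n < 0) (s : ℤ → M) :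
    zsum n s = 0 := by
  unfold zsum; rw [Finset.Icc_eq_empty (by omega), Finset.sum_empty]

lemma zc_mul (P Q : A⟦X⟧) (n : ℤ) : zc (P * Q) n = zsum n fun i => zc P i * zc Q (n - i) := by
  rcases lt_or_ge n 0 with hn | hn
  · rw [zc_of_neg _ hn, zsum_of_neg hn]
  · obtain ⟨m, rfl⟩ := Int.eq_ofNat_of_zero_le hn
    rw [zsum_natCast, zc_natCast, PowerSeries.coeff_mul,
      Finset.Nat.sum_antidiagonal_eq_sum_range_succ (fun i j => coeff i P * coeff j Q)]
    refine Finset.sum_congr rfl fun i hi => ?_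
    simp at hi
    rw [zc_natCast, show (m : ℤ) - i = ((m - i : ℕ) : ℤ) by omega, zc_natCast]

lemma zc_map {A' : Type*} [Ring A'] (g : A →+* A') (P : A⟦X⟧) (n : ℤ) :
    zc (PowerSeries.map g P) n = g (zc P n) := by
  unfold zc; split_ifs <;> simp

variable (A) in
/-- Power series in two commuting variables over a possibly noncommutative ring. -/
def BiSeries : Type _ := A⟦X⟧⟦X⟧

instance : Ring (BiSeries A) := inferInstanceAs (Ring A⟦X⟧⟦X⟧)

/-- The underlying iterated power series. -/
def BiSeries.out : BiSeries A →+* A⟦X⟧⟦X⟧ := RingHom.id (A⟦X⟧⟦X⟧)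

lemma BiSeries.out_injective : Function.Injective (BiSeries.out (A := A)) := fun _ _ h => h

/-- The ring of scalar power series in two variables. -/
abbrev Scal : Type := ℂ⟦X⟧⟦X⟧

/-- The embedding of scalar power series. -/
def scalMap [Algebra ℂ A] : Scal →+* BiSeries A :=
  PowerSeries.map (PowerSeries.map (algebraMap ℂ A))

lemma map_commutes {S T : Type*} [Semiring S] [Semiring T] (g : S →+* T)
    (hg : ∀ s t, g s * t = t * g s) (P : S⟦X⟧) (Q : T⟦X⟧) :
    PowerSeries.map g P * Q = Q * PowerSeries.map g P := by
  ext n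
  rw [PowerSeries.coeff_mul, PowerSeries.coeff_mul, ← Finset.Nat.sum_antidiagonal_swap]
  exact Finset.sum_congr rfl fun i _ => by simp [hg]

instance [Algebra ℂ A] : Algebra Scal (BiSeries A) :=
  RingHom.toAlgebra' scalMap
    (map_commutes _ (map_commutes _ fun s t => Algebra.commutes s t))

lemma out_smul [Algebra ℂ A] (c : Scal) (b : BiSeries A) : (c • b).out =
    PowerSeries.map (PowerSeries.map (algebraMap ℂ A)) c * b.out := rfl

/-- A series in the first variable. -/
def ser₁ : A⟦X⟧ →+* BiSeries A := PowerSeries.map C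

/-- A series in the second variable. -/
def ser₂ : A⟦X⟧ →+* BiSeries A := C

lemma out_ser₁ (P : A⟦X⟧) : (ser₁ P).out = PowerSeries.map C P := rfl

lemma out_ser₂ (P : A⟦X⟧) : (ser₂ P).out = C P := rfl

/-- The coefficient of a monomial, extended by zero to negative exponents. -/
def co (b : BiSeries A) (n m : ℤ) : A := zc (zc b.out n) m

lemma co_ext {b b' : BiSeries A} (h : ∀ n m, co b n m = co b' n m) : b = b' :=
  BiSeries.out_injective (zc_ext fun n => zc_ext fun m => h n m)

lemma co_ext_iff {b b' : BiSeries A} : b = b' ↔ ∀ n m, co b n m = co b' n m :=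
  ⟨fun h _ _ => by rw [h], co_ext⟩

lemma co_of_neg_left (b : BiSeries A) {n : ℤ} (hn : n < 0) (m : ℤ) : co b n m = 0 := by
  unfold co; rw [zc_of_neg _ hn, zc_zero]

lemma co_of_neg_right (b : BiSeries A) (n : ℤ) {m : ℤ} (hm : m < 0) : co b n m = 0 := by
  unfold co; rw [zc_of_neg _ hm]

lemma co_add (b b' : BiSeries A) (n m : ℤ) : co (b + b') n m = co b n m + co b' n m := by
  simp only [co, map_add, zc_add]

lemma co_sub (b b' : BiSeries A) (n m : ℤ) : co (b - b') n m = co b n m - co b' n m := by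
  simp only [co, map_sub, zc_sub]

lemma co_zero (n m : ℤ) : co (0 : BiSeries A) n m = 0 := by
  simp only [co, map_zero, zc_zero]

lemma co_sum {ι : Type*} (s : Finset ι) (b : ι → BiSeries A) (n m : ℤ) :
    co (∑ i ∈ s, b i) n m = ∑ i ∈ s, co (b i) n m := by
  classical
  induction s using Finset.induction_on with
  | empty => simp [co_zero]
  | insert i s hi ih => rw [Finset.sum_insert hi, Finset.sum_insert hi, co_add, ih]

lemma co_ser₁_mul_ser₂ (P Q : A⟦X⟧) (n m : ℤ) : co (ser₁ P * ser₂ Q) n m = zc P n * zc Q m := by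
  simp only [co, map_mul, out_ser₁, out_ser₂, zc_mul_C, zc_map, zc_C_mul]

lemma co_ser₂_mul_ser₁ (P Q : A⟦X⟧) (n m : ℤ) : co (ser₂ Q * ser₁ P) n m = zc Q m * zc P n := by
  simp only [co, map_mul, out_ser₁, out_ser₂, zc_mul_C, zc_map, zc_C_mul]

lemma co_ser₁ (P : A⟦X⟧) (n m : ℤ) : co (ser₁ P) n m = if m = 0 then zc P n else 0 := by
  have := co_ser₁_mul_ser₂ P 1 n m
  rw [map_one, mul_one] at this
  rw [this, show (1 : A⟦X⟧) = C 1 by simp, zc_C]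
  split_ifs <;> simp

lemma co_ser₂ (P : A⟦X⟧) (n m : ℤ) : co (ser₂ P) n m = if n = 0 then zc P m else 0 := by
  have := co_ser₁_mul_ser₂ 1 P n m
  rw [map_one, one_mul] at this
  rw [this, show (1 : A⟦X⟧) = C 1 by simp, zc_C]
  split_ifs <;> simp

/-- Constant scalars. -/
def cst : ℂ →+* Scal := (C : ℂ⟦X⟧ →+* Scal).comp C

/-- The first variable. -/
def var₁ : Scal := X

/-- The second variable. -/
def var₂ : Scal := C X

/-- A scalar power series in the product of the two variables. -/
def diagSer : ℂ⟦X⟧ →+* Scal :=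
  (PowerSeries.rescale (X : ℂ⟦X⟧)).comp (PowerSeries.map C)

section Algebra

variable [Algebra ℂ A]

lemma co_cst_smul (c : ℂ) (b : BiSeries A) (n m : ℤ) : co (cst c • b) n m = c • co b n m := by
  simp only [co, out_smul, cst, RingHom.comp_apply, PowerSeries.map_C, zc_C_mul]
  rw [Algebra.smul_def]

lemma co_var₁_smul (b : BiSeries A) (n m : ℤ) : co (var₁ • b) n m = co b (n - 1) m := by
  simp only [co, out_smul, var₁, PowerSeries.map_X, zc_X_mul]

lemma co_var₂_smul (b : BiSeries A) (n m : ℤ) : co (var₂ • b) n m = co b n (m - 1) := by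
  simp only [co, out_smul, var₂, PowerSeries.map_C, PowerSeries.map_X, zc_C_mul, zc_X_mul]

lemma diagSer_X : diagSer X = var₁ * var₂ := by
  simp [diagSer, var₁, var₂, PowerSeries.rescale_X, mul_comm]

lemma diagSer_C (c : ℂ) : diagSer (C c) = cst c := by
  ext n : 1
  simp only [diagSer, cst, RingHom.comp_apply, PowerSeries.map_C, PowerSeries.coeff_rescale,
    PowerSeries.coeff_C]
  split_ifs with hn <;> simp [hn]

lemma co_diagSer_smul (c : ℂ⟦X⟧) (b : BiSeries A) (n m : ℤ) :
    co (diagSer c • b) n m =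
      zsum (min n m) fun i => coeff i.toNat c • co b (n - i) (m - i) := by
  rcases lt_or_ge n 0 with hn | hn
  · rw [co_of_neg_left _ hn, zsum_of_neg (by omega)]
  rcases lt_or_ge m 0 with hm | hm
  · rw [co_of_neg_right _ _ hm, zsum_of_neg (by omega)]
  have key : ∀ i : ℤ, 0 ≤ i → zc (zc (PowerSeries.map (PowerSeries.map (algebraMap ℂ A)) (diagSer c)) i *
      zc b.out (n - i)) m = coeff i.toNat c • co b (n - i) (m - i) := by
    intro i hi
    obtain ⟨j, rfl⟩ := Int.eq_ofNat_of_zero_le hi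
    have : zc (PowerSeries.map (PowerSeries.map (algebraMap ℂ A)) (diagSer c)) (j : ℤ) =
        C (algebraMap ℂ A (coeff j c)) * X ^ j := by
      rw [zc_natCast]
      simp only [diagSer, RingHom.comp_apply]
      rw [PowerSeries.coeff_map, PowerSeries.coeff_rescale]
      simp [(PowerSeries.commute_X_pow _ _).eq]
    have hX : ∀ (l : ℕ) (P : A⟦X⟧) (m : ℤ), zc (X ^ l * P) m = zc P (m - l) := by
      intro l
      induction l with
      | zero => simp
      | succ l ih =>
        intro P m
        rw [pow_succ', mul_assoc, zc_X_mul, ih]; push_cast; congr 1; ring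
    rw [this, mul_assoc, zc_C_mul, hX, Algebra.smul_def]
    simp [co]
  conv_lhs => unfold co
  rw [out_smul, zc_mul]
  have hs : ∀ (s : Finset ℤ) (P : ℤ → A⟦X⟧), zc (∑ i ∈ s, P i) m = ∑ i ∈ s, zc (P i) m := by
    intro s P
    unfold zc; split_ifs <;> simp
  unfold zsum
  rw [hs, Finset.sum_congr rfl fun i hi => key i (by simp at hi; exact hi.1)]
  symm
  refine Finset.sum_subset (fun i hi => by simp at hi ⊢; omega) fun i hi hi' => ?_
  simp at hi hi'
  rw [co_of_neg_right _ _ (by omega), smul_zero]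

lemma isSMulRegular_linear {a b : ℂ} (hb : b ≠ 0) :
    IsSMulRegular (BiSeries A) (cst a * var₁ + cst b * var₂) := by
  refine IsSMulRegular.of_right_eq_zero_of_smul ?_
  intro x hx
  have h : ∀ n m, a • co x (n - 1) m + b • co x n (m - 1) = 0 := fun n m => by
    rw [← co_zero (A := A) n m, ← hx, add_smul, mul_smul, mul_smul, co_add, co_cst_smul,
      co_cst_smul, co_var₁_smul, co_var₂_smul]
  have h0 : ∀ n : ℕ, ∀ m, co x n m = 0 := by
    intro n
    induction n with
    | zero =>
      intro m
      have := h 0 (m + 1)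
      rw [co_of_neg_left _ (by omega), smul_zero, zero_add, add_sub_cancel_right] at this
      simpa [hb] using this
    | succ n ih =>
      intro m
      have := h (n + 1) (m + 1)
      rw [add_sub_cancel_right, add_sub_cancel_right, ih, smul_zero, zero_add] at this
      simpa [hb] using this
  refine co_ext fun n m => ?_
  rw [co_zero]
  rcases lt_or_ge n 0 with hn | hn
  · exact co_of_neg_left _ hn _
  · obtain ⟨j, rfl⟩ := Int.eq_ofNat_of_zero_le hn
    exact h0 j m

lemma isUnit_diagSer {c : ℂ⟦X⟧} (hc : constantCoeff c ≠ 0) : IsUnit (diagSer c) :=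
  (PowerSeries.isUnit_iff_constantCoeff.2 (isUnit_iff_ne_zero.2 hc)).map diagSer

end Algebra

end Series

section Cuts

variable {M : Type*} [AddCommGroup M] [Module ℂ M]

/-- The part of a family of coefficients with index at least `c`. -/
def cutGE (c : ℤ) (s : ℤ → M) (m : ℤ) : M := if c ≤ m then s m else 0

/-- The part of a family of coefficients with index less than `c`. -/
def cutLT (c : ℤ) (s : ℤ → M) (m : ℤ) : M := if c ≤ m then 0 else s m

/-- The first order exchange relation with an inhomogeneous term. -/
def LinRel (r : ℂ) (u v : ℤ → ℤ → M) (b : ℤ → ℤ → M) : Prop :=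
  ∀ n m, u n (m - 1) - u (n - 1) m = r • v n (m - 1) - r⁻¹ • v (n - 1) m + b n m

/-- The inhomogeneous term arising from cutting the second index at `c`. -/
def linBdry (r : ℂ) (c : ℤ) (v : ℤ → ℤ → M) (n m : ℤ) : M :=
  if m = c then (r - r⁻¹) • zsum (n - 1 + c) fun j => cutGE c (v (n - 1 + c - j)) j else 0

lemma LinRel.closed {r : ℂ} {u v : ℤ → ℤ → M} (hu : ∀ n < 0, ∀ m, u n m = 0)
    (hv : ∀ n < 0, ∀ m, v n m = 0) (h : LinRel r u v 0) (n : ℕ) (m : ℤ) :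
    u n m = r⁻¹ • v n m + (r - r⁻¹) • ∑ i ∈ range (n + 1), v (n - i) (m + i) := by
  induction n generalizing m with
  | zero =>
    have := h 0 (m + 1)
    rw [hu (0 - 1) (by norm_num), hv (0 - 1) (by norm_num)] at this
    simp only [add_sub_cancel_right, sub_zero, smul_zero, Pi.zero_apply, add_zero] at this
    simp [this]
    module
  | succ n ih =>
    have := h (n + 1) (m + 1)
    simp only [add_sub_cancel_right, Pi.zero_apply, add_zero] at this
    rw [sum_range_succ']
    have e : ∑ k ∈ range (n + 1), v (((n + 1 : ℕ) : ℤ) - ((k + 1 : ℕ) : ℤ)) (m + ((k + 1 : ℕ) : ℤ))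
        = ∑ i ∈ range (n + 1), v (n - i) (m + 1 + i) := by
      refine sum_congr rfl fun k _ => ?_
      push_cast
      congr 1 <;> ring
    rw [e]
    have ih' := ih (m + 1)
    push_cast
    simp only [sub_zero, add_zero]
    linear_combination (norm := module) this + ih'

lemma linBdry_eq {r : ℂ} {c : ℤ} (hc : 0 ≤ c) {v : ℤ → ℤ → M} (n : ℕ) :
    linBdry r c v (n + 1) c = (r - r⁻¹) • ∑ i ∈ range (n + 1), v (n - i) (c + i) := by
  unfold linBdry
  rw [if_pos rfl]
  congr 1
  symm
  unfold zsum
  refine sum_bij_ne_zero (fun i _ _ => c + (i : ℤ)) ?_ ?_ ?_ ?_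
  · intro i hi _; simp only [mem_range, mem_Icc] at hi ⊢; omega
  · intro i _ _ j _ _ h; simpa using h
  · intro j hj hj'
    have hcj : c ≤ j := by
      by_contra hlt; exact hj' (by simp [cutGE, hlt])
    simp only [mem_Icc] at hj
    refine ⟨(j - c).toNat, mem_range.2 (by omega), ?_, by omega⟩
    rw [cutGE, if_pos hcj] at hj'
    convert hj' using 2 <;> omega
  · intro i _ _
    rw [cutGE, if_pos (by omega)]
    congr 1; omega

/-- A first order exchange relation is equivalent to the exchange relations of its two halves. -/
theorem linRel_iff {r : ℂ} {c : ℤ} (hc : 0 ≤ c) {u v : ℤ → ℤ → M} (hu : ∀ n < 0, ∀ m, u n m = 0)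
    (hv : ∀ n < 0, ∀ m, v n m = 0) :
    LinRel r u v 0 ↔
      LinRel r (fun n => cutGE c (u n)) (fun n => cutGE c (v n)) (-linBdry r c v) ∧
      LinRel r (fun n => cutLT c (u n)) (fun n => cutLT c (v n)) (linBdry r c v) := by
  have key : ∀ (s : ℤ → M) m, s m = cutGE c s m + cutLT c s m := fun s m => by
    unfold cutGE cutLT; split_ifs <;> simp
  constructor
  · intro h
    have hP : LinRel r (fun n => cutGE c (u n)) (fun n => cutGE c (v n)) (-linBdry r c v) := by
      intro n m
      rcases lt_trichotomy m c with hm | rfl | hm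
      · simp [cutGE, linBdry, show ¬ c ≤ m by omega, show ¬ c ≤ m - 1 by omega, hm.ne]
      · have hl : ¬ m ≤ m - 1 := by omega
        simp only [Pi.neg_apply, cutGE, hl, le_refl, if_true, if_false]
        rcases le_or_gt n 0 with hn | hn
        · rw [hu _ (by omega), hv _ (by omega)]
          have : linBdry r m v n m = 0 := by
            unfold linBdry
            rw [if_pos rfl]
            have : zsum (n - 1 + m) (fun j => cutGE m (v (n - 1 + m - j)) j) = 0 := by
              refine sum_eq_zero fun j hj => ?_
              simp only [mem_Icc] at hj
              rw [cutGE]; split_ifs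
              · omega
              · rfl
            rw [this, smul_zero]
          simp [this]
        · obtain ⟨k, rfl⟩ : ∃ k : ℕ, n = k + 1 := ⟨(n - 1).toNat, by omega⟩
          rw [linBdry_eq hc, add_sub_cancel_right, LinRel.closed hu hv h k m]
          simp
          abel
      · have := h n m
        simp only [Pi.zero_apply, add_zero] at this
        simp [cutGE, linBdry, show c ≤ m by omega, show c ≤ m - 1 by omega, hm.ne', this]
    refine ⟨hP, fun n m => ?_⟩
    have h1 := h n m
    have h2 := hP n m
    simp only [Pi.zero_apply, Pi.neg_apply] at h1 h2
    rw [key (u n), key (u (n - 1)), key (v n), key (v (n - 1))] at h1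
    linear_combination (norm := module) h1 - h2
  · rintro ⟨h1, h2⟩ n m
    have h1 := h1 n m
    have h2 := h2 n m
    simp only [Pi.zero_apply, Pi.neg_apply] at h1 h2 ⊢
    rw [key (u n), key (u (n - 1)), key (v n), key (v (n - 1))]
    linear_combination (norm := module) h1 + h2

/-- The quadratic exchange form. -/
def quadForm (q : ℂ) (w w' : ℤ → ℤ → M) (n m : ℤ) : M :=
  q • w n (m - 1) - q⁻¹ • w (n - 1) m - q⁻¹ • w' (m - 1) n + q • w' m (n - 1)

/-- The part of a double family with both indices at least `c`. -/
def cutPP (c : ℤ) (w : ℤ → ℤ → M) (n m : ℤ) : M := if c ≤ n ∧ c ≤ m then w n m else 0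

/-- The part of a double family with first index at least `c` and second index less than `c`. -/
def cutPN (c : ℤ) (w : ℤ → ℤ → M) (n m : ℤ) : M := if c ≤ n ∧ m < c then w n m else 0

/-- The part of a double family with first index less than `c` and second index at least `c`. -/
def cutNP (c : ℤ) (w : ℤ → ℤ → M) (n m : ℤ) : M := if n < c ∧ c ≤ m then w n m else 0

/-- The part of a double family with both indices less than `c`. -/
def cutNN (c : ℤ) (w : ℤ → ℤ → M) (n m : ℤ) : M := if n < c ∧ m < c then w n m else 0

/-- The antidiagonal sums of the nonnegative part. -/
def sumP (c : ℤ) (w : ℤ → ℤ → M) (K : ℤ) : M := zsum K fun i => cutPP c w i (K - i)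

/-- The antidiagonal sums of the negative part. -/
def sumN (c : ℤ) (w : ℤ → ℤ → M) (K : ℤ) : M := zsum K fun i => cutNN c w (-i) (-(K - i))

lemma quad_boundary {q : ℂ} {y : ℕ → ℕ → M}
    (h : ∀ i j, q • y (i + 1) j - q⁻¹ • y i (j + 1) - q⁻¹ • y j (i + 1) + q • y (j + 1) i = 0)
    (k : ℕ) : q • y 0 k - q⁻¹ • y k 0 = (q - q⁻¹) • ∑ i ∈ range (k + 1), y i (k - i) := by
  have hs : ∑ i ∈ range k, (q • y (i + 1) (k - 1 - i) - q⁻¹ • y i (k - 1 - i + 1)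
      - q⁻¹ • y (k - 1 - i) (i + 1) + q • y (k - 1 - i + 1) i) = 0 :=
    sum_eq_zero fun i _ => h i (k - 1 - i)
  have h1 : ∑ i ∈ range k, y (i + 1) (k - 1 - i) = ∑ i ∈ range (k + 1), y i (k - i) - y 0 k := by
    rw [sum_range_succ']
    simp only [Nat.sub_zero, add_sub_cancel_right]
    exact sum_congr rfl fun i _ => by congr 1; omega
  have h2 : ∑ i ∈ range k, y i (k - 1 - i + 1) = ∑ i ∈ range (k + 1), y i (k - i) - y k 0 := by
    rw [sum_range_succ]
    simp only [Nat.sub_self, add_sub_cancel_right]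
    exact sum_congr rfl fun i hi => by rw [mem_range] at hi; congr 1; omega
  have h3 : ∑ i ∈ range k, y (k - 1 - i) (i + 1) = ∑ i ∈ range (k + 1), y i (k - i) - y k 0 := by
    rw [← h2, ← sum_range_reflect]
    exact sum_congr rfl fun i hi => by rw [mem_range] at hi; congr 1; omega
  have h4 : ∑ i ∈ range k, y (k - 1 - i + 1) i = ∑ i ∈ range (k + 1), y i (k - i) - y 0 k := by
    rw [← h1, ← sum_range_reflect]
    exact sum_congr rfl fun i hi => by rw [mem_range] at hi; congr 1; omega
  rw [sum_add_distrib, sum_sub_distrib, sum_sub_distrib, ← smul_sum, ← smul_sum, ← smul_sum,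
    ← smul_sum, h1, h2, h3, h4] at hs
  linear_combination (norm := module) (-(2 : ℂ)⁻¹) • hs

lemma sumP_of_lt {c : ℤ} (w : ℤ → ℤ → M) {K : ℤ} (hK : K < 2 * c) : sumP c w K = 0 := by
  unfold sumP zsum
  refine sum_eq_zero fun i _ => ?_
  rw [cutPP, if_neg (by omega)]

lemma sumN_of_lt {c : ℤ} (w : ℤ → ℤ → M) {K : ℤ} (hK : K < 2 - 2 * c) : sumN c w K = 0 := by
  unfold sumN zsum
  refine sum_eq_zero fun i _ => ?_
  rw [cutNN, if_neg (by omega)]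

lemma sumP_eq {c : ℤ} (hc : 0 ≤ c) (w : ℤ → ℤ → M) (k : ℕ) :
    sumP c w (2 * c + k) = ∑ i ∈ range (k + 1), w (c + i) (c + ((k - i : ℕ) : ℤ)) := by
  symm
  unfold sumP zsum
  refine sum_bij_ne_zero (fun i _ _ => c + (i : ℤ)) ?_ ?_ ?_ ?_
  · intro i hi _; simp only [mem_range, mem_Icc] at hi ⊢; omega
  · intro i _ _ j _ _ h; simpa using h
  · intro j hj hj'
    have hcj : c ≤ j ∧ c ≤ 2 * c + k - j := by
      by_contra hlt; exact hj' (by simp only [cutPP, if_neg hlt])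
    simp only [mem_Icc] at hj
    refine ⟨(j - c).toNat, mem_range.2 (by omega), ?_, by omega⟩
    rw [cutPP, if_pos hcj] at hj'
    convert hj' using 2 <;> omega
  · intro i hi _
    rw [mem_range] at hi
    rw [cutPP, if_pos (by omega)]
    congr 1; omega

lemma sumN_eq {c : ℤ} (hc : c ≤ 1) (w : ℤ → ℤ → M) (k : ℕ) :
    sumN c w (2 - 2 * c + k) =
      ∑ i ∈ range (k + 1), w (c - 1 - ((k - i : ℕ) : ℤ)) (c - 1 - i) := by
  symm
  unfold sumN zsum
  refine sum_bij_ne_zero (fun i _ _ => 1 - c + ((k - i : ℕ) : ℤ)) ?_ ?_ ?_ ?_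
  · intro i hi _; simp only [mem_range, mem_Icc] at hi ⊢; omega
  · intro i hi _ j hj _ h
    simp only [mem_range] at hi hj
    omega
  · intro j hj hj'
    have hcj : -j < c ∧ -(2 - 2 * c + k - j) < c := by
      by_contra hlt; exact hj' (by simp only [cutNN, if_neg hlt])
    simp only [mem_Icc] at hj
    refine ⟨k - (j - (1 - c)).toNat, mem_range.2 (by omega), ?_, by omega⟩
    rw [cutNN, if_pos hcj] at hj'
    convert hj' using 2 <;> omega
  · intro i hi _
    rw [mem_range] at hi
    rw [cutNN, if_pos (by omega)]
    congr 1 <;> omega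

lemma quadForm_symm (q : ℂ) (w w' : ℤ → ℤ → M) (n m : ℤ) :
    quadForm q w w' n m = quadForm q w' w m n := by
  unfold quadForm; abel

lemma quadForm_split (q : ℂ) (c : ℤ) (w : ℤ → ℤ → M) (n m : ℤ) :
    quadForm q w w n m = quadForm q (cutPP c w) (cutPP c w) n m +
      quadForm q (cutNN c w) (cutNN c w) n m + quadForm q (cutPN c w) (cutNP c w) n m +
      quadForm q (cutPN c w) (cutNP c w) m n := by
  have key : ∀ i j, w i j = cutPP c w i j + cutNN c w i j + cutPN c w i j + cutNP c w i j := by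
    intro i j
    unfold cutPP cutNN cutPN cutNP
    split_ifs <;> first | omega | simp
  unfold quadForm
  rw [key n, key (n - 1), key (m - 1), key m]
  module

/-- A quadratic exchange relation is equivalent to the exchange relations of its halves. -/
theorem quadRel_iff {q : ℂ} {c : ℤ} (hc : 0 ≤ c) (hc' : c ≤ 1) {w : ℤ → ℤ → M} :
    (∀ n m, quadForm q w w n m = 0) ↔
      (∀ n m, quadForm q (cutPP c w) (cutPP c w) n m = (q - q⁻¹) •
        ((if m = c then sumP c w (n + c - 1) else 0) +
          if n = c then sumP c w (m + c - 1) else 0)) ∧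
      (∀ n m, quadForm q (cutNN c w) (cutNN c w) n m = (q - q⁻¹) •
        ((if m = c then sumN c w (1 - c - n) else 0) +
          if n = c then sumN c w (1 - c - m) else 0)) ∧
      (∀ n m, quadForm q (cutPN c w) (cutNP c w) n m = -((q - q⁻¹) •
        ((if m = c then sumP c w (n + c - 1) else 0) +
          if n = c then sumN c w (1 - c - m) else 0))) := by
  constructor
  · intro h
    have hP0 : ∀ n, quadForm q (cutPP c w) (cutPP c w) n c =
        (q - q⁻¹) • sumP c w (n + c - 1) := by
      intro n
      rcases le_or_gt n c with hn | hn
      · rw [sumP_of_lt _ (by omega)]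
        simp only [quadForm, cutPP]
        repeat rw [if_neg (by omega)]
        simp
      · obtain ⟨k, rfl⟩ : ∃ k : ℕ, n = c + 1 + k := ⟨(n - c - 1).toNat, by omega⟩
        have := quad_boundary (q := q) (y := fun i j => w (c + i) (c + j)) (fun i j => by
          have := h (c + i + 1) (c + j + 1)
          simp only [quadForm, add_sub_cancel_right] at this
          push_cast
          simpa only [← add_assoc] using this) k
        rw [show c + 1 + (k : ℤ) + c - 1 = 2 * c + k by ring, sumP_eq hc, ← this]
        simp only [quadForm, cutPP]
        rw [if_neg (by omega), if_pos (by omega), if_neg (by omega), if_pos (by omega),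
          show c + 1 + (k : ℤ) - 1 = c + k by ring]
        simp
        abel
    have hN0 : ∀ n, quadForm q (cutNN c w) (cutNN c w) n c =
        (q - q⁻¹) • sumN c w (1 - c - n) := by
      intro n
      rcases le_or_gt c n with hn | hn
      · rw [sumN_of_lt _ (by omega)]
        simp only [quadForm, cutNN]
        repeat rw [if_neg (by omega)]
        simp
      · obtain ⟨k, rfl⟩ : ∃ k : ℕ, n = c - 1 - k := ⟨(c - 1 - n).toNat, by omega⟩
        have := quad_boundary (q := q) (y := fun i j => w (c - 1 - j) (c - 1 - i)) (fun i j => by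
          have := h (c - 1 - j) (c - 1 - i)
          simp only [quadForm] at this
          push_cast
          simpa only [← sub_sub] using this) k
        rw [show 1 - c - (c - 1 - (k : ℤ)) = 2 - 2 * c + k by ring, sumN_eq hc', ← this]
        simp only [quadForm, cutNN]
        rw [if_pos (by omega), if_neg (by omega), if_pos (by omega), if_neg (by omega)]
        simp
    have hP : ∀ n m, quadForm q (cutPP c w) (cutPP c w) n m = (q - q⁻¹) •
        ((if m = c then sumP c w (n + c - 1) else 0) +
          if n = c then sumP c w (m + c - 1) else 0) := by
      intro n m
      by_cases hm : m = c
      · subst hm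
        rw [hP0, if_pos rfl]
        split_ifs with hn
        · rw [sumP_of_lt w (by omega : n + m - 1 < 2 * m), sumP_of_lt w (by omega)]; simp
        · simp
      · by_cases hn : n = c
        · subst hn
          rw [quadForm_symm, hP0]; simp [hm]
        · rw [if_neg hm, if_neg hn, add_zero, smul_zero]
          by_cases hnm : c < n ∧ c < m
          · rw [← h n m]
            simp only [quadForm, cutPP]
            repeat rw [if_pos (by omega)]
          · simp only [quadForm, cutPP]
            repeat rw [if_neg (by omega)]
            simp
    have hN : ∀ n m, quadForm q (cutNN c w) (cutNN c w) n m = (q - q⁻¹) •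
        ((if m = c then sumN c w (1 - c - n) else 0) +
          if n = c then sumN c w (1 - c - m) else 0) := by
      intro n m
      by_cases hm : m = c
      · subst hm
        rw [hN0, if_pos rfl]
        split_ifs with hn
        · rw [sumN_of_lt w (by omega : 1 - m - n < 2 - 2 * m), sumN_of_lt w (by omega)]; simp
        · simp
      · by_cases hn : n = c
        · subst hn
          rw [quadForm_symm, hN0]; simp [hm]
        · rw [if_neg hm, if_neg hn, add_zero, smul_zero]
          by_cases hnm : n < c ∧ m < c
          · rw [← h n m]
            simp only [quadForm, cutNN]
            repeat rw [if_pos (by omega)]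
          · simp only [quadForm, cutNN]
            repeat rw [if_neg (by omega)]
            simp
    refine ⟨hP, hN, fun n m => ?_⟩
    by_cases hs : c ≤ n ∧ m ≤ c
    · have hsum := h n m
      rw [quadForm_split q c w, hP, hN] at hsum
      by_cases he : n = c ∧ m = c
      · obtain ⟨rfl, rfl⟩ := he
        rw [sumP_of_lt _ (by omega), sumN_of_lt _ (by omega)] at hsum ⊢
        simp only [if_true, add_zero, smul_zero, zero_add, neg_zero] at hsum ⊢
        linear_combination (norm := module) (2 : ℂ)⁻¹ • hsum
      · have h0 : quadForm q (cutPN c w) (cutNP c w) m n = 0 := by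
          simp only [quadForm, cutPN, cutNP]
          repeat rw [if_neg (by omega)]
          simp
        rw [h0] at hsum
        have e1 : (if n = c then sumP c w (m + c - 1) else 0) = 0 := by
          split_ifs
          · exact sumP_of_lt _ (by omega)
          · rfl
        have e2 : (if m = c then sumN c w (1 - c - n) else 0) = 0 := by
          split_ifs
          · exact sumN_of_lt _ (by omega)
          · rfl
        rw [e1, e2] at hsum
        linear_combination (norm := module) hsum
    · have e1 : (if m = c then sumP c w (n + c - 1) else 0) = 0 := by
        split_ifs
        · exact sumP_of_lt _ (by omega)
        · rfl
      have e2 : (if n = c then sumN c w (1 - c - m) else 0) = 0 := by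
        split_ifs
        · exact sumN_of_lt _ (by omega)
        · rfl
      rw [e1, e2]
      simp only [quadForm, cutPN, cutNP]
      repeat rw [if_neg (by omega)]
      simp
  · rintro ⟨hP, hN, hPN⟩ n m
    rw [quadForm_split q c w, hP, hN, hPN, hPN]
    module

end Cuts

section Halves

variable {M : Type*} [AddCommGroup M] [Module ℂ M]

/-- The first order exchange relation of a half series with series of the same sign. -/
def Half (r : ℂ) (c : ℤ) (x y : ℤ → ℤ → M) (B : ℤ → M) : Prop :=
  ∀ n m, x n (m - 1) - x (n - 1) m = r • y n (m - 1) - r⁻¹ • y (n - 1) m -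
    if m = c then (r - r⁻¹) • B (n - 1 + c) else 0

/-- The first order exchange relation of a half series with series of the opposite sign. -/
def Cross (r : ℂ) (c : ℤ) (κ : ℂ) (x y : ℤ → ℤ → M) (B : ℤ → M) : Prop :=
  ∀ n m, x n m - κ • x (n - 1) (m - 1) = r • y n m - (r⁻¹ * κ) • y (n - 1) (m - 1) -
    if m = 1 - c then ((r - r⁻¹) * κ ^ (1 - c)) • B (n - 1 + c) else 0

/-- A first order exchange relation is equivalent to the relations of its half series. -/
theorem lin_iff {r : ℂ} {c : ℤ} (hc : 0 ≤ c) {κ : ℂ} (hκ : κ ≠ 0) {u v x y x' y' : ℤ → ℤ → M}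
    {B : ℤ → M} (hu : ∀ n < 0, ∀ m, u n m = 0) (hv : ∀ n < 0, ∀ m, v n m = 0)
    (hx : ∀ n m, x n m = cutGE c (u n) m) (hy : ∀ n m, y n m = cutGE c (v n) m)
    (hx' : ∀ n m, x' n m = -(κ ^ m • cutLT c (u n) (-m)))
    (hy' : ∀ n m, y' n m = -(κ ^ m • cutLT c (v n) (-m)))
    (hB : ∀ n, B n = zsum n fun j => y (n - j) j) :
    LinRel r u v 0 ↔ Half r c x y B ∧ Cross r c κ x' y' B := by
  rw [linRel_iff hc hu hv]
  have hl : ∀ n m, linBdry r c v n m = if m = c then (r - r⁻¹) • B (n - 1 + c) else 0 := by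
    intro n m
    unfold linBdry
    simp only [hB, hy]
  refine and_congr ?_ ?_
  · unfold LinRel Half
    simp only [← hx, ← hy, Pi.neg_apply, hl, sub_eq_add_neg]
  · have hl' : ∀ m : ℤ, κ ^ (m - 1) = κ⁻¹ * κ ^ m := fun m => by rw [zpow_sub_one₀ hκ, mul_comm]
    constructor
    · intro h n m
      have := h n (1 - m)
      rw [hl, show (1 - m - 1 : ℤ) = -m by ring, show (1 - m : ℤ) = -(m - 1) by ring] at this
      simp only [hx', hy', hl']
      have hb : (if m = 1 - c then ((r - r⁻¹) * κ ^ (1 - c)) • B (n - 1 + c) else 0) =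
          κ ^ m • if -(m - 1) = c then (r - r⁻¹) • B (n - 1 + c) else 0 := by
        by_cases hm : m = 1 - c
        · rw [if_pos hm, if_pos (by omega), hm, smul_smul, mul_comm]
        · rw [if_neg hm, if_neg (by omega), smul_zero]
      rw [hb]
      have h2 := congrArg (fun z => -(κ ^ m • z)) this
      simp only [smul_sub, smul_add, smul_neg, smul_smul, ← mul_assoc, mul_inv_cancel₀ hκ, one_mul, mul_assoc r⁻¹ κ κ⁻¹, mul_one]
        at h2 ⊢
      linear_combination (norm := module) h2
    · intro h n m
      have := h n (1 - m)
      rw [show (1 - m - 1 : ℤ) = -m by ring] at this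
      simp only [hx', hy', neg_neg, neg_sub] at this
      have hb : (if 1 - m = 1 - c then ((r - r⁻¹) * κ ^ (1 - c)) • B (n - 1 + c) else 0) =
          κ ^ (1 - m) • if m = c then (r - r⁻¹) • B (n - 1 + c) else 0 := by
        by_cases hm : m = c
        · rw [if_pos (by omega), if_pos hm, hm, smul_smul, mul_comm]
        · rw [if_neg (by omega), if_neg hm, smul_zero]
      rw [hb] at this
      rw [hl]
      have h2 := congrArg (fun z => -(κ ^ (m - 1) • z)) this
      have e1 : κ ^ (m - 1) * κ ^ (1 - m) = 1 := by
        rw [← zpow_add₀ hκ, show m - 1 + (1 - m) = 0 by ring, zpow_zero]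
      have e2 : κ ^ (m - 1) * κ * κ ^ (-m) = 1 := by
        rw [← zpow_add_one₀ hκ, ← zpow_add₀ hκ, show m - 1 + 1 + -m = 0 by ring, zpow_zero]
      have e3 : κ ^ (m - 1) * r * κ ^ (1 - m) = r := by linear_combination r * e1
      have e4 : κ ^ (m - 1) * r⁻¹ * κ * κ ^ (-m) = r⁻¹ := by linear_combination r⁻¹ * e2
      simp only [smul_sub, smul_add, smul_neg, smul_smul, ← mul_assoc, e1, e2, e3, e4] at h2
      linear_combination (norm := module) h2

/-- The quadratic exchange relation of a half series with itself. -/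
def QHalf (q : ℂ) (c : ℤ) (x : ℤ → ℤ → M) (S : ℤ → M) : Prop :=
  ∀ n m, quadForm q x x n m = (q - q⁻¹) •
    ((if m = c then S (n + c - 1) else 0) + if n = c then S (m + c - 1) else 0)

/-- The quadratic exchange relation of half series of opposite signs. -/
def QCross (q : ℂ) (c : ℤ) (κ : ℂ) (z z' : ℤ → ℤ → M) (S T : ℤ → M) : Prop :=
  ∀ n m, q • z n m - (q⁻¹ * κ) • z (n - 1) (m - 1) - q⁻¹ • z' n m +
    (q * κ) • z' (n - 1) (m - 1) = (q - q⁻¹) •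
    ((if m = 1 - c then κ ^ (1 - c) • S (n + c - 1) else 0) +
      if n = c then κ ^ c • T (m - c) else 0)

/-- A quadratic exchange relation is equivalent to the relations of its half series. -/
theorem quad_iff {q : ℂ} {c : ℤ} (hc : 0 ≤ c) (hc' : c ≤ 1) {κ : ℂ} (hκ : κ ≠ 0)
    {w x y z z' : ℤ → ℤ → M} {S T : ℤ → M}
    (hx : ∀ n m, x n m = cutPP c w n m)
    (hy : ∀ n m, y n m = κ ^ (n + m) • cutNN c w (-m) (-n))
    (hz : ∀ n m, z n m = -(κ ^ m • cutPN c w n (-m)))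
    (hz' : ∀ n m, z' n m = -(κ ^ m • cutNP c w (-m) n))
    (hS : ∀ n, S n = zsum n fun i => x i (n - i))
    (hT : ∀ n, T n = zsum n fun i => y (n - i) i) :
    (∀ n m, quadForm q w w n m = 0) ↔
      QHalf q c x S ∧ QHalf q (1 - c) y T ∧ QCross q c κ z z' S T := by
  have hSP : ∀ n, sumP c w n = S n := by
    intro n; unfold sumP; simp only [hS, hx]
  have hTN : ∀ n, T n = κ ^ n • sumN c w n := by
    intro n; unfold sumN; simp only [hT, hy, zsum, smul_sum]
    exact sum_congr rfl fun i _ => by congr 2; ring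
  rw [quadRel_iff hc hc']
  refine and_congr ?_ (and_congr ?_ ?_)
  · unfold QHalf
    have : x = cutPP c w := by ext; simp [hx]
    simp only [hSP, this]
  · have key : ∀ n m, quadForm q y y n m =
        κ ^ (n + m - 1) • quadForm q (cutNN c w) (cutNN c w) (1 - n) (1 - m) := by
      intro n m
      simp only [quadForm, hy]
      rw [show n + (m - 1) = n + m - 1 by ring, show n - 1 + m = n + m - 1 by ring,
        show m - 1 + n = n + m - 1 by ring, show m + (n - 1) = n + m - 1 by ring,
        show 1 - n - 1 = -n by ring, show 1 - m - 1 = -m by ring, show -(n - 1) = 1 - n by ring,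
        show -(m - 1) = 1 - m by ring]
      module
    have key2 : ∀ n m, (if m = 1 - c then T (n + (1 - c) - 1) else 0) =
        κ ^ (n + m - 1) • if 1 - m = c then sumN c w (1 - c - (1 - n)) else 0 := by
      intro n m
      by_cases hm : m = 1 - c
      · rw [if_pos hm, if_pos (by omega), hTN, hm]
        rw [show n + (1 - c) - 1 = 1 - c - (1 - n) by ring]
      · rw [if_neg hm, if_neg (by omega), smul_zero]
    have key3 : ∀ n m, (q - q⁻¹) • ((if m = 1 - c then T (n + (1 - c) - 1) else 0) +
        if n = 1 - c then T (m + (1 - c) - 1) else 0) = κ ^ (n + m - 1) • (q - q⁻¹) •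
        ((if 1 - m = c then sumN c w (1 - c - (1 - n)) else 0) +
          if 1 - n = c then sumN c w (1 - c - (1 - m)) else 0) := by
      intro n m
      rw [key2, key2 m n, add_comm m n]
      module
    constructor
    · intro h n m
      rw [key, h, key3]
    · intro h n m
      have := h (1 - n) (1 - m)
      rw [key, key3] at this
      have := smul_right_injective M (zpow_ne_zero _ hκ) this
      simpa only [sub_sub_cancel] using this
  · have key : ∀ n m, q • z n m - (q⁻¹ * κ) • z (n - 1) (m - 1) - q⁻¹ • z' n m +
        (q * κ) • z' (n - 1) (m - 1) =
        -(κ ^ m • quadForm q (cutPN c w) (cutNP c w) n (1 - m)) := by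
      intro n m
      have e : κ * κ ^ (m - 1) = κ ^ m := by
        rw [mul_comm, ← zpow_add_one₀ hκ]; congr 1; ring
      have e1 : q⁻¹ * κ * κ ^ (m - 1) = q⁻¹ * κ ^ m := by rw [mul_assoc, e]
      have e2 : q * κ * κ ^ (m - 1) = q * κ ^ m := by rw [mul_assoc, e]
      simp only [quadForm, hz, hz']
      rw [show 1 - m - 1 = -m by ring, show -(m - 1) = 1 - m by ring]
      simp only [smul_neg, smul_smul, e1, e2]
      module
    have key2 : ∀ n m, (q - q⁻¹) •
        ((if m = 1 - c then κ ^ (1 - c) • S (n + c - 1) else 0) +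
        if n = c then κ ^ c • T (m - c) else 0) = -(κ ^ m • -((q - q⁻¹) •
        ((if 1 - m = c then sumP c w (n + c - 1) else 0) +
          if n = c then sumN c w (1 - c - (1 - m)) else 0))) := by
      intro n m
      have e : κ ^ c * κ ^ (m - c) = κ ^ m := by
        rw [← zpow_add₀ hκ]; congr 1; ring
      have e1 : (if m = 1 - c then κ ^ (1 - c) • S (n + c - 1) else 0) =
          κ ^ m • if 1 - m = c then sumP c w (n + c - 1) else 0 := by
        by_cases hm : m = 1 - c
        · rw [if_pos hm, if_pos (by omega), hSP, hm]
        · rw [if_neg hm, if_neg (by omega), smul_zero]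
      have e2 : (if n = c then κ ^ c • T (m - c) else 0) =
          κ ^ m • if n = c then sumN c w (1 - c - (1 - m)) else 0 := by
        split_ifs
        · rw [hTN, smul_smul, e]; congr 2; ring
        · simp
      rw [e1, e2]
      module
    constructor
    · intro h n m
      rw [key, h, key2]
    · intro h n m
      have := h n (1 - m)
      rw [key, key2] at this
      have := smul_right_injective M (zpow_ne_zero _ hκ) (neg_injective this)
      simpa only [sub_sub_cancel] using this

end Halves

section Links

variable {A : Type*} [Ring A] [Algebra ℂ A]

lemma co_one_smul (b : BiSeries A) (n m : ℤ) : co ((1 : Scal) • b) n m = co b n m := by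
  rw [one_smul]

/-- The product of the two variables times a scalar. -/
def diagVar (κ : ℂ) : Scal := cst κ * (var₁ * var₂)

lemma co_diagVar_smul (κ : ℂ) (b : BiSeries A) (n m : ℤ) :
    co (diagVar κ • b) n m = κ • co b (n - 1) (m - 1) := by
  rw [diagVar, mul_smul, mul_smul, co_cst_smul, co_var₁_smul, co_var₂_smul]

/-- First order exchange relation between generating series. -/
def Ex (r : ℂ) (s t b : Scal) (x y z : BiSeries A) : Prop :=
  (s - t) • x = (cst r * s - cst r⁻¹ * t) • y - (cst (r - r⁻¹) * b) • z

lemma ex_swap {r : ℂ} {s t b : Scal} {x y z : BiSeries A} :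
    Ex r t s b x y z ↔ Ex r⁻¹ s t b x y z := by
  unfold Ex
  rw [inv_inv, ← neg_inj]
  have e1 : -((t - s) • x) = (s - t) • x := by rw [← neg_smul, neg_sub]
  have e2 : -((cst r * t - cst r⁻¹ * s) • y - (cst (r - r⁻¹) * b) • z) =
      (cst r⁻¹ * s - cst r * t) • y - (cst (r⁻¹ - r) * b) • z := by
    rw [show cst r⁻¹ * s - cst r * t = -(cst r * t - cst r⁻¹ * s) by ring,
      show cst (r⁻¹ - r) * b = -(cst (r - r⁻¹) * b) by rw [map_sub, map_sub]; ring,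
      neg_smul, neg_smul]
    abel
  rw [e1, e2]

lemma ex_half {r : ℂ} {c : ℤ} {b : Scal} {x y z : BiSeries A} {S : A⟦X⟧}
    (hb : ∀ n m, co (b • z) n m = if m = c then zc S (n - 1 + c) else 0) :
    Ex r var₂ var₁ b x y z ↔ Half r c (co x) (co y) (zc S) := by
  unfold Ex Half
  rw [co_ext_iff]
  refine forall_congr' fun n => forall_congr' fun m => ?_
  simp only [sub_smul, mul_smul, co_sub, co_cst_smul, co_var₁_smul, co_var₂_smul, hb, smul_ite,
    smul_zero]

lemma ex_half_swap {r : ℂ} {c : ℤ} {b : Scal} {x y z : BiSeries A} {S : A⟦X⟧}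
    (hb : ∀ n m, co (b • z) n m = if n = c then zc S (m - 1 + c) else 0) :
    Ex r var₁ var₂ b x y z ↔ Half r c (fun n m => co x m n) (fun n m => co y m n) (zc S) := by
  unfold Ex Half
  rw [co_ext_iff, forall_comm]
  refine forall_congr' fun n => forall_congr' fun m => ?_
  simp only [sub_smul, mul_smul, co_sub, co_cst_smul, co_var₁_smul, co_var₂_smul, hb, smul_ite,
    smul_zero]

lemma ex_cross {r κ : ℂ} {c : ℤ} {b : Scal} {x y z : BiSeries A} {S : A⟦X⟧}
    (hb : ∀ n m, co (b • z) n m = if m = 1 - c then κ ^ (1 - c) • zc S (n - 1 + c) else 0) :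
    Ex r 1 (diagVar κ) b x y z ↔ Cross r c κ (co x) (co y) (zc S) := by
  unfold Ex Cross
  rw [co_ext_iff]
  refine forall_congr' fun n => forall_congr' fun m => ?_
  simp only [sub_smul, mul_smul, co_sub, co_cst_smul, co_diagVar_smul, co_one_smul, hb, smul_ite,
    smul_zero]

lemma ex_cross_swap {r κ : ℂ} {c : ℤ} {b : Scal} {x y z : BiSeries A} {S : A⟦X⟧}
    (hb : ∀ n m, co (b • z) n m = if n = 1 - c then κ ^ (1 - c) • zc S (m - 1 + c) else 0) :
    Ex r 1 (diagVar κ) b x y z ↔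
      Cross r c κ (fun n m => co x m n) (fun n m => co y m n) (zc S) := by
  unfold Ex Cross
  rw [co_ext_iff, forall_comm]
  refine forall_congr' fun n => forall_congr' fun m => ?_
  simp only [sub_smul, mul_smul, co_sub, co_cst_smul, co_diagVar_smul, co_one_smul, hb, smul_ite,
    smul_zero]

lemma co_var₁_ser₁ (S : A⟦X⟧) (n m : ℤ) :
    co (var₁ • ser₁ S) n m = if m = 0 then zc S (n - 1 + 0) else 0 := by
  rw [co_var₁_smul, co_ser₁, add_zero]

lemma co_var₂_ser₁ (S : A⟦X⟧) (n m : ℤ) :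
    co (var₂ • ser₁ S) n m = if m = 1 then zc S (n - 1 + 1) else 0 := by
  rw [co_var₂_smul, co_ser₁, sub_add_cancel]
  simp only [sub_eq_zero]

lemma co_var₂_ser₂ (S : A⟦X⟧) (n m : ℤ) :
    co (var₂ • ser₂ S) n m = if n = 0 then zc S (m - 1 + 0) else 0 := by
  rw [co_var₂_smul, co_ser₂, add_zero]

lemma co_var₁_ser₂ (S : A⟦X⟧) (n m : ℤ) :
    co (var₁ • ser₂ S) n m = if n = 1 then zc S (m - 1 + 1) else 0 := by
  rw [co_var₁_smul, co_ser₂, sub_add_cancel]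
  simp only [sub_eq_zero]

lemma co_one_ser₁ (κ : ℂ) (S : A⟦X⟧) (n m : ℤ) :
    co ((1 : Scal) • ser₁ S) n m =
      if m = 1 - 1 then κ ^ (1 - 1 : ℤ) • zc S (n - 1 + 1) else 0 := by
  rw [co_one_smul, co_ser₁]; simp

lemma co_one_ser₂ (κ : ℂ) (S : A⟦X⟧) (n m : ℤ) :
    co ((1 : Scal) • ser₂ S) n m =
      if n = 1 - 1 then κ ^ (1 - 1 : ℤ) • zc S (m - 1 + 1) else 0 := by
  rw [co_one_smul, co_ser₂]; simp

lemma co_diagVar_ser₁ (κ : ℂ) (S : A⟦X⟧) (n m : ℤ) :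
    co (diagVar κ • ser₁ S) n m =
      if m = 1 - 0 then κ ^ (1 - 0 : ℤ) • zc S (n - 1 + 0) else 0 := by
  rw [co_diagVar_smul, co_ser₁]; simp [sub_eq_zero]

lemma co_diagVar_ser₂ (κ : ℂ) (S : A⟦X⟧) (n m : ℤ) :
    co (diagVar κ • ser₂ S) n m =
      if n = 1 - 0 then κ ^ (1 - 0 : ℤ) • zc S (m - 1 + 0) else 0 := by
  rw [co_diagVar_smul, co_ser₂]; simp [sub_eq_zero]

/-- Quadratic exchange relation between generating series. -/
def Qd (q : ℂ) (s t b b' : Scal) (x y z z' : BiSeries A) : Prop :=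
  (cst q * s - cst q⁻¹ * t) • x - (cst (q - q⁻¹) * b) • z =
    (cst q⁻¹ * s - cst q * t) • y + (cst (q - q⁻¹) * b') • z'

lemma qd_half {q : ℂ} {c : ℤ} {b b' : Scal} {x y z z' : BiSeries A} {S : A⟦X⟧}
    (hxy : ∀ n m, co y n m = co x m n)
    (hb : ∀ n m, co (b • z) n m = if m = c then zc S (n - 1 + c) else 0)
    (hb' : ∀ n m, co (b' • z') n m = if n = c then zc S (m - 1 + c) else 0) :
    Qd q var₂ var₁ b b' x y z z' ↔ QHalf q c (co x) (zc S) := by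
  unfold Qd QHalf
  rw [co_ext_iff]
  refine forall_congr' fun n => forall_congr' fun m => ?_
  simp only [sub_smul, mul_smul, co_sub, co_add, co_cst_smul, co_var₁_smul, co_var₂_smul, hb, hb',
    hxy, quadForm, show n + c - 1 = n - 1 + c by ring, show m + c - 1 = m - 1 + c by ring]
  constructor <;> intro h <;> linear_combination (norm := module) h

lemma qd_half_swap {q : ℂ} {c : ℤ} {b b' : Scal} {x y z z' : BiSeries A} {S : A⟦X⟧}
    (hxy : ∀ n m, co x n m = co y m n)
    (hb : ∀ n m, co (b • z) n m = if m = c then zc S (n - 1 + c) else 0)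
    (hb' : ∀ n m, co (b' • z') n m = if n = c then zc S (m - 1 + c) else 0) :
    Qd q var₁ var₂ b b' x y z z' ↔ QHalf q c (co y) (zc S) := by
  unfold Qd QHalf
  rw [co_ext_iff]
  refine forall_congr' fun n => forall_congr' fun m => ?_
  simp only [sub_smul, mul_smul, co_sub, co_add, co_cst_smul, co_var₁_smul, co_var₂_smul, hb, hb',
    hxy, quadForm, show n + c - 1 = n - 1 + c by ring, show m + c - 1 = m - 1 + c by ring]
  constructor <;> intro h <;> linear_combination (norm := module) h

lemma qd_cross {q κ : ℂ} {c : ℤ} {b b' : Scal} {x y z z' : BiSeries A} {S T : A⟦X⟧}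
    (hb : ∀ n m, co (b • z) n m = if m = 1 - c then κ ^ (1 - c) • zc S (n - 1 + c) else 0)
    (hb' : ∀ n m, co (b' • z') n m = if n = c then κ ^ c • zc T (m - c) else 0) :
    Qd q 1 (diagVar κ) b b' x y z z' ↔ QCross q c κ (co x) (co y) (zc S) (zc T) := by
  unfold Qd QCross
  rw [co_ext_iff]
  refine forall_congr' fun n => forall_congr' fun m => ?_
  simp only [sub_smul, mul_smul, co_sub, co_add, co_cst_smul, co_diagVar_smul, co_one_smul, hb,
    hb', show n + c - 1 = n - 1 + c by ring]
  constructor <;> intro h <;> linear_combination (norm := module) h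

lemma eq_zero_of_shift {M : Type*} [Zero M] {D : ℤ → ℤ → M} (h0 : ∀ n < 0, ∀ m, D n m = 0)
    (h : ∀ n m, D n (m - 1) = D (n - 1) m) (n m : ℤ) : D n m = 0 := by
  rcases lt_or_ge n 0 with hn | hn
  · exact h0 n hn m
  · obtain ⟨j, rfl⟩ := Int.eq_ofNat_of_zero_le hn
    clear hn
    induction j generalizing m with
    | zero =>
      rw [← add_sub_cancel_right m 1, h]
      exact h0 _ (by simp) _
    | succ j ih =>
      rw [← add_sub_cancel_right m 1, h]
      simpa using ih (m + 1)

/-- The divided difference of a series: the part with second index positive. -/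
lemma ef_half {θ : ℂ} {W : BiSeries A} {ψ : A⟦X⟧} :
    (var₂ - var₁) • W = (cst θ * var₂) • (ser₁ ψ - ser₂ ψ) ↔
      ∀ n m, co W n m = if 0 ≤ n ∧ 1 ≤ m then -(θ • zc ψ (n + m)) else 0 := by
  rw [co_ext_iff]
  simp only [sub_smul, mul_smul, co_sub, co_cst_smul, co_var₁_smul, co_var₂_smul, co_ser₁, co_ser₂]
  have key : ∀ n m : ℤ, ((if 0 ≤ n ∧ 1 ≤ m - 1 then -(θ • zc ψ (n + (m - 1))) else 0) -
      if 0 ≤ n - 1 ∧ 1 ≤ m then -(θ • zc ψ (n - 1 + m)) else 0) =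
      θ • ((if m - 1 = 0 then zc ψ n else 0) - if n = 0 then zc ψ (m - 1) else 0) := by
    intro n m
    rw [show n - 1 + m = n + (m - 1) by ring]
    rcases lt_trichotomy n 0 with hn | rfl | hn
    · rw [if_neg (by omega), if_neg (by omega), zc_of_neg ψ hn, if_neg hn.ne]
      simp
    · rcases lt_trichotomy (m - 1) 0 with hm | hm | hm
      · rw [if_neg (by omega), if_neg (by omega), zc_of_neg ψ hm, if_neg hm.ne]
        simp
      · rw [if_neg (by omega), if_neg (by omega), hm]
        simp
      · rw [if_pos (by omega), if_neg (by omega), if_neg hm.ne']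
        simp
    · rcases lt_trichotomy (m - 1) 0 with hm | hm | hm
      · rw [if_neg (by omega), if_neg (by omega), if_neg hm.ne, if_neg hn.ne']
        simp
      · rw [if_neg (by omega), if_pos (by omega), if_neg hn.ne', hm]
        simp
      · rw [if_pos (by omega), if_pos (by omega), if_neg hm.ne', if_neg hn.ne']
        simp
  constructor
  · intro h n m
    rw [← sub_eq_zero]
    refine eq_zero_of_shift (D := fun n m => co W n m -
      if 0 ≤ n ∧ 1 ≤ m then -(θ • zc ψ (n + m)) else 0) ?_ ?_ n m
    · intro n hn m
      rw [co_of_neg_left _ hn, if_neg (by omega), sub_zero]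
    · intro n m
      have := h n m
      rw [← key] at this
      linear_combination (norm := module) this
  · intro h n m
    rw [h, h, key]

lemma ef_half' {θ : ℂ} {W : BiSeries A} {ψ : A⟦X⟧} :
    (var₁ - var₂) • W = (cst θ * var₁) • (ser₁ ψ - ser₂ ψ) ↔
      ∀ n m, co W n m = if 1 ≤ n ∧ 0 ≤ m then θ • zc ψ (n + m) else 0 := by
  rw [co_ext_iff]
  simp only [sub_smul, mul_smul, co_sub, co_cst_smul, co_var₁_smul, co_var₂_smul, co_ser₁, co_ser₂]
  have key : ∀ n m : ℤ, ((if 1 ≤ n - 1 ∧ 0 ≤ m then θ • zc ψ (n - 1 + m) else 0) -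
      if 1 ≤ n ∧ 0 ≤ m - 1 then θ • zc ψ (n + (m - 1)) else 0) =
      θ • ((if m = 0 then zc ψ (n - 1) else 0) - if n - 1 = 0 then zc ψ m else 0) := by
    intro n m
    rw [show n + (m - 1) = n - 1 + m by ring]
    rcases lt_trichotomy (n - 1) 0 with hn | hn | hn
    · rw [if_neg (by omega), if_neg (by omega), zc_of_neg ψ hn, if_neg hn.ne]
      simp
    · rcases lt_trichotomy m 0 with hm | rfl | hm
      · rw [if_neg (by omega), if_neg (by omega), zc_of_neg ψ hm, if_neg hm.ne]
        simp
      · rw [if_neg (by omega), if_neg (by omega), hn]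
        simp
      · rw [if_neg (by omega), if_pos (by omega), if_neg hm.ne', hn]
        simp
    · rcases lt_trichotomy m 0 with hm | rfl | hm
      · rw [if_neg (by omega), if_neg (by omega), if_neg hm.ne, if_neg hn.ne']
        simp
      · rw [if_pos (by omega), if_neg (by omega), if_neg hn.ne']
        simp
      · rw [if_pos (by omega), if_pos (by omega), if_neg hm.ne', if_neg hn.ne']
        simp
  constructor
  · intro h n m
    rw [← sub_eq_zero]
    refine eq_zero_of_shift (D := fun n m => co W n m -
      if 1 ≤ n ∧ 0 ≤ m then θ • zc ψ (n + m) else 0) ?_ ?_ n m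
    · intro n hn m
      rw [co_of_neg_left _ hn, if_neg (by omega), sub_zero]
    · intro n m
      have := h n m
      rw [← key] at this
      linear_combination (norm := module) -this
  · intro h n m
    rw [h, h, key]

/-- The geometric series in the product of the two variables. -/
def geom (κ : ℂ) : Scal := diagSer (PowerSeries.mk fun i => κ ^ i)

lemma geom_mul (κ : ℂ) : (1 - diagVar κ) * geom κ = 1 := by
  have h : (1 - C κ * X) * PowerSeries.mk (fun i => κ ^ i) = (1 : ℂ⟦X⟧) := by
    ext n
    rw [sub_mul, one_mul, mul_assoc, map_sub, PowerSeries.coeff_C_mul]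
    cases n with
    | zero => simp
    | succ n => simp [PowerSeries.coeff_succ_X_mul, pow_succ', PowerSeries.coeff_one]
  have := congrArg diagSer h
  rwa [map_mul, map_sub, map_mul, map_one, diagSer_C, diagSer_X] at this

lemma co_geom_ser₁ (κ : ℂ) (ψ : A⟦X⟧) (n m : ℤ) :
    co (geom κ • ser₁ ψ) n m = if 0 ≤ m then κ ^ m • zc ψ (n - m) else 0 := by
  rw [geom, co_diagSer_smul]
  simp only [co_ser₁, sub_eq_zero]
  split_ifs with hm
  · unfold zsum
    rcases le_or_gt m n with hmn | hmn
    · rw [sum_eq_single m]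
      · obtain ⟨j, rfl⟩ := Int.eq_ofNat_of_zero_le hm
        simp
      · intro b _ hb
        simp [hb.symm]
      · intro hb
        exact absurd (mem_Icc.2 ⟨hm, by omega⟩) hb
    · rw [zc_of_neg _ (by omega), smul_zero]
      refine sum_eq_zero fun i hi => ?_
      rw [mem_Icc] at hi
      rw [if_neg (by omega), smul_zero]
  · exact zsum_of_neg (by omega) _

lemma co_geom_ser₂ (κ : ℂ) (ψ : A⟦X⟧) (n m : ℤ) :
    co (geom κ • ser₂ ψ) n m = if 0 ≤ n then κ ^ n • zc ψ (m - n) else 0 := by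
  rw [geom, co_diagSer_smul]
  simp only [co_ser₂, sub_eq_zero]
  split_ifs with hn
  · unfold zsum
    rcases le_or_gt n m with hmn | hmn
    · rw [sum_eq_single n]
      · obtain ⟨j, rfl⟩ := Int.eq_ofNat_of_zero_le hn
        simp
      · intro b _ hb
        simp [hb.symm]
      · intro hb
        exact absurd (mem_Icc.2 ⟨hn, by omega⟩) hb
    · rw [zc_of_neg _ (by omega), smul_zero]
      refine sum_eq_zero fun i hi => ?_
      rw [mem_Icc] at hi
      rw [if_neg (by omega), smul_zero]
  · exact zsum_of_neg (by omega) _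

lemma ef_cross {θ κ κ' : ℂ} {W : BiSeries A} {ψ ψ' : A⟦X⟧} :
    ((1 - diagVar κ) * (1 - diagVar κ')) • W =
        cst θ • ((1 - diagVar κ) • ser₁ ψ - (1 - diagVar κ') • ser₂ ψ') ↔
      ∀ n m, co W n m = θ • ((if 0 ≤ m then κ' ^ m • zc ψ (n - m) else 0) -
        if 0 ≤ n then κ ^ n • zc ψ' (m - n) else 0) := by
  have hr : IsUnit ((1 - diagVar κ) * (1 - diagVar κ')) :=
    (IsUnit.of_mul_eq_one _ (geom_mul κ)).mul (IsUnit.of_mul_eq_one _ (geom_mul κ'))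
  have e : cst θ • ((1 - diagVar κ) • ser₁ ψ - (1 - diagVar κ') • ser₂ ψ') =
      ((1 - diagVar κ) * (1 - diagVar κ')) • cst θ • (geom κ' • ser₁ ψ - geom κ • ser₂ ψ') := by
    simp only [smul_sub, ← mul_smul]
    congr 2
    · linear_combination -(cst θ * (1 - diagVar κ)) * geom_mul κ'
    · linear_combination -(cst θ * (1 - diagVar κ')) * geom_mul κ
  rw [e, hr.smul_left_cancel, co_ext_iff]
  simp only [co_cst_smul, co_sub, co_geom_ser₁, co_geom_ser₂]

lemma ef_cross' {θ κ κ' : ℂ} {W : BiSeries A} {ψ ψ' : A⟦X⟧} :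
    ((1 - diagVar κ) * (1 - diagVar κ')) • W =
        cst θ • ((diagVar κ' * (1 - diagVar κ)) • ser₂ ψ' -
          (diagVar κ * (1 - diagVar κ')) • ser₁ ψ) ↔
      ∀ n m, co W n m = θ • ((if 1 ≤ n then κ' • κ' ^ (n - 1) • zc ψ' (m - n) else 0) -
        if 1 ≤ m then κ • κ ^ (m - 1) • zc ψ (n - m) else 0) := by
  have hr : IsUnit ((1 - diagVar κ) * (1 - diagVar κ')) :=
    (IsUnit.of_mul_eq_one _ (geom_mul κ)).mul (IsUnit.of_mul_eq_one _ (geom_mul κ'))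
  have e : cst θ • ((diagVar κ' * (1 - diagVar κ)) • ser₂ ψ' -
          (diagVar κ * (1 - diagVar κ')) • ser₁ ψ) =
      ((1 - diagVar κ) * (1 - diagVar κ')) •
        cst θ • (diagVar κ' • geom κ' • ser₂ ψ' - diagVar κ • geom κ • ser₁ ψ) := by
    simp only [smul_sub, ← mul_smul]
    congr 2
    · linear_combination -(cst θ * (1 - diagVar κ) * diagVar κ') * geom_mul κ'
    · linear_combination -(cst θ * (1 - diagVar κ') * diagVar κ) * geom_mul κ
  rw [e, hr.smul_left_cancel, co_ext_iff]
  simp only [co_cst_smul, co_sub, co_diagVar_smul, co_geom_ser₁, co_geom_ser₂, smul_ite,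
    smul_zero, sub_sub_sub_cancel_right, sub_nonneg]

end Links

section SeriesLinks

lemma zsum_reflect {M : Type*} [AddCommMonoid M] (n : ℤ) (s : ℤ → M) :
    zsum n s = zsum n fun i => s (n - i) := by
  unfold zsum
  refine sum_bij (fun i _ => n - i) ?_ ?_ ?_ ?_
  · intro i hi; rw [mem_Icc] at hi ⊢; omega
  · intro i _ j _ h; omega
  · intro b hb; rw [mem_Icc] at hb; exact ⟨n - b, mem_Icc.2 (by omega), by omega⟩
  · intro i _; rw [sub_sub_cancel]

variable {A : Type*} [Ring A] [Algebra ℂ A] {r κ : ℂ} {K P N : A⟦X⟧}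

/-- The same-sign exchange relation of `K` with a lowering half series `P`. -/
def HalfE (r : ℂ) (c : ℤ) (K P : A⟦X⟧) : Prop :=
  Half r c (fun n m => zc K n * zc P m) (fun n m => zc P m * zc K n) (zc (P * K))

/-- The opposite-sign exchange relation of `K` with the half series `P` and `N`. -/
def CrossE (r : ℂ) (c : ℤ) (κ : ℂ) (K P N : A⟦X⟧) : Prop :=
  Cross r c κ (fun n m => zc K n * zc N m) (fun n m => zc N m * zc K n) (zc (P * K))

/-- The same-sign exchange relation of `K` with a raising half series `P`. -/
def HalfF (r : ℂ) (c : ℤ) (K P : A⟦X⟧) : Prop :=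
  Half r c (fun n m => zc P m * zc K n) (fun n m => zc K n * zc P m) (zc (K * P))

/-- The opposite-sign exchange relation of `K` with the raising half series `P` and `N`. -/
def CrossF (r : ℂ) (c : ℤ) (κ : ℂ) (K P N : A⟦X⟧) : Prop :=
  Cross r c κ (fun n m => zc N m * zc K n) (fun n m => zc K n * zc N m) (zc (K * P))

lemma linE_iff {c : ℤ} (hc : 0 ≤ c) (hκ : κ ≠ 0) {x : ℤ → A}
    (hP : ∀ m, zc P m = cutGE c x m) (hN : ∀ m, zc N m = -(κ ^ m • cutLT c x (-m))) :
    LinRel r (fun n m => zc K n * x m) (fun n m => x m * zc K n) 0 ↔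
      HalfE r c K P ∧ CrossE r c κ K P N := by
  refine lin_iff hc hκ ?_ ?_ ?_ ?_ ?_ ?_ ?_
  · intro n hn m; simp only [zc_of_neg K hn, zero_mul]
  · intro n hn m; simp only [zc_of_neg K hn, mul_zero]
  · intro n m; rw [hP]; unfold cutGE; split_ifs <;> simp
  · intro n m; rw [hP]; unfold cutGE; split_ifs <;> simp
  · intro n m; rw [hN]; unfold cutLT; split_ifs <;> simp
  · intro n m; rw [hN]; unfold cutLT; split_ifs <;> simp
  · intro n; exact zc_mul _ _ _

lemma linF_iff {c : ℤ} (hc : 0 ≤ c) (hκ : κ ≠ 0) {x : ℤ → A}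
    (hP : ∀ m, zc P m = cutGE c x m) (hN : ∀ m, zc N m = -(κ ^ m • cutLT c x (-m))) :
    LinRel r (fun n m => x m * zc K n) (fun n m => zc K n * x m) 0 ↔
      HalfF r c K P ∧ CrossF r c κ K P N := by
  refine lin_iff hc hκ ?_ ?_ ?_ ?_ ?_ ?_ ?_
  · intro n hn m; simp only [zc_of_neg K hn, mul_zero]
  · intro n hn m; simp only [zc_of_neg K hn, zero_mul]
  · intro n m; rw [hP]; unfold cutGE; split_ifs <;> simp
  · intro n m; rw [hP]; unfold cutGE; split_ifs <;> simp
  · intro n m; rw [hN]; unfold cutLT; split_ifs <;> simp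
  · intro n m; rw [hN]; unfold cutLT; split_ifs <;> simp
  · intro n; rw [zc_mul, zsum_reflect]; simp only [sub_sub_cancel]

lemma exE_pp : Ex r var₂ var₁ var₁ (ser₁ K * ser₂ P) (ser₂ P * ser₁ K) (ser₁ P * ser₁ K) ↔
    HalfE r 0 K P := by
  rw [← map_mul, ex_half (co_var₁_ser₁ _)]
  simp only [HalfE, Half, co_ser₁_mul_ser₂, co_ser₂_mul_ser₁]

lemma exE_pp' : Ex r var₁ var₂ var₂ (ser₂ K * ser₁ P) (ser₁ P * ser₂ K) (ser₂ P * ser₂ K) ↔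
    HalfE r 0 K P := by
  rw [← map_mul, ex_half_swap (co_var₂_ser₂ _)]
  simp only [HalfE, Half, co_ser₁_mul_ser₂, co_ser₂_mul_ser₁]

lemma exE_mm : Ex r var₁ var₂ var₂ (ser₁ K * ser₂ P) (ser₂ P * ser₁ K) (ser₁ P * ser₁ K) ↔
    HalfE r⁻¹ 1 K P := by
  rw [← map_mul, ex_swap, ex_half (co_var₂_ser₁ _)]
  simp only [HalfE, Half, co_ser₁_mul_ser₂, co_ser₂_mul_ser₁]

lemma exE_mm' : Ex r var₂ var₁ var₁ (ser₂ K * ser₁ P) (ser₁ P * ser₂ K) (ser₂ P * ser₂ K) ↔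
    HalfE r⁻¹ 1 K P := by
  rw [← map_mul, ex_swap, ex_half_swap (co_var₁_ser₂ _)]
  simp only [HalfE, Half, co_ser₁_mul_ser₂, co_ser₂_mul_ser₁]

lemma exE_pm : Ex r 1 (diagVar κ) (diagVar κ) (ser₁ K * ser₂ N) (ser₂ N * ser₁ K)
    (ser₁ P * ser₁ K) ↔ CrossE r 0 κ K P N := by
  rw [← map_mul, ex_cross (co_diagVar_ser₁ _ _)]
  simp only [CrossE, Cross, co_ser₁_mul_ser₂, co_ser₂_mul_ser₁]

lemma exE_pm' : Ex r (diagVar κ) 1 1 (ser₂ K * ser₁ N) (ser₁ N * ser₂ K)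
    (ser₂ P * ser₂ K) ↔ CrossE r⁻¹ 1 κ K P N := by
  rw [← map_mul, ex_swap, ex_cross_swap (co_one_ser₂ _ _)]
  simp only [CrossE, Cross, co_ser₁_mul_ser₂, co_ser₂_mul_ser₁]

lemma exF_pp : Ex r var₂ var₁ var₂ (ser₂ P * ser₁ K) (ser₁ K * ser₂ P) (ser₁ K * ser₁ P) ↔
    HalfF r 1 K P := by
  rw [← map_mul, ex_half (co_var₂_ser₁ _)]
  simp only [HalfF, Half, co_ser₁_mul_ser₂, co_ser₂_mul_ser₁]

lemma exF_pp' : Ex r var₁ var₂ var₁ (ser₁ P * ser₂ K) (ser₂ K * ser₁ P) (ser₂ K * ser₂ P) ↔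
    HalfF r 1 K P := by
  rw [← map_mul, ex_half_swap (co_var₁_ser₂ _)]
  simp only [HalfF, Half, co_ser₁_mul_ser₂, co_ser₂_mul_ser₁]

lemma exF_mm : Ex r var₁ var₂ var₁ (ser₂ P * ser₁ K) (ser₁ K * ser₂ P) (ser₁ K * ser₁ P) ↔
    HalfF r⁻¹ 0 K P := by
  rw [← map_mul, ex_swap, ex_half (co_var₁_ser₁ _)]
  simp only [HalfF, Half, co_ser₁_mul_ser₂, co_ser₂_mul_ser₁]

lemma exF_mm' : Ex r var₂ var₁ var₂ (ser₁ P * ser₂ K) (ser₂ K * ser₁ P) (ser₂ K * ser₂ P) ↔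
    HalfF r⁻¹ 0 K P := by
  rw [← map_mul, ex_swap, ex_half_swap (co_var₂_ser₂ _)]
  simp only [HalfF, Half, co_ser₁_mul_ser₂, co_ser₂_mul_ser₁]

lemma exF_pm : Ex r 1 (diagVar κ) 1 (ser₂ N * ser₁ K) (ser₁ K * ser₂ N)
    (ser₁ K * ser₁ P) ↔ CrossF r 1 κ K P N := by
  rw [← map_mul, ex_cross (co_one_ser₁ _ _)]
  simp only [CrossF, Cross, co_ser₁_mul_ser₂, co_ser₂_mul_ser₁]

lemma exF_pm' : Ex r (diagVar κ) 1 (diagVar κ) (ser₁ N * ser₂ K) (ser₂ K * ser₁ N)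
    (ser₂ K * ser₂ P) ↔ CrossF r⁻¹ 0 κ K P N := by
  rw [← map_mul, ex_swap, ex_cross_swap (co_diagVar_ser₂ _ _)]
  simp only [CrossF, Cross, co_ser₁_mul_ser₂, co_ser₂_mul_ser₁]

lemma quadE_iff {q : ℂ} (hκ : κ ≠ 0) {x : ℤ → A}
    (hP : ∀ m, zc P m = cutGE 0 x m) (hN : ∀ m, zc N m = -(κ ^ m • cutLT 0 x (-m))) :
    (∀ n m, quadForm q (fun i j => x i * x j) (fun i j => x i * x j) n m = 0) ↔
      Qd q var₂ var₁ var₁ var₂ (ser₁ P * ser₂ P) (ser₂ P * ser₁ P) (ser₁ P * ser₁ P)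
        (ser₂ P * ser₂ P) ∧
      Qd q var₁ var₂ var₂ var₁ (ser₁ N * ser₂ N) (ser₂ N * ser₁ N) (ser₁ N * ser₁ N)
        (ser₂ N * ser₂ N) ∧
      Qd q 1 (diagVar κ) (diagVar κ) 1 (ser₁ P * ser₂ N) (ser₂ N * ser₁ P) (ser₁ P * ser₁ P)
        (ser₂ N * ser₂ N) := by
  rw [quad_iff (c := 0) le_rfl zero_le_one hκ (x := co (ser₁ P * ser₂ P))
    (y := co (ser₂ N * ser₁ N)) (z := co (ser₁ P * ser₂ N)) (z' := co (ser₂ N * ser₁ P))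
    (S := zc (P * P)) (T := zc (N * N))]
  · refine and_congr ?_ (and_congr ?_ ?_)
    · rw [← map_mul, ← map_mul]
      refine (qd_half ?_ (co_var₁_ser₁ _) (co_var₂_ser₂ _)).symm
      intro n m; rw [co_ser₁_mul_ser₂, co_ser₂_mul_ser₁]
    · rw [← map_mul, ← map_mul]
      refine (qd_half_swap ?_ (co_var₂_ser₁ _) (co_var₁_ser₂ _)).symm
      intro n m; rw [co_ser₁_mul_ser₂, co_ser₂_mul_ser₁]
    · rw [← map_mul, ← map_mul]
      refine (qd_cross (co_diagVar_ser₁ _ _) ?_).symm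
      intro n m; rw [co_one_smul, co_ser₂, zpow_zero, one_smul, sub_zero]
  · intro n m
    rw [co_ser₁_mul_ser₂, hP, hP]
    unfold cutPP cutGE
    split_ifs <;> first | omega | simp
  · intro n m
    rw [co_ser₂_mul_ser₁, hN, hN, zpow_add₀ hκ]
    unfold cutNN cutLT
    split_ifs <;> first | omega | simp [smul_smul, mul_comm]
  · intro n m
    rw [co_ser₁_mul_ser₂, hN, hP]
    unfold cutPN cutGE cutLT
    split_ifs <;> first | omega | simp
  · intro n m
    rw [co_ser₂_mul_ser₁, hN, hP]
    unfold cutNP cutGE cutLT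
    split_ifs <;> first | omega | simp
  · intro n; simp only [co_ser₁_mul_ser₂, zc_mul]
  · intro n; simp only [co_ser₂_mul_ser₁, zc_mul]

lemma quadF_iff {q : ℂ} (hκ : κ ≠ 0) {x : ℤ → A}
    (hP : ∀ m, zc P m = cutGE 1 x m) (hN : ∀ m, zc N m = -(κ ^ m • cutLT 1 x (-m))) :
    (∀ n m, quadForm q (fun i j => x j * x i) (fun i j => x j * x i) n m = 0) ↔
      Qd q var₂ var₁ var₂ var₁ (ser₂ P * ser₁ P) (ser₁ P * ser₂ P) (ser₁ P * ser₁ P)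
        (ser₂ P * ser₂ P) ∧
      Qd q var₁ var₂ var₁ var₂ (ser₂ N * ser₁ N) (ser₁ N * ser₂ N) (ser₁ N * ser₁ N)
        (ser₂ N * ser₂ N) ∧
      Qd q 1 (diagVar κ) 1 (diagVar κ) (ser₂ N * ser₁ P) (ser₁ P * ser₂ N) (ser₁ P * ser₁ P)
        (ser₂ N * ser₂ N) := by
  rw [quad_iff (c := 1) zero_le_one le_rfl hκ (x := co (ser₂ P * ser₁ P))
    (y := co (ser₁ N * ser₂ N)) (z := co (ser₂ N * ser₁ P)) (z' := co (ser₁ P * ser₂ N))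
    (S := zc (P * P)) (T := zc (N * N))]
  · refine and_congr ?_ (and_congr ?_ ?_)
    · rw [← map_mul, ← map_mul]
      refine (qd_half ?_ (co_var₂_ser₁ _) (co_var₁_ser₂ _)).symm
      intro n m; rw [co_ser₁_mul_ser₂, co_ser₂_mul_ser₁]
    · rw [← map_mul, ← map_mul]
      refine (qd_half_swap ?_ (co_var₁_ser₁ _) (co_var₂_ser₂ _)).symm
      intro n m; rw [co_ser₁_mul_ser₂, co_ser₂_mul_ser₁]
    · rw [← map_mul, ← map_mul]
      refine (qd_cross (co_one_ser₁ _ _) ?_).symm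
      intro n m; rw [co_diagVar_smul, co_ser₂, zpow_one, smul_ite, smul_zero]
      simp only [sub_eq_zero]
  · intro n m
    rw [co_ser₂_mul_ser₁, hP, hP]
    unfold cutPP cutGE
    split_ifs <;> first | omega | simp
  · intro n m
    rw [co_ser₁_mul_ser₂, hN, hN, zpow_add₀ hκ]
    unfold cutNN cutLT
    split_ifs <;> first | omega | simp [smul_smul, mul_comm]
  · intro n m
    rw [co_ser₂_mul_ser₁, hN, hP]
    unfold cutPN cutGE cutLT
    split_ifs <;> first | omega | simp
  · intro n m
    rw [co_ser₁_mul_ser₂, hN, hP]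
    unfold cutNP cutGE cutLT
    split_ifs <;> first | omega | simp
  · intro n; rw [zc_mul, zsum_reflect]; simp only [co_ser₂_mul_ser₁, sub_sub_cancel]
  · intro n; rw [zc_mul, zsum_reflect]; simp only [co_ser₁_mul_ser₂, sub_sub_cancel]

end SeriesLinks

section Reduce

variable {R B : Type*} [CommRing R] [Ring B] [Algebra R B]

lemma ef_reduce {p p' β β' δ : R} {k₁ k₁' k₂ k₂' ψ ψ' W : B} (hp' : IsSMulRegular B p')
    (hβ : IsSMulRegular B β) (hk : IsUnit k₁) (hk' : IsUnit k₁') (h2 : k₂ = ψ * k₁)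
    (h2' : k₂' = k₁' * ψ') (h12 : (p * β) • (k₁ * k₂') = (p' * β') • (k₂' * k₁)) :
    (p' * β') • (k₁' * W * k₁) = (p' * δ) • (k₁' * k₂) - (p * δ) • (k₁ * k₂') ↔
      (β * β') • W = δ • (β • ψ - β' • ψ') := by
  have e : β • ((p' * β') • (k₁' * W * k₁) - ((p' * δ) • (k₁' * k₂) - (p * δ) • (k₁ * k₂'))) =
      p' • (k₁' * ((β * β') • W - δ • (β • ψ - β' • ψ')) * k₁) := by
    have h : β • (p * δ) • (k₁ * k₂') = δ • (p' * β') • (k₁' * ψ' * k₁) := by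
      rw [h2'] at h12 ⊢
      rw [← h12, smul_smul, smul_smul]
      congr 1; ring
    rw [smul_sub, smul_sub, h, h2]
    simp only [mul_add, add_mul, mul_sub, sub_mul, smul_add, smul_sub, mul_smul_comm,
      smul_mul_assoc, mul_assoc, smul_smul]
    module
  rw [← sub_eq_zero, ← sub_eq_zero (b := δ • _)]
  constructor
  · intro h
    rw [h, smul_zero] at e
    have := hp'.right_eq_zero_of_smul e.symm
    rw [mul_assoc] at this
    exact hk.mul_left_eq_zero.1 (hk'.mul_right_eq_zero.1 this)
  · intro h
    rw [h, mul_zero, zero_mul, smul_zero] at e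
    exact hβ.right_eq_zero_of_smul e

lemma fe_reduce {p p' β β' γ γ' : R} {k₁ k₁' k₂ k₂' ψ ψ' W : B} (hp : IsSMulRegular B p)
    (hβ' : IsSMulRegular B β') (hk : IsUnit k₁) (hk' : IsUnit k₁') (h2 : k₂ = k₁ * ψ)
    (h2' : k₂' = ψ' * k₁') (h12 : (p * β) • (k₁ * k₂') = (p' * β') • (k₂' * k₁)) :
    (p * β) • (k₁ * W * k₁') = (p' * γ') • (k₂' * k₁) - (p * γ) • (k₂ * k₁') ↔
      (β * β') • W = (γ' * β) • ψ' - (γ * β') • ψ := by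
  have e : β' • ((p * β) • (k₁ * W * k₁') - ((p' * γ') • (k₂' * k₁) - (p * γ) • (k₂ * k₁'))) =
      p • (k₁ * ((β * β') • W - ((γ' * β) • ψ' - (γ * β') • ψ)) * k₁') := by
    have h : β' • (p' * γ') • (k₂' * k₁) = γ' • (p * β) • (k₁ * ψ' * k₁') := by
      rw [mul_assoc, ← h2', h12, smul_smul, smul_smul]
      congr 1; ring
    rw [smul_sub, smul_sub, h, h2]
    simp only [mul_add, add_mul, mul_sub, sub_mul, smul_add, smul_sub, mul_smul_comm,
      smul_mul_assoc, mul_assoc, smul_smul]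
    module
  rw [← sub_eq_zero, ← sub_eq_zero (b := _ - (γ * β') • ψ)]
  constructor
  · intro h
    rw [h, smul_zero] at e
    have := hp.right_eq_zero_of_smul e.symm
    rw [mul_assoc] at this
    exact hk'.mul_left_eq_zero.1 (hk.mul_right_eq_zero.1 this)
  · intro h
    rw [h, mul_zero, zero_mul, smul_zero] at e
    exact hβ'.right_eq_zero_of_smul e

end Reduce

/-- The six-vertex matrix attached to a pair of scalars. -/
def vtx (q : ℂ) (hq : q ≠ 0) (s t : Scal) : SixVertex Scal where
  α := cst q * s - cst q⁻¹ * t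
  α' := cst q⁻¹ * s - cst q * t
  β := s - t
  γ := cst (q - q⁻¹) * t
  δ := cst (q - q⁻¹) * s
  det := by
    have h : cst q * cst q⁻¹ = 1 := by rw [← map_mul, mul_inv_cancel₀ hq, map_one]
    rw [map_sub]
    linear_combination (2 * s * t - s * s - t * t) * h

section Sectors

variable {A : Type*} [Ring A] [Algebra ℂ A] {q : ℂ} {s t b : Scal} {x y z : BiSeries A}

lemma ex_iff_add : (s - t) • x = (cst q⁻¹ * s - cst q * t) • y + (cst (q - q⁻¹) * b) • z ↔
    Ex q t s b x y z := by
  unfold Ex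
  rw [← neg_inj, ← neg_smul, neg_sub, neg_add, ← neg_smul, neg_sub, ← sub_eq_add_neg]

lemma ex_iff_add' : (s - t) • x = (cst q⁻¹ * s - cst q * t) • y + (cst (q - q⁻¹) * b) • z ↔
    Ex q⁻¹ s t b x y z := by
  rw [ex_iff_add, ex_swap]

lemma ex_iff_sub : (s - t) • x = (cst q * s - cst q⁻¹ * t) • y - (cst (q - q⁻¹) * b) • z ↔
    Ex q s t b x y z := Iff.rfl

lemma ex_iff_sub' : (s - t) • x = (cst q * s - cst q⁻¹ * t) • y - (cst (q - q⁻¹) * b) • z ↔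
    Ex q⁻¹ t s b x y z := by
  rw [ex_iff_sub, ex_swap]

omit [Algebra ℂ A] in
lemma comm_of_ser {P Q : A⟦X⟧} (h : ser₁ P * ser₂ Q = ser₂ Q * ser₁ P) : P * Q = Q * P := by
  rw [co_ext_iff] at h
  refine zc_ext fun n => ?_
  rw [zc_mul, zc_mul, zsum_reflect]
  simp only [co_ser₁_mul_ser₂, co_ser₂_mul_ser₁] at h
  simp only [h, sub_sub_cancel]

omit [Algebra ℂ A] in
lemma comm_psi {K k ψ : A⟦X⟧} (hu : IsUnit k) (h : K = ψ * k) (hc : k * K = K * k) :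
    K = k * ψ := by
  rw [h, ← mul_assoc] at hc
  rw [h]
  exact (hu.mul_right_cancel hc).symm

end Sectors

section Sectors

variable {A : Type*} [Ring A] [Algebra ℂ A] {q : ℂ} {hq : q ≠ 0}

lemma gaussRel_vtx_iff {p p' s t t' : Scal} {k₁ e f k₂ k₁' e' f' k₂' ψ ψ' : BiSeries A}
    (hp : IsSMulRegular (BiSeries A) p) (hp' : IsSMulRegular (BiSeries A) p')
    (hβ : IsSMulRegular (BiSeries A) (s - t)) (hβ' : IsSMulRegular (BiSeries A) (s - t'))
    (hk : IsUnit k₁) (hk' : IsUnit k₁') (hl : k₂ = ψ * k₁) (hr : k₂ = k₁ * ψ)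
    (hl' : k₂' = ψ' * k₁') (hr' : k₂' = k₁' * ψ') :
    GaussRel p p' (vtx q hq s t) (vtx q hq s t') k₁ e f k₂ k₁' e' f' k₂' ↔
      (((p * (cst q * s - cst q⁻¹ * t)) • (k₁ * k₁') =
          (p' * (cst q * s - cst q⁻¹ * t')) • (k₁' * k₁)) ∧
        ((p * (s - t)) • (k₁ * k₂') = (p' * (s - t')) • (k₂' * k₁)) ∧
        ((p * (cst q * s - cst q⁻¹ * t) * (cst q⁻¹ * s - cst q * t) * (s - t')) • (k₂ * k₁') =
          (p' * (cst q * s - cst q⁻¹ * t') * (cst q⁻¹ * s - cst q * t') * (s - t)) •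
            (k₁' * k₂)) ∧
        ((p * (cst q * s - cst q⁻¹ * t)) • (k₂ * k₂') =
          (p' * (cst q * s - cst q⁻¹ * t')) • (k₂' * k₂))) ∧
      ((Ex q s t t (k₁ * e') (e' * k₁) (e * k₁) ∧ Ex q⁻¹ s t t (k₂ * e') (e' * k₂) (e * k₂)) ∧
        Ex q t s s (k₁' * e) (e * k₁') (e' * k₁') ∧ Ex q⁻¹ t s s (k₂' * e) (e * k₂') (e' * k₂')) ∧
      ((Ex q s t' s (f' * k₁) (k₁ * f') (k₁ * f) ∧ Ex q⁻¹ s t' s (f' * k₂) (k₂ * f') (k₂ * f)) ∧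
        Ex q t' s t' (f * k₁') (k₁' * f) (k₁' * f') ∧
        Ex q⁻¹ t' s t' (f * k₂') (k₂' * f) (k₂' * f')) ∧
      (Qd q s t t s (e * e') (e' * e) (e * e) (e' * e') ∧
        Qd q s t' s t' (f' * f) (f * f') (f * f) (f' * f')) ∧
      ((s - t) * (s - t')) • (e * f' - f' * e) =
        (cst (q - q⁻¹) * s) • ((s - t) • ψ - (s - t') • ψ') ∧
      ((s - t) * (s - t')) • (f * e' - e' * f) =
        (cst (q - q⁻¹) * t' * (s - t)) • ψ' - (cst (q - q⁻¹) * t * (s - t')) • ψ := by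
  constructor
  · rintro ⟨h11, h12, h21, h22, e1, e1', e2, e2', f1, f1', f2, f2', ee, ff, ef, fe⟩
    exact ⟨⟨h11, h12, h21, h22⟩,
      ⟨⟨ex_iff_sub.1 e1, ex_iff_add'.1 e2⟩, ex_iff_add.1 e1', ex_iff_sub'.1 e2'⟩,
      ⟨⟨ex_iff_sub.1 f1, ex_iff_add'.1 f2⟩, ex_iff_add.1 f1', ex_iff_sub'.1 f2'⟩,
      ⟨ee, ff⟩, (ef_reduce hp' hβ hk hk' hl hr' h12).1 ef, (fe_reduce hp hβ' hk hk' hr hl' h12).1 fe⟩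
  · rintro ⟨⟨h11, h12, h21, h22⟩, ⟨⟨e1, e2⟩, e1', e2'⟩, ⟨⟨f1, f2⟩, f1', f2'⟩, ⟨ee, ff⟩, ef, fe⟩
    exact ⟨h11, h12, h21, h22, ex_iff_sub.2 e1, ex_iff_add.2 e1', ex_iff_add'.2 e2,
      ex_iff_sub'.2 e2', ex_iff_sub.2 f1, ex_iff_add.2 f1', ex_iff_add'.2 f2,
      ex_iff_sub'.2 f2', ee, ff, (ef_reduce hp' hβ hk hk' hl hr' h12).2 ef,
      (fe_reduce hp hβ' hk hk' hr hl' h12).2 fe⟩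

lemma regular_sub₁₂ {a b : ℂ} (ha : a ≠ 0) :
    IsSMulRegular (BiSeries A) (cst a * var₂ - cst b * var₁) := by
  have := isSMulRegular_linear (A := A) (a := -b) ha
  rwa [map_neg, neg_mul, neg_add_eq_sub] at this

lemma regular_sub₂₁ {a b : ℂ} (hb : b ≠ 0) :
    IsSMulRegular (BiSeries A) (cst a * var₁ - cst b * var₂) := by
  have := isSMulRegular_linear (A := A) (a := a) (neg_ne_zero.2 hb)
  rwa [map_neg, neg_mul, ← sub_eq_add_neg] at this

lemma regular_var₁₂ : IsSMulRegular (BiSeries A) (var₂ - var₁) := by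
  simpa using regular_sub₁₂ (A := A) (b := 1) one_ne_zero

lemma regular_var₂₁ : IsSMulRegular (BiSeries A) (var₁ - var₂) := by
  simpa using regular_sub₂₁ (A := A) (a := 1) one_ne_zero

lemma smul_eq_iff {R M : Type*} [Monoid R] [MulAction R M] {c : R} (hc : IsSMulRegular M c)
    {x y : M} : c • x = c • y ↔ x = y := hc.eq_iff

lemma vtx_same_iff {s t : Scal} {k₁ e f k₂ k₁' e' f' k₂' ψ ψ' : BiSeries A}
    (hα : IsSMulRegular (BiSeries A) (cst q * s - cst q⁻¹ * t))
    (hα' : IsSMulRegular (BiSeries A) (cst q⁻¹ * s - cst q * t))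
    (hβ : IsSMulRegular (BiSeries A) (s - t))
    (hk : IsUnit k₁) (hk' : IsUnit k₁') (hl : k₂ = ψ * k₁) (hr : k₂ = k₁ * ψ)
    (hl' : k₂' = ψ' * k₁') (hr' : k₂' = k₁' * ψ') :
    GaussRel 1 1 (vtx q hq s t) (vtx q hq s t) k₁ e f k₂ k₁' e' f' k₂' ↔
      (k₁ * k₁' = k₁' * k₁ ∧ k₁ * k₂' = k₂' * k₁ ∧ k₂ * k₁' = k₁' * k₂ ∧ k₂ * k₂' = k₂' * k₂) ∧
      ((Ex q s t t (k₁ * e') (e' * k₁) (e * k₁) ∧ Ex q⁻¹ s t t (k₂ * e') (e' * k₂) (e * k₂)) ∧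
        Ex q t s s (k₁' * e) (e * k₁') (e' * k₁') ∧ Ex q⁻¹ t s s (k₂' * e) (e * k₂') (e' * k₂')) ∧
      ((Ex q s t s (f' * k₁) (k₁ * f') (k₁ * f) ∧ Ex q⁻¹ s t s (f' * k₂) (k₂ * f') (k₂ * f)) ∧
        Ex q t s t (f * k₁') (k₁' * f) (k₁' * f') ∧ Ex q⁻¹ t s t (f * k₂') (k₂' * f) (k₂' * f')) ∧
      (Qd q s t t s (e * e') (e' * e) (e * e) (e' * e') ∧
        Qd q s t s t (f' * f) (f * f') (f * f) (f' * f')) ∧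
      (s - t) • (e * f' - f' * e) = (cst (q - q⁻¹) * s) • (ψ - ψ') ∧
      (s - t) • (f * e' - e' * f) = (cst (q - q⁻¹) * t) • (ψ' - ψ) := by
  have h1 : IsSMulRegular (BiSeries A) (1 : Scal) := IsSMulRegular.one _
  rw [gaussRel_vtx_iff h1 h1 hβ hβ hk hk' hl hr hl' hr']
  refine and_congr ?_ (and_congr Iff.rfl (and_congr Iff.rfl (and_congr Iff.rfl ?_)))
  · rw [smul_eq_iff (h1.mul hα), smul_eq_iff (h1.mul hβ), smul_eq_iff (h1.mul hα),
      smul_eq_iff (((h1.mul hα).mul hα').mul hβ)]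
  · refine and_congr ?_ ?_
    · rw [mul_smul, ← smul_sub, smul_comm (cst (q - q⁻¹) * s), smul_eq_iff hβ]
    · rw [mul_smul, mul_smul _ _ ψ', mul_smul _ _ ψ, ← smul_sub, ← smul_sub,
        smul_comm (cst (q - q⁻¹) * t), smul_eq_iff hβ]

/-- The relations among the modes of one sign. -/
structure SameSign (q : ℂ) (r : ℂ) (c d : ℤ) (K₁ K₂ e f : A⟦X⟧) : Prop where
  k11 : ser₁ K₁ * ser₂ K₁ = ser₂ K₁ * ser₁ K₁
  k12 : ser₁ K₁ * ser₂ K₂ = ser₂ K₂ * ser₁ K₁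
  k21 : ser₁ K₂ * ser₂ K₁ = ser₂ K₁ * ser₁ K₂
  k22 : ser₁ K₂ * ser₂ K₂ = ser₂ K₂ * ser₁ K₂
  k1e : HalfE r c K₁ e
  k2e : HalfE r⁻¹ c K₂ e
  k1f : HalfF r d K₁ f
  k2f : HalfF r⁻¹ d K₂ f

variable {K₁ K₂ e f ψ : A⟦X⟧}

lemma pp_iff (hk : IsUnit K₁) (hl : K₂ = ψ * K₁) (hr : K₂ = K₁ * ψ) :
    GaussRel 1 1 (vtx q hq var₂ var₁) (vtx q hq var₂ var₁) (ser₁ K₁) (ser₁ e) (ser₁ f) (ser₁ K₂)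
        (ser₂ K₁) (ser₂ e) (ser₂ f) (ser₂ K₂) ↔
      SameSign q q 0 1 K₁ K₂ e f ∧
      (Qd q var₂ var₁ var₁ var₂ (ser₁ e * ser₂ e) (ser₂ e * ser₁ e) (ser₁ e * ser₁ e)
          (ser₂ e * ser₂ e) ∧
        Qd q var₂ var₁ var₂ var₁ (ser₂ f * ser₁ f) (ser₁ f * ser₂ f) (ser₁ f * ser₁ f)
          (ser₂ f * ser₂ f)) ∧
      ∀ n m, zc e n * zc f m - zc f m * zc e n =
        if 0 ≤ n ∧ 1 ≤ m then -((q - q⁻¹) • zc ψ (n + m)) else 0 := by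
  rw [vtx_same_iff (ψ := ser₁ ψ) (ψ' := ser₂ ψ) (regular_sub₁₂ hq) (regular_sub₁₂ (inv_ne_zero hq))
    regular_var₁₂ (hk.map ser₁) (hk.map ser₂) (by rw [hl, map_mul]) (by rw [hr, map_mul])
    (by rw [hl, map_mul]) (by rw [hr, map_mul]), exE_pp, exE_pp, exE_pp', exE_pp', exF_pp, exF_pp,
    exF_pp', exF_pp', ef_half, ← neg_sub var₁ var₂, ← neg_sub (ser₁ ψ), neg_smul, smul_neg, neg_inj,
    ef_half']
  simp only [co_sub, co_ser₁_mul_ser₂, co_ser₂_mul_ser₁]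
  constructor
  · rintro ⟨⟨h1, h2, h3, h4⟩, ⟨⟨e1, e2⟩, -⟩, ⟨⟨f1, f2⟩, -⟩, hq, h, -⟩
    exact ⟨⟨h1, h2, h3, h4, e1, e2, f1, f2⟩, hq, h⟩
  · rintro ⟨⟨h1, h2, h3, h4, e1, e2, f1, f2⟩, hq, h⟩
    refine ⟨⟨h1, h2, h3, h4⟩, ⟨⟨e1, e2⟩, e1, e2⟩, ⟨⟨f1, f2⟩, f1, f2⟩, hq, h, fun n m => ?_⟩
    rw [← neg_sub, h, add_comm]
    split_ifs <;> first | omega | simp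

lemma mm_iff (hk : IsUnit K₁) (hl : K₂ = ψ * K₁) (hr : K₂ = K₁ * ψ) :
    GaussRel 1 1 (vtx q hq var₁ var₂) (vtx q hq var₁ var₂) (ser₁ K₁) (ser₁ e) (ser₁ f) (ser₁ K₂)
        (ser₂ K₁) (ser₂ e) (ser₂ f) (ser₂ K₂) ↔
      SameSign q q⁻¹ 1 0 K₁ K₂ e f ∧
      (Qd q var₁ var₂ var₂ var₁ (ser₁ e * ser₂ e) (ser₂ e * ser₁ e) (ser₁ e * ser₁ e)
          (ser₂ e * ser₂ e) ∧
        Qd q var₁ var₂ var₁ var₂ (ser₂ f * ser₁ f) (ser₁ f * ser₂ f) (ser₁ f * ser₁ f)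
          (ser₂ f * ser₂ f)) ∧
      ∀ n m, zc e n * zc f m - zc f m * zc e n =
        if 1 ≤ n ∧ 0 ≤ m then (q - q⁻¹) • zc ψ (n + m) else 0 := by
  rw [vtx_same_iff (ψ := ser₁ ψ) (ψ' := ser₂ ψ) (regular_sub₂₁ (inv_ne_zero hq)) (regular_sub₂₁ hq)
    regular_var₂₁ (hk.map ser₁) (hk.map ser₂) (by rw [hl, map_mul]) (by rw [hr, map_mul])
    (by rw [hl, map_mul]) (by rw [hr, map_mul]), exE_mm, exE_mm, exE_mm', exE_mm', exF_mm, exF_mm,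
    exF_mm', exF_mm', ef_half', ← neg_sub var₂ var₁, ← neg_sub (ser₁ ψ), neg_smul, smul_neg, neg_inj,
    ef_half]
  simp only [co_sub, co_ser₁_mul_ser₂, co_ser₂_mul_ser₁]
  constructor
  · rintro ⟨⟨h1, h2, h3, h4⟩, ⟨⟨e1, e2⟩, -⟩, ⟨⟨f1, f2⟩, -⟩, hq, h, -⟩
    exact ⟨⟨h1, h2, h3, h4, e1, e2, f1, f2⟩, hq, h⟩
  · rintro ⟨⟨h1, h2, h3, h4, e1, e2, f1, f2⟩, hq, h⟩
    refine ⟨⟨h1, h2, h3, h4⟩, ⟨⟨e1, e2⟩, e1, e2⟩, ⟨⟨f1, f2⟩, f1, f2⟩, hq, h, fun n m => ?_⟩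
    rw [← neg_sub, h, add_comm]
    split_ifs <;> first | omega | simp

/-- The ratio of two dilations of a power series. -/
def rat (fs : ℂ⟦X⟧) (a b : ℂ) : ℂ⟦X⟧ := PowerSeries.rescale a fs * (PowerSeries.rescale b fs)⁻¹

lemma diagSer_smul_eq_iff {u v ρ : ℂ⟦X⟧} (hv : constantCoeff v ≠ 0) (h : v * ρ = u)
    {x y : BiSeries A} : diagSer u • x = diagSer v • y ↔ y = diagSer ρ • x := by
  rw [← h, map_mul, mul_smul, (isUnit_diagSer hv).smul_left_cancel, eq_comm]

lemma diagSer_rescale_linear (σ a b : ℂ) :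
    diagSer (PowerSeries.rescale σ (C a - C b * X)) = cst a * 1 - cst b * diagVar σ := by
  have h : PowerSeries.rescale σ (C a - C b * X) = C a - C b * (C σ * X) := by
    ext n
    rw [PowerSeries.coeff_rescale]
    rcases n with _ | _ | n
    · simp
    · simp [PowerSeries.coeff_X, PowerSeries.coeff_C]; ring
    · simp [PowerSeries.coeff_X, PowerSeries.coeff_C]
  rw [h, map_sub, map_mul, map_mul, diagSer_C, diagSer_C, diagSer_C, diagSer_X, mul_one, diagVar]

lemma rescale_const (σ a : ℂ) : PowerSeries.rescale σ (C a : ℂ⟦X⟧) = C a := by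
  ext n
  rw [PowerSeries.coeff_rescale, PowerSeries.coeff_C]
  split_ifs with h <;> simp [h]

lemma constantCoeff_rescale (σ : ℂ) (f : ℂ⟦X⟧) :
    constantCoeff (PowerSeries.rescale σ f) = constantCoeff f := by
  rw [← PowerSeries.coeff_zero_eq_constantCoeff_apply, PowerSeries.coeff_rescale]; simp

/-- The series `f(x) / (q - q⁻¹ x)`. -/
def pser (q : ℂ) (fs : ℂ⟦X⟧) : ℂ⟦X⟧ := fs * (C q - C q⁻¹ * X)⁻¹

section Rat

variable {fs : ℂ⟦X⟧} (h0 : constantCoeff fs = 1)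
  (hfe : fs * PowerSeries.rescale (q ^ 2) fs * (1 - C (q ^ 2) * X) = 1 - X)

lemma rescale_mul_inv (h0 : constantCoeff fs = 1) (a : ℂ) :
    PowerSeries.rescale a fs * (PowerSeries.rescale a fs)⁻¹ = 1 :=
  PowerSeries.mul_inv_cancel _ (by rw [constantCoeff_rescale, h0]; exact one_ne_zero)

lemma rat_eq (h0 : constantCoeff fs = 1) {a b : ℂ} {u v : ℂ⟦X⟧}
    (h : v * PowerSeries.rescale a fs = u * PowerSeries.rescale b fs) : v * rat fs a b = u := by
  rw [rat, ← mul_assoc, h, mul_assoc, rescale_mul_inv h0, mul_one]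

lemma pser_mul (hq : q ≠ 0) : pser q fs * (C q - C q⁻¹ * X) = fs := by
  rw [pser, mul_assoc, PowerSeries.inv_mul_cancel, mul_one]
  simpa using hq

lemma constantCoeff_pser (h0 : constantCoeff fs = 1) : constantCoeff (pser q fs) = q⁻¹ := by
  rw [pser, map_mul, h0, one_mul, PowerSeries.constantCoeff_inv]
  simp

lemma pser_functional (hq : q ≠ 0)
    (hfe : fs * PowerSeries.rescale (q ^ 2) fs * (1 - C (q ^ 2) * X) = 1 - X) :
    pser q fs * (C 1 - C 1 * X) * PowerSeries.rescale (q⁻¹ ^ 2) fs = C q⁻¹ := by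
  have hl : C q - C q⁻¹ * X ≠ 0 := fun h => hq (by simpa using congrArg constantCoeff h)
  have h := congrArg (PowerSeries.rescale (q⁻¹ ^ 2)) hfe
  have hX : PowerSeries.rescale (q⁻¹ ^ 2) (1 - C (q ^ 2) * X : ℂ⟦X⟧) = 1 - X := by
    have : (1 - C (q ^ 2) * X : ℂ⟦X⟧) = PowerSeries.rescale (q ^ 2) (1 - X) := by
      rw [map_sub, map_one, PowerSeries.rescale_X]
    rw [this, PowerSeries.rescale_rescale, ← mul_pow, mul_inv_cancel₀ hq, one_pow,
      PowerSeries.rescale_one, RingHom.id_apply]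
  rw [map_mul, map_mul, hX, PowerSeries.rescale_rescale, ← mul_pow, mul_inv_cancel₀ hq, one_pow,
      PowerSeries.rescale_one, RingHom.id_apply, map_sub, map_one, PowerSeries.rescale_X] at h
  have hc : C q * C q⁻¹ = (1 : ℂ⟦X⟧) := by rw [← map_mul, mul_inv_cancel₀ hq, map_one]
  have hc' : C (q⁻¹ ^ 2) = (C q⁻¹ * C q⁻¹ : ℂ⟦X⟧) := by rw [← map_mul, sq]
  refine mul_right_cancel₀ hl ?_
  rw [hc'] at h
  rw [map_one, one_mul]
  linear_combination (1 - X) * PowerSeries.rescale (q⁻¹ ^ 2) fs * pser_mul (fs := fs) hq + h - hc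

end Rat

lemma pm_iff {σ : ℂ} {fs : ℂ⟦X⟧} {K₁ e f K₂ K₁' e' f' K₂' ψ ψ' : A⟦X⟧}
    (h0 : constantCoeff fs = 1)
    (hfe : fs * PowerSeries.rescale (q ^ 2) fs * (1 - C (q ^ 2) * X) = 1 - X)
    (hk : IsUnit K₁) (hk' : IsUnit K₁') (hl : K₂ = ψ * K₁) (hr : K₂ = K₁ * ψ)
    (hl' : K₂' = ψ' * K₁') (hr' : K₂' = K₁' * ψ') :
    GaussRel (diagSer (PowerSeries.rescale σ⁻¹ (pser q fs)))
        (diagSer (PowerSeries.rescale σ (pser q fs)))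
        (vtx q hq 1 (diagVar σ⁻¹)) (vtx q hq 1 (diagVar σ)) (ser₁ K₁) (ser₁ e) (ser₁ f) (ser₁ K₂)
        (ser₂ K₁') (ser₂ e') (ser₂ f') (ser₂ K₂') ↔
      (ser₂ K₁' * ser₁ K₁ = diagSer (rat fs σ⁻¹ σ) • (ser₁ K₁ * ser₂ K₁') ∧
        ser₂ K₂' * ser₁ K₁ =
          diagSer (rat fs (q⁻¹ ^ 2 * σ) (q⁻¹ ^ 2 * σ⁻¹)) • (ser₁ K₁ * ser₂ K₂') ∧
        ser₂ K₁' * ser₁ K₂ =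
          diagSer (rat fs (q ^ 2 * σ) (q ^ 2 * σ⁻¹)) • (ser₁ K₂ * ser₂ K₁') ∧
        ser₂ K₂' * ser₁ K₂ = diagSer (rat fs σ⁻¹ σ) • (ser₁ K₂ * ser₂ K₂')) ∧
      ((CrossE q 0 σ⁻¹ K₁ e e' ∧ CrossE q⁻¹ 0 σ⁻¹ K₂ e e') ∧
        CrossE q⁻¹ 1 σ⁻¹ K₁' e' e ∧ CrossE q⁻¹⁻¹ 1 σ⁻¹ K₂' e' e) ∧
      ((CrossF q 1 σ K₁ f f' ∧ CrossF q⁻¹ 1 σ K₂ f f') ∧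
        CrossF q⁻¹ 0 σ K₁' f' f ∧ CrossF q⁻¹⁻¹ 0 σ K₂' f' f) ∧
      (Qd q 1 (diagVar σ⁻¹) (diagVar σ⁻¹) 1 (ser₁ e * ser₂ e') (ser₂ e' * ser₁ e)
          (ser₁ e * ser₁ e) (ser₂ e' * ser₂ e') ∧
        Qd q 1 (diagVar σ) 1 (diagVar σ) (ser₂ f' * ser₁ f) (ser₁ f * ser₂ f')
          (ser₁ f * ser₁ f) (ser₂ f' * ser₂ f')) ∧
      (∀ n m, zc e n * zc f' m - zc f' m * zc e n =
        (q - q⁻¹) • ((if 0 ≤ m then σ ^ m • zc ψ (n - m) else 0) -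
          if 0 ≤ n then σ⁻¹ ^ n • zc ψ' (m - n) else 0)) ∧
      ∀ n m, zc f n * zc e' m - zc e' m * zc f n =
        (q - q⁻¹) • ((if 1 ≤ n then σ • σ ^ (n - 1) • zc ψ' (m - n) else 0) -
          if 1 ≤ m then σ⁻¹ • σ⁻¹ ^ (m - 1) • zc ψ (n - m) else 0) := by
  have hp : ∀ c : ℂ, IsUnit (diagSer (PowerSeries.rescale c (pser q fs))) := fun c =>
    isUnit_diagSer (by rw [constantCoeff_rescale, constantCoeff_pser h0]; exact inv_ne_zero hq)
  have hg : ∀ c : ℂ, IsUnit (1 - diagVar c) := fun c => IsUnit.of_mul_eq_one _ (geom_mul c)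
  rw [gaussRel_vtx_iff (ψ := ser₁ ψ) (ψ' := ser₂ ψ') ((hp _).isSMulRegular _)
    ((hp _).isSMulRegular _) ((hg _).isSMulRegular _) ((hg _).isSMulRegular _)
    (hk.map ser₁) (hk'.map ser₂) (by rw [hl, map_mul]) (by rw [hr, map_mul])
    (by rw [hl', map_mul]) (by rw [hr', map_mul]), exE_pm, exE_pm, exE_pm', exE_pm', exF_pm, exF_pm,
    exF_pm', exF_pm', mul_one (cst (q - q⁻¹)), ef_cross]
  rw [show cst (q - q⁻¹) * diagVar σ * (1 - diagVar σ⁻¹) =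
      cst (q - q⁻¹) * (diagVar σ * (1 - diagVar σ⁻¹)) by ring,
    show cst (q - q⁻¹) * diagVar σ⁻¹ * (1 - diagVar σ) =
      cst (q - q⁻¹) * (diagVar σ⁻¹ * (1 - diagVar σ)) by ring, mul_smul (cst (q - q⁻¹)),
    mul_smul (cst (q - q⁻¹)), ← smul_sub, ef_cross']
  simp only [co_sub, co_ser₁_mul_ser₂, co_ser₂_mul_ser₁]
  refine and_congr ?_ Iff.rfl
  have h1 : ∀ c : ℂ, 1 - diagVar c = diagSer (PowerSeries.rescale c (C 1 - C 1 * X)) := fun c => by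
    rw [diagSer_rescale_linear, map_one, one_mul, one_mul]
  simp only [h1, ← diagSer_rescale_linear, ← map_mul, pser_mul hq]
  have e1 := pser_functional (fs := fs) hq hfe
  refine and_congr (diagSer_smul_eq_iff ?_ (rat_eq h0 ?_)) (and_congr (diagSer_smul_eq_iff ?_ (rat_eq h0 ?_))
    (and_congr (diagSer_smul_eq_iff ?_ (rat_eq h0 ?_)) (diagSer_smul_eq_iff ?_ (rat_eq h0 ?_))))
  · rw [constantCoeff_rescale, h0]; exact one_ne_zero
  · exact mul_comm _ _
  · simp [constantCoeff_rescale, constantCoeff_pser h0, hq]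
  · rw [← PowerSeries.rescale_rescale, ← PowerSeries.rescale_rescale, ← map_mul, ← map_mul, e1,
      rescale_const, rescale_const]
  · simp [constantCoeff_rescale, h0, hq]
  · rw [← PowerSeries.rescale_rescale, ← PowerSeries.rescale_rescale]
    have e2 : ∀ c : ℂ, PowerSeries.rescale c (fs * (C q⁻¹ - C q * X)) *
        PowerSeries.rescale c (PowerSeries.rescale (q ^ 2) fs) =
        C q⁻¹ * PowerSeries.rescale c (C 1 - C 1 * X) := fun c => by
      have hc : C q⁻¹ * C (q ^ 2) = (C q : ℂ⟦X⟧) := by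
        rw [← map_mul, sq, inv_mul_cancel_left₀ hq]
      conv_rhs => rw [← rescale_const c q⁻¹]
      rw [← map_mul, ← map_mul]
      congr 1
      rw [map_one, one_mul]
      linear_combination C q⁻¹ * hfe + fs * PowerSeries.rescale (q ^ 2) fs * X * hc
    linear_combination PowerSeries.rescale σ⁻¹ (C 1 - C 1 * X : ℂ⟦X⟧) * e2 σ -
      PowerSeries.rescale σ (C 1 - C 1 * X : ℂ⟦X⟧) * e2 σ⁻¹
  · rw [constantCoeff_rescale, h0]; exact one_ne_zero
  · exact mul_comm _ _

end Sectors

section Core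

variable {A : Type*} [Ring A] [Algebra ℂ A] {q : ℂ} {hq : q ≠ 0}

lemma ef_iff {θ σ : ℂ} (hσ : σ ≠ 0) {x y : ℤ → A} {e f e' f' ψ ψ' : A⟦X⟧}
    (he : ∀ n, zc e n = cutGE 0 x n) (he' : ∀ n, zc e' n = -(σ⁻¹ ^ n • cutLT 0 x (-n)))
    (hf : ∀ n, zc f n = cutGE 1 y n) (hf' : ∀ n, zc f' n = -(σ ^ n • cutLT 1 y (-n))) :
    (∀ n m, x n * y m - y m * x n = θ • (σ ^ (m - n) • zc ψ' (-(n + m)) - zc ψ (n + m))) ↔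
      (∀ n m, zc e n * zc f m - zc f m * zc e n =
        if 0 ≤ n ∧ 1 ≤ m then -(θ • zc ψ (n + m)) else 0) ∧
      (∀ n m, zc e' n * zc f' m - zc f' m * zc e' n =
        if 1 ≤ n ∧ 0 ≤ m then θ • zc ψ' (n + m) else 0) ∧
      (∀ n m, zc e n * zc f' m - zc f' m * zc e n =
        θ • ((if 0 ≤ m then σ ^ m • zc ψ (n - m) else 0) -
          if 0 ≤ n then σ⁻¹ ^ n • zc ψ' (m - n) else 0)) ∧
      ∀ n m, zc f n * zc e' m - zc e' m * zc f n =
        θ • ((if 1 ≤ n then σ • σ ^ (n - 1) • zc ψ' (m - n) else 0) -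
          if 1 ≤ m then σ⁻¹ • σ⁻¹ ^ (m - 1) • zc ψ (n - m) else 0) := by
  have hz : ∀ a b : ℤ, σ ^ a * σ ^ b = σ ^ (a + b) := fun a b => (zpow_add₀ hσ a b).symm
  have h1 : ∀ n : ℤ, σ * σ ^ (n - 1) = σ ^ n := fun n => by
    rw [← zpow_one_add₀ hσ]; congr 1; ring
  have h2 : ∀ n : ℤ, σ⁻¹ * σ ^ (-(n - 1)) = σ ^ (-n) := fun n => by
    rw [← zpow_neg_one, hz]; congr 1; ring
  have h3 : ∀ n : ℤ, σ⁻¹ ^ n = σ ^ (-n) := fun n => by rw [inv_zpow, zpow_neg]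
  have e1 : ∀ n, 0 ≤ n → zc e n = x n := fun n hn => by rw [he, cutGE, if_pos hn]
  have f1 : ∀ n, 1 ≤ n → zc f n = y n := fun n hn => by rw [hf, cutGE, if_pos hn]
  have f0 : ∀ n, n < 1 → zc f n = 0 := fun n hn => by rw [hf, cutGE, if_neg (by omega)]
  have e1' : ∀ n, 1 ≤ n → zc e' n = -(σ ^ (-n) • x (-n)) := fun n hn => by
    rw [he', cutLT, if_neg (by omega), h3]
  have e0' : ∀ n, n < 1 → zc e' n = 0 := fun n hn => by rw [he', cutLT, if_pos (by omega)]; simp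
  have f1' : ∀ n, 0 ≤ n → zc f' n = -(σ ^ n • y (-n)) := fun n hn => by
    rw [hf', cutLT, if_neg (by omega)]
  have comm_mm : ∀ (a b : ℂ) (u v : A), -(a • u) * -(b • v) - -(b • v) * -(a • u) =
      (a * b) • (u * v - v * u) := fun a b u v => by
    rw [neg_mul_neg, neg_mul_neg, smul_mul_smul_comm, smul_mul_smul_comm, mul_comm b, smul_sub]
  have comm_pm : ∀ (b : ℂ) (u v : A), u * -(b • v) - -(b • v) * u = (-b) • (u * v - v * u) :=
    fun b u v => by
    rw [mul_neg, neg_mul, mul_smul_comm, smul_mul_assoc, neg_smul, smul_sub]; abel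
  have comm_mp : ∀ (b : ℂ) (u v : A), v * -(b • u) - -(b • u) * v = b • (u * v - v * u) :=
    fun b u v => by
    rw [mul_neg, neg_mul, mul_smul_comm, smul_mul_assoc, smul_sub]; abel
  have transfer : ∀ {a : ℂ} {u v w : A}, a ≠ 0 → w = a • v → (a • u = w ↔ u = v) := by
    rintro a u v _ ha rfl
    exact ⟨fun h => smul_right_injective A ha h, fun h => h ▸ rfl⟩
  have hz' : ∀ (z : A) (a b c : ℤ), b + c = a → σ ^ b • σ ^ c • z = σ ^ a • z := by
    rintro z _ b c rfl
    rw [smul_smul, hz]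
  have q1 : ∀ n m, 0 ≤ n → 1 ≤ m → (zc e n * zc f m - zc f m * zc e n = -(θ • zc ψ (n + m)) ↔
      x n * y m - y m * x n = θ • (σ ^ (m - n) • zc ψ' (-(n + m)) - zc ψ (n + m))) :=
    fun n m hn hm => by
    rw [e1 n hn, f1 m hm, zc_of_neg ψ' (by omega), smul_zero, zero_sub, smul_neg]
  have q2 : ∀ n m, 1 ≤ n → 0 ≤ m → (zc e' n * zc f' m - zc f' m * zc e' n = θ • zc ψ' (n + m) ↔
      x (-n) * y (-m) - y (-m) * x (-n) =
        θ • (σ ^ (-m - -n) • zc ψ' (-(-n + -m)) - zc ψ (-n + -m))) := fun n m hn hm => by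
    rw [e1' n hn, f1' m hm, comm_mm, zc_of_neg ψ (by omega : -n + -m < 0)]
    refine transfer (mul_ne_zero (zpow_ne_zero _ hσ) (zpow_ne_zero _ hσ)) ?_
    rw [sub_zero, smul_smul, smul_smul, show -(-n + -m) = n + m by ring]
    congr 1
    rw [mul_right_comm, hz, hz, show -n + m + (-m - -n) = 0 by ring, zpow_zero, one_mul]
  have q3 : ∀ n m, 0 ≤ n → 0 ≤ m → (zc e n * zc f' m - zc f' m * zc e n =
        θ • (σ ^ m • zc ψ (n - m) - σ ^ (-n) • zc ψ' (m - n)) ↔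
      x n * y (-m) - y (-m) * x n =
        θ • (σ ^ (-m - n) • zc ψ' (-(n + -m)) - zc ψ (n + -m))) := fun n m hn hm => by
    rw [e1 n hn, f1' m hm, comm_pm]
    refine transfer (neg_ne_zero.2 (zpow_ne_zero _ hσ)) ?_
    rw [← hz' _ (-n) m (-m - n) (by ring), show -(n + -m) = m - n by ring,
      show n + -m = n - m by ring]
    module
  have q4 : ∀ n m, 1 ≤ n → 1 ≤ m → (zc f n * zc e' m - zc e' m * zc f n =
        θ • (σ ^ n • zc ψ' (m - n) - σ ^ (-m) • zc ψ (n - m)) ↔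
      x (-m) * y n - y n * x (-m) =
        θ • (σ ^ (n - -m) • zc ψ' (-(-m + n)) - zc ψ (-m + n))) := fun n m hn hm => by
    rw [f1 n hn, e1' m hm, comm_mp]
    refine transfer (zpow_ne_zero _ hσ) ?_
    rw [← hz' _ n (-m) (n - -m) (by ring), show -(-m + n) = m - n by ring,
      show -m + n = n - m by ring]
    module
  simp only [smul_smul, h1, h3, h2]
  constructor
  · intro h
    refine ⟨fun n m => ?_, fun n m => ?_, fun n m => ?_, fun n m => ?_⟩
    · split_ifs with hc
      · exact (q1 n m hc.1 hc.2).2 (h n m)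
      · rcases lt_or_ge n 0 with hn | hn
        · rw [zc_of_neg e hn]; simp
        · rw [f0 m (by omega)]; simp
    · split_ifs with hc
      · exact (q2 n m hc.1 hc.2).2 (h _ _)
      · rcases lt_or_ge m 0 with hm | hm
        · rw [zc_of_neg f' hm]; simp
        · rw [e0' n (by omega)]; simp
    · rcases lt_or_ge n 0 with hn | hn <;> rcases lt_or_ge m 0 with hm | hm
      · rw [zc_of_neg e hn, if_neg (by omega), if_neg (by omega)]; simp
      · rw [zc_of_neg e hn, if_pos (by omega), if_neg (by omega), zc_of_neg ψ (by omega)]; simp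
      · rw [zc_of_neg f' hm, if_neg (by omega), if_pos (by omega), zc_of_neg ψ' (by omega)]; simp
      · rw [if_pos hm, if_pos hn]; exact (q3 n m hn hm).2 (h _ _)
    · rcases lt_or_ge n 1 with hn | hn <;> rcases lt_or_ge m 1 with hm | hm
      · rw [f0 n hn, if_neg (by omega), if_neg (by omega)]; simp
      · rw [f0 n hn, if_neg (by omega), if_pos (by omega), zc_of_neg ψ (by omega)]; simp
      · rw [e0' m hm, if_pos (by omega), if_neg (by omega), zc_of_neg ψ' (by omega)]; simp
      · rw [if_pos hm, if_pos hn]; exact (q4 n m hn hm).2 (h _ _)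
  · rintro ⟨ha, hb, hc, hd⟩ n m
    rcases le_or_gt 0 n with hn | hn <;> rcases le_or_gt 1 m with hm | hm
    · have := ha n m
      rw [if_pos ⟨hn, hm⟩] at this
      exact (q1 n m hn hm).1 this
    · have := hc n (-m)
      rw [if_pos (by omega), if_pos hn] at this
      simpa only [neg_neg] using (q3 n (-m) hn (by omega)).1 this
    · have := hd m (-n)
      rw [if_pos hm, if_pos (by omega)] at this
      simpa only [neg_neg] using (q4 m (-n) hm (by omega)).1 this
    · have := hb (-n) (-m)
      rw [if_pos (by omega)] at this
      simpa only [neg_neg] using (q2 (-n) (-m) (by omega) (by omega)).1 this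

end Core

section Core

variable {A : Type*} [Ring A] [Algebra ℂ A]

/-- The negatives of the reflected modes `x (-m)`, dilated by `κ`. -/
def reflect (κ : ℂ) (x : ℤ → A) (m : ℤ) : A := -(κ ^ m • x (-m))

lemma cutGE_one_reflect {κ : ℂ} (x : ℤ → A) (m : ℤ) :
    cutGE 1 (reflect κ x) m = -(κ ^ m • cutLT 0 x (-m)) := by
  unfold cutGE cutLT reflect; split_ifs <;> first | omega | simp

lemma cutGE_zero_reflect {κ : ℂ} (x : ℤ → A) (m : ℤ) :
    cutGE 0 (reflect κ x) m = -(κ ^ m • cutLT 1 x (-m)) := by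
  unfold cutGE cutLT reflect; split_ifs <;> first | omega | simp

lemma neg_cutLT_one_reflect {κ : ℂ} (hκ : κ ≠ 0) (x : ℤ → A) (m : ℤ) :
    -(κ ^ m • cutLT 1 (reflect κ x) (-m)) = cutGE 0 x m := by
  unfold cutGE cutLT reflect
  split_ifs <;> first | omega | simp [smul_smul, mul_inv_cancel₀ (zpow_ne_zero m hκ)]

lemma neg_cutLT_zero_reflect {κ : ℂ} (hκ : κ ≠ 0) (x : ℤ → A) (m : ℤ) :
    -(κ ^ m • cutLT 0 (reflect κ x) (-m)) = cutGE 1 x m := by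
  unfold cutGE cutLT reflect
  split_ifs <;> first | omega | simp [smul_smul, mul_inv_cancel₀ (zpow_ne_zero m hκ)]

/-- The exchange relations of a Cartan series with the full currents `x` and `y`. -/
def Exch (r : ℂ) (K : A⟦X⟧) (x y : ℤ → A) : Prop :=
  LinRel r (fun n m => zc K n * x m) (fun n m => x m * zc K n) 0 ∧
    LinRel r (fun n m => y m * zc K n) (fun n m => zc K n * y m) 0

/-- The relations of the Drinfeld-type realization. -/
structure CurrentRel (q σ : ℂ) (fs : ℂ⟦X⟧) (x y : ℤ → A) (K₁ K₂ K₁' K₂' ψ ψ' : A⟦X⟧) : Prop where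
  pp11 : ser₁ K₁ * ser₂ K₁ = ser₂ K₁ * ser₁ K₁
  pp12 : ser₁ K₁ * ser₂ K₂ = ser₂ K₂ * ser₁ K₁
  pp21 : ser₁ K₂ * ser₂ K₁ = ser₂ K₁ * ser₁ K₂
  pp22 : ser₁ K₂ * ser₂ K₂ = ser₂ K₂ * ser₁ K₂
  mm11 : ser₁ K₁' * ser₂ K₁' = ser₂ K₁' * ser₁ K₁'
  mm12 : ser₁ K₁' * ser₂ K₂' = ser₂ K₂' * ser₁ K₁'
  mm21 : ser₁ K₂' * ser₂ K₁' = ser₂ K₁' * ser₁ K₂'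
  mm22 : ser₁ K₂' * ser₂ K₂' = ser₂ K₂' * ser₁ K₂'
  pm11 : ser₂ K₁' * ser₁ K₁ = diagSer (rat fs σ⁻¹ σ) • (ser₁ K₁ * ser₂ K₁')
  pm12 : ser₂ K₂' * ser₁ K₁ =
    diagSer (rat fs (q⁻¹ ^ 2 * σ) (q⁻¹ ^ 2 * σ⁻¹)) • (ser₁ K₁ * ser₂ K₂')
  pm21 : ser₂ K₁' * ser₁ K₂ = diagSer (rat fs (q ^ 2 * σ) (q ^ 2 * σ⁻¹)) • (ser₁ K₂ * ser₂ K₁')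
  pm22 : ser₂ K₂' * ser₁ K₂ = diagSer (rat fs σ⁻¹ σ) • (ser₁ K₂ * ser₂ K₂')
  exch₁ : Exch q K₁ x y
  exch₂ : Exch q⁻¹ K₂ x y
  exch₁' : Exch q⁻¹ K₁' (reflect σ⁻¹ x) (reflect σ y)
  exch₂' : Exch q⁻¹⁻¹ K₂' (reflect σ⁻¹ x) (reflect σ y)
  ee : ∀ n m, quadForm q (fun i j => x i * x j) (fun i j => x i * x j) n m = 0
  ff : ∀ n m, quadForm q (fun i j => y j * y i) (fun i j => y j * y i) n m = 0
  ef : ∀ n m, x n * y m - y m * x n =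
    (q - q⁻¹) • (σ ^ (m - n) • zc ψ' (-(n + m)) - zc ψ (n + m))

theorem currentRel_iff {q σ : ℂ} (hq : q ≠ 0) (hσ : σ ≠ 0) {fs : ℂ⟦X⟧}
    (h0 : constantCoeff fs = 1)
    (hfe : fs * PowerSeries.rescale (q ^ 2) fs * (1 - C (q ^ 2) * X) = 1 - X)
    {x y : ℤ → A} {K₁ e f K₂ K₁' e' f' K₂' ψ ψ' : A⟦X⟧}
    (he : ∀ n, zc e n = cutGE 0 x n) (he' : ∀ n, zc e' n = -(σ⁻¹ ^ n • cutLT 0 x (-n)))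
    (hf : ∀ n, zc f n = cutGE 1 y n) (hf' : ∀ n, zc f' n = -(σ ^ n • cutLT 1 y (-n)))
    (hk : IsUnit K₁) (hk' : IsUnit K₁') (hl : K₂ = ψ * K₁) (hr : K₂ = K₁ * ψ)
    (hl' : K₂' = ψ' * K₁') (hr' : K₂' = K₁' * ψ') :
    CurrentRel q σ fs x y K₁ K₂ K₁' K₂' ψ ψ' ↔
      GaussRel 1 1 (vtx q hq var₂ var₁) (vtx q hq var₂ var₁) (ser₁ K₁) (ser₁ e) (ser₁ f)
        (ser₁ K₂) (ser₂ K₁) (ser₂ e) (ser₂ f) (ser₂ K₂) ∧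
      GaussRel 1 1 (vtx q hq var₁ var₂) (vtx q hq var₁ var₂) (ser₁ K₁') (ser₁ e') (ser₁ f')
        (ser₁ K₂') (ser₂ K₁') (ser₂ e') (ser₂ f') (ser₂ K₂') ∧
      GaussRel (diagSer (PowerSeries.rescale σ⁻¹ (pser q fs)))
        (diagSer (PowerSeries.rescale σ (pser q fs)))
        (vtx q hq 1 (diagVar σ⁻¹)) (vtx q hq 1 (diagVar σ)) (ser₁ K₁) (ser₁ e) (ser₁ f) (ser₁ K₂)
        (ser₂ K₁') (ser₂ e') (ser₂ f') (ser₂ K₂') := by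
  have hσ' := inv_ne_zero hσ
  have hl₁ : ∀ r K, Exch r K x y ↔
      (HalfE r 0 K e ∧ CrossE r 0 σ⁻¹ K e e') ∧ HalfF r 1 K f ∧ CrossF r 1 σ K f f' :=
    fun r K => and_congr (linE_iff le_rfl hσ' he he') (linF_iff zero_le_one hσ hf hf')
  have hl₂ : ∀ r K, Exch r K (reflect σ⁻¹ x) (reflect σ y) ↔
      (HalfE r 1 K e' ∧ CrossE r 1 σ⁻¹ K e' e) ∧ HalfF r 0 K f' ∧ CrossF r 0 σ K f' f :=
    fun r K => and_congr
      (linE_iff zero_le_one hσ' (fun m => by rw [he', cutGE_one_reflect])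
        fun m => by rw [he, neg_cutLT_one_reflect hσ'])
      (linF_iff le_rfl hσ (fun m => by rw [hf', cutGE_zero_reflect])
        fun m => by rw [hf, neg_cutLT_zero_reflect hσ])
  rw [pp_iff hk hl hr, mm_iff hk' hl' hr', pm_iff h0 hfe hk hk' hl hr hl' hr']
  have hee := quadE_iff (q := q) hσ' he he'
  have hff := quadF_iff (q := q) hσ hf hf'
  have hef := ef_iff (θ := q - q⁻¹) (ψ := ψ) (ψ' := ψ') hσ he he' hf hf'
  constructor
  · intro H
    obtain ⟨⟨a1, a2⟩, a3, a4⟩ := (hl₁ _ _).1 H.exch₁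
    obtain ⟨⟨b1, b2⟩, b3, b4⟩ := (hl₁ _ _).1 H.exch₂
    obtain ⟨⟨c1, c2⟩, c3, c4⟩ := (hl₂ _ _).1 H.exch₁'
    obtain ⟨⟨d1, d2⟩, d3, d4⟩ := (hl₂ _ _).1 H.exch₂'
    obtain ⟨e1, e2, e3⟩ := hee.1 H.ee
    obtain ⟨f1, f2, f3⟩ := hff.1 H.ff
    obtain ⟨g1, g2, g3, g4⟩ := hef.1 H.ef
    exact ⟨⟨⟨H.pp11, H.pp12, H.pp21, H.pp22, a1, b1, a3, b3⟩, ⟨e1, f1⟩, g1⟩,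
      ⟨⟨H.mm11, H.mm12, H.mm21, H.mm22, c1, d1, c3, d3⟩, ⟨e2, f2⟩, g2⟩,
      ⟨H.pm11, H.pm12, H.pm21, H.pm22⟩, ⟨⟨a2, b2⟩, c2, d2⟩, ⟨⟨a4, b4⟩, c4, d4⟩, ⟨e3, f3⟩, g3, g4⟩
  · rintro ⟨⟨⟨p1, p2, p3, p4, a1, b1, a3, b3⟩, ⟨e1, f1⟩, g1⟩,
      ⟨⟨m1, m2, m3, m4, c1, d1, c3, d3⟩, ⟨e2, f2⟩, g2⟩,
      ⟨k1, k2, k3, k4⟩, ⟨⟨a2, b2⟩, c2, d2⟩, ⟨⟨a4, b4⟩, c4, d4⟩, ⟨e3, f3⟩, g3, g4⟩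
    exact ⟨p1, p2, p3, p4, m1, m2, m3, m4, k1, k2, k3, k4,
      (hl₁ _ _).2 ⟨⟨a1, a2⟩, a3, a4⟩, (hl₁ _ _).2 ⟨⟨b1, b2⟩, b3, b4⟩,
      (hl₂ _ _).2 ⟨⟨c1, c2⟩, c3, c4⟩, (hl₂ _ _).2 ⟨⟨d1, d2⟩, d3, d4⟩,
      hee.2 ⟨e1, e2, e3⟩, hff.2 ⟨f1, f2, f3⟩, hef.2 ⟨g1, g2, g3, g4⟩⟩

end Core

section Taylor

/-- The Taylor series at the origin. -/
def taylorSeries (g : ℂ → ℂ) : ℂ⟦X⟧ :=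
  PowerSeries.mk fun m => iteratedDeriv m g 0 / (m.factorial : ℂ)

lemma coeff_taylorSeries (g : ℂ → ℂ) (m : ℕ) :
    coeff m (taylorSeries g) = iteratedDeriv m g 0 / (m.factorial : ℂ) :=
  PowerSeries.coeff_mk _ _

lemma taylorSeries_congr {g g' : ℂ → ℂ} (h : g =ᶠ[nhds 0] g') :
    taylorSeries g = taylorSeries g' := by
  ext m
  rw [coeff_taylorSeries, coeff_taylorSeries, h.iteratedDeriv_eq]

lemma constantCoeff_taylorSeries (g : ℂ → ℂ) : constantCoeff (taylorSeries g) = g 0 := by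
  rw [← PowerSeries.coeff_zero_eq_constantCoeff_apply, coeff_taylorSeries]
  simp

lemma taylorSeries_mul {f g : ℂ → ℂ} (hf : AnalyticAt ℂ f 0) (hg : AnalyticAt ℂ g 0) :
    taylorSeries (fun x => f x * g x) = taylorSeries f * taylorSeries g := by
  ext m
  have e : (fun x => f x * g x) = f * g := rfl
  simp only [coeff_taylorSeries, e, iteratedDeriv_mul hf.contDiffAt hg.contDiffAt,
    Finset.sum_div, PowerSeries.coeff_mul,
    Finset.Nat.sum_antidiagonal_eq_sum_range_succ_mk, Nat.succ_eq_add_one]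
  refine Finset.sum_congr rfl fun i hi ↦ ?_
  rw [Nat.cast_choose _ (by grind)]
  field_simp [Nat.factorial_ne_zero]

lemma taylorSeries_add {f g : ℂ → ℂ} (hf : AnalyticAt ℂ f 0) (hg : AnalyticAt ℂ g 0) :
    taylorSeries (fun x => f x + g x) = taylorSeries f + taylorSeries g := by
  ext m
  have e : (fun x => f x + g x) = f + g := rfl
  rw [map_add, coeff_taylorSeries, coeff_taylorSeries, coeff_taylorSeries, e,
    iteratedDeriv_add hf.contDiffAt hg.contDiffAt, add_div]

lemma taylorSeries_const (c : ℂ) : taylorSeries (fun _ => c) = C c := by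
  ext m
  rw [coeff_taylorSeries, PowerSeries.coeff_C, iteratedDeriv_const]
  split_ifs with h <;> simp [h]

lemma taylorSeries_id : taylorSeries (fun x => x) = X := by
  ext m
  rw [coeff_taylorSeries, PowerSeries.coeff_X]
  rcases m with _ | _ | m
  · simp
  · simp
  · have : iteratedDeriv (m + 1 + 1) (fun x : ℂ => x) 0 = 0 := by
      rw [iteratedDeriv_succ', show deriv (fun x : ℂ => x) = fun _ => 1 from by ext; simp,
        iteratedDeriv_const]
      simp
    rw [this]; simp

lemma iteratedDeriv_comp_mul_left' (m : ℕ) (g : ℂ → ℂ) (c : ℂ) :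
    iteratedDeriv m (fun x => g (c * x)) = fun x => c ^ m * iteratedDeriv m g (c * x) := by
  induction m with
  | zero => simp
  | succ m ih =>
    rw [iteratedDeriv_succ, ih, iteratedDeriv_succ]
    ext x
    rw [deriv_const_mul_field, deriv_comp_mul_left c (iteratedDeriv m g), smul_eq_mul, pow_succ]
    ring

lemma taylorSeries_comp_mul (g : ℂ → ℂ) (c : ℂ) :
    taylorSeries (fun x => g (x * c)) = PowerSeries.rescale c (taylorSeries g) := by
  ext m
  have e : (fun x => g (x * c)) = fun x => g (c * x) := by ext x; rw [mul_comm]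
  rw [PowerSeries.coeff_rescale, coeff_taylorSeries, coeff_taylorSeries, e,
    iteratedDeriv_comp_mul_left']
  simp [mul_div_assoc]

lemma taylorSeries_div {f g : ℂ → ℂ} (hf : AnalyticAt ℂ f 0) (hg : AnalyticAt ℂ g 0)
    (h0 : g 0 ≠ 0) : taylorSeries (fun x => f x / g x) = taylorSeries f * (taylorSeries g)⁻¹ := by
  have hc : constantCoeff (taylorSeries g) ≠ 0 := by rwa [constantCoeff_taylorSeries]
  have h1 : taylorSeries (fun x => f x / g x) * taylorSeries g = taylorSeries f := by
    rw [← taylorSeries_mul (hf.fun_div hg h0) hg]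
    refine taylorSeries_congr ?_
    filter_upwards [hg.continuousAt.eventually_ne h0] with x hx
    exact div_mul_cancel₀ _ hx
  rw [PowerSeries.eq_mul_inv_iff_mul_eq hc, h1]

end Taylor

section Product

variable {q : ℂ}

/-- The infinite product `∏ (1 - x q^{4n})`. -/
def qProd (q x : ℂ) : ℂ := ∏' n : ℕ, (1 + -(x * q ^ (4 * n)))

lemma summable_norm_pow_four (hq : ‖q‖ < 1) : Summable fun n : ℕ => ‖q‖ ^ (4 * n) := by
  simp_rw [pow_mul]
  exact summable_geometric_of_lt_one (by positivity) (pow_lt_one₀ (norm_nonneg _) hq (by norm_num))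

lemma summable_qProd (hq : ‖q‖ < 1) (x : ℂ) : Summable fun n : ℕ => ‖-(x * q ^ (4 * n))‖ := by
  simp only [norm_neg, norm_mul, norm_pow]
  exact (summable_norm_pow_four hq).mul_left _

lemma hasProd_qProd (hq : ‖q‖ < 1) (x : ℂ) :
    HasProd (fun n : ℕ => 1 + -(x * q ^ (4 * n))) (qProd q x) :=
  (multipliable_one_add_of_summable (summable_qProd hq x)).hasProd

lemma qProd_ne_zero (hq : ‖q‖ < 1) {x : ℂ} (hx : ‖x‖ < 1) : qProd q x ≠ 0 := by
  refine tprod_one_add_ne_zero_of_summable (fun n h => ?_) (summable_qProd hq x)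
  have h1 : x * q ^ (4 * n) = 1 := by linear_combination -h
  have h2 : ‖x * q ^ (4 * n)‖ < 1 := by
    rw [norm_mul, norm_pow]
    exact mul_lt_one_of_nonneg_of_lt_one_left (norm_nonneg _) hx
      (pow_le_one₀ (norm_nonneg _) hq.le)
  rw [h1, norm_one] at h2
  exact lt_irrefl _ h2

lemma qProd_eq (hq : ‖q‖ < 1) (x : ℂ) : qProd q x = (1 - x) * qProd q (x * q ^ 4) := by
  have e : ∀ n : ℕ, 1 + -(x * q ^ (4 * (n + 1))) = 1 + -(x * q ^ 4 * q ^ (4 * n)) := by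
    intro n; ring
  rw [qProd, tprod_eq_zero_mul']
  · simp only [e]
    rw [← qProd]
    ring
  · simp only [e]
    exact (hasProd_qProd hq _).multipliable

lemma analyticAt_qProd (hq : ‖q‖ < 1) : AnalyticAt ℂ (qProd q) 0 := by
  have h := (summable_norm_pow_four hq).hasProdLocallyUniformlyOn_nat_one_add
    (f := fun n x => -(x * q ^ (4 * n))) (Metric.isOpen_ball (x := (0 : ℂ)) (ε := 1))
    (.of_forall fun n x hx => by
      rw [norm_neg, norm_mul, norm_pow]
      exact mul_le_of_le_one_left (by positivity) (by simpa using (Metric.mem_ball.1 hx).le))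
    (fun _ => by fun_prop)
  have hd := h.differentiableOn (.of_forall fun _ => by
    simpa [Finset.prod_fn] using DifferentiableOn.finsetProd (fun _ _ => by fun_prop))
    Metric.isOpen_ball
  exact hd.analyticAt (Metric.isOpen_ball.mem_nhds (Metric.mem_ball_self one_pos))

lemma norm_mul_pow_lt_one (hq : ‖q‖ < 1) {x : ℂ} (hx : ‖x‖ < 1) (j : ℕ) : ‖x * q ^ j‖ < 1 := by
  rw [norm_mul, norm_pow]
  exact mul_lt_one_of_nonneg_of_lt_one_left (norm_nonneg _) hx (pow_le_one₀ (norm_nonneg _) hq.le)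

lemma fProd_eq (hq : ‖q‖ < 1) {x : ℂ} (hx : ‖x‖ < 1) :
    fProd q x = qProd q x * qProd q (x * q ^ 4) / qProd q (x * q ^ 2) ^ 2 := by
  have h2 := hasProd_qProd hq (x * q ^ 2)
  have hne := qProd_ne_zero hq (norm_mul_pow_lt_one hq hx 2)
  have h := ((hasProd_qProd hq x).mul (hasProd_qProd hq (x * q ^ 4))).div₀ (h2.mul h2)
    (mul_ne_zero hne hne)
  rw [pow_two (qProd q _), ← h.tprod_eq, fProd]
  refine tprod_congr fun n => ?_
  rw [show 4 * n + 4 = 4 + 4 * n from by ring, show 4 * n + 2 = 2 + 4 * n from by ring, pow_add,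
    pow_add]
  ring_nf

lemma eventually_norm_lt_one : ∀ᶠ x : ℂ in nhds 0, ‖x‖ < 1 := by
  filter_upwards [Metric.ball_mem_nhds (0 : ℂ) one_pos] with x hx
  simpa using hx

lemma analyticAt_comp_mul {g : ℂ → ℂ} (hg : AnalyticAt ℂ g 0) (c : ℂ) :
    AnalyticAt ℂ (fun x => g (x * c)) 0 := by
  have : AnalyticAt ℂ g ((fun x : ℂ => x * c) 0) := by simpa using hg
  have h' : AnalyticAt ℂ (fun x : ℂ => x * c) 0 := analyticAt_id.mul analyticAt_const
  exact AnalyticAt.comp (f := fun x : ℂ => x * c) this h'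

lemma fProd_zero (q : ℂ) : fProd q 0 = 1 := by simp [fProd]

lemma analyticAt_fProd (hq : ‖q‖ < 1) : AnalyticAt ℂ (fProd q) 0 := by
  have h := analyticAt_qProd hq
  have h4 : AnalyticAt ℂ (fun x => qProd q x * qProd q (x * q ^ 4) / qProd q (x * q ^ 2) ^ 2) 0 :=
    (h.mul (analyticAt_comp_mul h _)).div ((analyticAt_comp_mul h _).pow 2)
      (pow_ne_zero 2 (qProd_ne_zero hq (by simp)))
  refine h4.congr ?_
  filter_upwards [eventually_norm_lt_one] with x hx
  exact (fProd_eq hq hx).symm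

lemma fProd_functional (hq : ‖q‖ < 1) {x : ℂ} (hx : ‖x‖ < 1) :
    fProd q x * fProd q (x * q ^ 2) * (1 - x * q ^ 2) = 1 - x := by
  have a0 := qProd_ne_zero hq hx
  have a2 := qProd_ne_zero hq (norm_mul_pow_lt_one hq hx 2)
  have a4 := qProd_ne_zero hq (norm_mul_pow_lt_one hq hx 4)
  have e0 := qProd_eq hq x
  have e2 := qProd_eq hq (x * q ^ 2)
  rw [fProd_eq hq hx, fProd_eq hq (norm_mul_pow_lt_one hq hx 2)]
  rw [show x * q ^ 2 * q ^ 2 = x * q ^ 4 from by ring] at *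
  field_simp
  rw [e0]
  rw [e2]
  ring_nf

end Product

section Structure

variable {q : ℂ}

lemma constantCoeff_taylorSeries_fProd (q : ℂ) : constantCoeff (taylorSeries (fProd q)) = 1 := by
  rw [constantCoeff_taylorSeries, fProd_zero]

lemma taylorSeries_linear (a b : ℂ) : taylorSeries (fun x => a + x * b) = C a + C b * X := by
  have h := taylorSeries_add (f := fun _ => a) (g := fun x => x * b) analyticAt_const
    (analyticAt_id.mul analyticAt_const)
  have h' := taylorSeries_mul (f := fun x => x) (g := fun _ => b) analyticAt_id analyticAt_const
  rw [h, h', taylorSeries_const, taylorSeries_const, taylorSeries_id, mul_comm X]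

lemma taylorSeries_fProd_functional (hq : ‖q‖ < 1) :
    taylorSeries (fProd q) * PowerSeries.rescale (q ^ 2) (taylorSeries (fProd q)) *
      (1 - C (q ^ 2) * X) = 1 - X := by
  have hf := analyticAt_fProd hq
  have hf2 := analyticAt_comp_mul hf (q ^ 2)
  have hl : AnalyticAt ℂ (fun x : ℂ => 1 + x * -q ^ 2) 0 :=
    analyticAt_const.add (analyticAt_id.mul analyticAt_const)
  have e1 : (1 - C (q ^ 2) * X : ℂ⟦X⟧) = taylorSeries fun x => 1 + x * -q ^ 2 := by
    rw [taylorSeries_linear, map_neg, map_one]; ring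
  have e2 : (1 - X : ℂ⟦X⟧) = taylorSeries fun x => 1 + x * -1 := by
    rw [taylorSeries_linear, map_neg, map_one]; ring
  rw [e1, e2, ← taylorSeries_comp_mul, ← taylorSeries_mul hf hf2,
    ← taylorSeries_mul (hf.fun_mul hf2) hl]
  refine taylorSeries_congr ?_
  filter_upwards [eventually_norm_lt_one] with x hx
  linear_combination fProd_functional hq hx

lemma norm_exp_lt_one {h : ℂ} (hh : h.re < 0) : ‖Complex.exp h‖ < 1 := by
  rw [Complex.norm_exp]; rwa [Real.exp_lt_one_iff]

lemma ratioCoeff_eq {h : ℂ} (hh : h.re < 0) (a b : ℂ) (m : ℕ) :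
    ratioCoeff h a b m = coeff m (rat (taylorSeries (fProd (Complex.exp h)))
      (Complex.exp (h * a)) (Complex.exp (h * b))) := by
  have hf := analyticAt_fProd (norm_exp_lt_one hh)
  rw [rat, ← taylorSeries_comp_mul, ← taylorSeries_comp_mul,
    ← taylorSeries_div (analyticAt_comp_mul hf _) (analyticAt_comp_mul hf _)
      (by rw [zero_mul, fProd_zero]; exact one_ne_zero), coeff_taylorSeries, ratioCoeff]

/-- The polynomial numerator of the entries of the R-matrix with a linear numerator. -/
def numer (q : ℂ) (x y : Fin 2 × Fin 2) : ℂ × ℂ :=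
  if x = y then (if x.1 = x.2 then (q, -q⁻¹) else (1, -1))
  else if x = (0, 1) ∧ y = (1, 0) then (0, q - q⁻¹)
  else if x = (1, 0) ∧ y = (0, 1) then (q - q⁻¹, 0)
  else (0, 0)

lemma RC_eq {h : ℂ} (hh : h.re < 0) (x y : Fin 2 × Fin 2) (m : ℕ) :
    RC h x y m = coeff m (pser (Complex.exp h) (taylorSeries (fProd (Complex.exp h))) *
      (C (numer (Complex.exp h) x y).1 + C (numer (Complex.exp h) x y).2 * X)) := by
  set q := Complex.exp h with hqd
  have hq0 : q ≠ 0 := Complex.exp_ne_zero h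
  have hf := analyticAt_fProd (norm_exp_lt_one hh)
  have hl : ∀ a b : ℂ, AnalyticAt ℂ (fun x : ℂ => a + x * b) 0 := fun a b =>
    analyticAt_const.add (analyticAt_id.mul analyticAt_const)
  have hd0 : (q + (0 : ℂ) * -q⁻¹) ≠ 0 := by simpa using hq0
  have e : REnt h x y =ᶠ[nhds 0] fun t => fProd q t *
      ((numer q x y).1 + t * (numer q x y).2) / (q + t * -q⁻¹) := by
    filter_upwards [(hl q (-q⁻¹)).continuousAt.eventually_ne hd0] with t ht
    have ht' : q - t * q⁻¹ ≠ 0 := by rw [sub_eq_add_neg, ← mul_neg]; exact ht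
    have hn : q + t * -q⁻¹ = q - t * q⁻¹ := by ring
    simp only [REnt, numer, ← hqd, Complex.exp_neg, hn]
    rw [mul_div_assoc (fProd q t)]
    congr 1
    split_ifs
    · rw [eq_div_iff ht']; ring
    all_goals ring
  have key : taylorSeries (REnt h x y) = pser q (taylorSeries (fProd q)) *
      (C (numer q x y).1 + C (numer q x y).2 * X) := by
    rw [taylorSeries_congr e, taylorSeries_div (hf.fun_mul (hl _ _)) (hl _ _) hd0,
      taylorSeries_mul hf (hl _ _), taylorSeries_linear, taylorSeries_linear, pser, map_neg]
    rw [show C q + -C q⁻¹ * X = (C q - C q⁻¹ * X : ℂ⟦X⟧) from by ring]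
    ring
  rw [← key, coeff_taylorSeries, RC]

end Structure

lemma ent_vtx {q : ℂ} (hq : q ≠ 0) (s t : Scal) (x y : Fin 2 × Fin 2) :
    (vtx q hq s t).ent x y = cst (numer q x y).1 * s + cst (numer q x y).2 * t := by
  unfold SixVertex.ent numer vtx
  simp only
  split_ifs <;> simp only [map_zero, map_one, map_neg] <;> ring

lemma diagSer_rescale_add (κ a b : ℂ) :
    diagSer (PowerSeries.rescale κ (C a + C b * X)) = cst a * 1 + cst b * diagVar κ := by
  have hC : ∀ c : ℂ, PowerSeries.rescale κ (C c) = C c := fun c => by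
    ext n; rw [PowerSeries.coeff_rescale, PowerSeries.coeff_C]; split_ifs with h <;> simp [h]
  rw [map_add, map_add, map_mul, map_mul, hC, hC, PowerSeries.rescale_X, map_mul, diagSer_C,
    diagSer_C, diagSer_C, diagSer_X, diagVar]
  ring

section

variable {A : Type*} [Ring A] [Algebra ℂ A]

/-- The antidiagonal of an array, as a power series. -/
def lineSer (y : ℤ → ℤ → A) (d : ℤ) : A⟦X⟧ := PowerSeries.mk fun n => y n (d - n)

lemma coeff_map_mul_lineSer (c : ℂ⟦X⟧) (y : ℤ → ℤ → A) (d : ℤ) (n : ℕ) :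
    coeff n (PowerSeries.map (algebraMap ℂ A) c * lineSer y d) =
      ∑ m ∈ range (n + 1), coeff m c • y ((n : ℤ) - m) (d - n + m) := by
  rw [PowerSeries.coeff_mul, Finset.Nat.sum_antidiagonal_eq_sum_range_succ_mk]
  refine Finset.sum_congr rfl fun m hm => ?_
  have hm' : m ≤ n := Nat.lt_succ_iff.1 (Finset.mem_range.1 hm)
  rw [PowerSeries.coeff_map, lineSer, PowerSeries.coeff_mk, Algebra.smul_def, Nat.cast_sub hm']
  congr 2
  ring

lemma coeff_linear_mul_lineSer (a b : ℂ) {y : ℤ → ℤ → A} (hy : ∀ n m, n < 0 → y n m = 0)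
    (d : ℤ) (n : ℕ) :
    coeff n (PowerSeries.map (algebraMap ℂ A) (C a + C b * X) * lineSer y d) =
      a • y n (d - n) + b • y ((n : ℤ) - 1) (d - n + 1) := by
  have e : PowerSeries.map (algebraMap ℂ A) (C a + C b * X) =
      C (algebraMap ℂ A a) + C (algebraMap ℂ A b) * X := by
    rw [map_add, map_mul, PowerSeries.map_C, PowerSeries.map_C, PowerSeries.map_X]
  rw [e, add_mul, mul_assoc, map_add, PowerSeries.coeff_C_mul, PowerSeries.coeff_C_mul, ← Algebra.smul_def,
    ← Algebra.smul_def]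
  congr 2
  · rw [lineSer, PowerSeries.coeff_mk]
  · rcases n with _ | n
    · rw [PowerSeries.coeff_zero_X_mul, hy _ _ (by norm_num)]
    · rw [PowerSeries.coeff_succ_X_mul, lineSer, PowerSeries.coeff_mk]
      push_cast
      congr 1 <;> ring

lemma antidiagonal_iff {ι : Type*} [Fintype ι] {p : ℂ⟦X⟧} (hp : constantCoeff p ≠ 0)
    {y y' : ι → ℤ → ℤ → A} (hy : ∀ i n m, n < 0 → y i n m = 0)
    (hy' : ∀ i n m, n < 0 → y' i n m = 0) (N N' : ι → ℂ × ℂ) :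
    (∀ α β : ℤ, ∑ i, ∑ m ∈ range (α.toNat + 1),
        coeff m (p * (C (N i).1 + C (N i).2 * X)) • y i (α - m) (β + m) =
      ∑ i, ∑ m ∈ range (α.toNat + 1),
        coeff m (p * (C (N' i).1 + C (N' i).2 * X)) • y' i (α - m) (β + m)) ↔
    ∀ α β : ℤ, ∑ i, ((N i).1 • y i α β + (N i).2 • y i (α - 1) (β + 1)) =
      ∑ i, ((N' i).1 • y' i α β + (N' i).2 • y' i (α - 1) (β + 1)) := by
  have hu : IsUnit (PowerSeries.map (algebraMap ℂ A) p) :=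
    (PowerSeries.isUnit_iff_constantCoeff.2 (isUnit_iff_ne_zero.2 hp)).map _
  have key : ∀ (y : ι → ℤ → ℤ → A) (N : ι → ℂ × ℂ) (n : ℕ) (d : ℤ),
      coeff n (PowerSeries.map (algebraMap ℂ A) p * ∑ i,
        PowerSeries.map (algebraMap ℂ A) (C (N i).1 + C (N i).2 * X) * lineSer (y i) d) =
      ∑ i, ∑ m ∈ range (n + 1),
        coeff m (p * (C (N i).1 + C (N i).2 * X)) • y i ((n : ℤ) - m) (d - n + m) := by
    intro y N n d
    rw [Finset.mul_sum, map_sum]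
    refine Finset.sum_congr rfl fun i _ => ?_
    rw [← mul_assoc, ← map_mul, coeff_map_mul_lineSer]
  constructor
  · intro h α β
    rcases lt_or_ge α 0 with hα | hα
    · simp only [hy _ _ _ hα, hy' _ _ _ hα, hy _ (α - 1) _ (by omega), hy' _ (α - 1) _ (by omega),
        smul_zero]
    obtain ⟨n, rfl⟩ := Int.eq_ofNat_of_zero_le hα
    have hs : ∑ i, PowerSeries.map (algebraMap ℂ A) (C (N i).1 + C (N i).2 * X) *
          lineSer (y i) (n + β) =
        ∑ i, PowerSeries.map (algebraMap ℂ A) (C (N' i).1 + C (N' i).2 * X) *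
          lineSer (y' i) (n + β) := by
      refine hu.mul_left_cancel (PowerSeries.ext fun j => ?_)
      rw [key, key]
      have := h j (n + β - j)
      rwa [Int.toNat_natCast] at this
    have := congrArg (coeff n) hs
    rw [map_sum, map_sum] at this
    simp only [coeff_linear_mul_lineSer _ _ (hy _), coeff_linear_mul_lineSer _ _ (hy' _)] at this
    rwa [show (n : ℤ) + β - n = β by ring] at this
  · intro h α β
    rcases lt_or_ge α 0 with hα | hα
    · have hz : ∀ m : ℕ, α - m < 0 := fun m => by omega
      simp only [hy _ _ _ (hz _), hy' _ _ _ (hz _), smul_zero, Finset.sum_const_zero]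
    obtain ⟨n, rfl⟩ := Int.eq_ofNat_of_zero_le hα
    have e := key y N n (n + β)
    have e' := key y' N' n (n + β)
    rw [show (n : ℤ) + β - n = β by ring] at e e'
    rw [Int.toNat_natCast, ← e, ← e']
    congr 2
    ext j
    rw [map_sum, map_sum]
    simp only [coeff_linear_mul_lineSer _ _ (hy _), coeff_linear_mul_lineSer _ _ (hy' _)]
    exact h _ _

end

section Exchange

variable {A : Type*} [Ring A] [Algebra ℂ A] {h : ℂ}

lemma constantCoeff_pser_ne_zero (h : ℂ) :
    constantCoeff (pser (Complex.exp h) (taylorSeries (fProd (Complex.exp h)))) ≠ 0 := by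
  rw [constantCoeff_pser (constantCoeff_taylorSeries_fProd _)]
  exact inv_ne_zero (Complex.exp_ne_zero h)

lemma rll_pp_iff (hh : h.re < 0) (P : Fin 2 → Fin 2 → A⟦X⟧) :
    (∀ (i a j b : Fin 2) (α β : ℤ),
      ∑ kk : Fin 2, ∑ c : Fin 2, ∑ m ∈ range (α.toNat + 1),
        RC h (i, a) (kk, c) m • (zc (P kk j) (α - m) * zc (P c b) (β + m)) =
      ∑ kk : Fin 2, ∑ c : Fin 2, ∑ m ∈ range (α.toNat + 1),
        RC h (kk, c) (j, b) m • (zc (P a c) (β + m) * zc (P i kk) (α - m))) ↔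
    RLL 1 1 (vtx (Complex.exp h) (Complex.exp_ne_zero h) var₂ var₁) (vtx (Complex.exp h) (Complex.exp_ne_zero h) var₂ var₁)
      (fun i j => ser₁ (P i j)) (fun i j => ser₂ (P i j)) := by
  unfold RLL
  refine forall_congr' fun i => forall_congr' fun a => forall_congr' fun j => forall_congr' fun b => ?_
  have key := antidiagonal_iff (ι := Fin 2 × Fin 2) (constantCoeff_pser_ne_zero h)
    (y := fun x n m => zc (P x.1 j) n * zc (P x.2 b) m)
    (y' := fun x n m => zc (P a x.2) m * zc (P i x.1) n)
    (fun x n m hn => by simp only [zc_of_neg _ hn, zero_mul])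
    (fun x n m hn => by simp only [zc_of_neg _ hn, mul_zero])
    (fun x => numer (Complex.exp h) (i, a) x) (fun x => numer (Complex.exp h) x (j, b))
  simp only [← RC_eq hh, Fintype.sum_prod_type] at key
  rw [key, co_ext_iff, one_smul, one_smul]
  simp only [co_sum, ent_vtx, add_smul, mul_smul, co_add, co_cst_smul, co_var₁_smul, co_var₂_smul,
    co_ser₁_mul_ser₂, co_ser₂_mul_ser₁]
  constructor
  · intro H n m
    simpa using H n (m - 1)
  · intro H n m
    simpa using H n (m + 1)

lemma rll_mm_iff (hh : h.re < 0) (P : Fin 2 → Fin 2 → A⟦X⟧) :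
    (∀ (i a j b : Fin 2) (α β : ℤ),
      ∑ kk : Fin 2, ∑ c : Fin 2, ∑ m ∈ range (β.toNat + 1),
        RC h (i, a) (kk, c) m • (zc (P kk j) (α + m) * zc (P c b) (β - m)) =
      ∑ kk : Fin 2, ∑ c : Fin 2, ∑ m ∈ range (β.toNat + 1),
        RC h (kk, c) (j, b) m • (zc (P a c) (β - m) * zc (P i kk) (α + m))) ↔
    RLL 1 1 (vtx (Complex.exp h) (Complex.exp_ne_zero h) var₁ var₂) (vtx (Complex.exp h) (Complex.exp_ne_zero h) var₁ var₂)
      (fun i j => ser₁ (P i j)) (fun i j => ser₂ (P i j)) := by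
  unfold RLL
  refine forall_congr' fun i => forall_congr' fun a => forall_congr' fun j => forall_congr' fun b => ?_
  have key := antidiagonal_iff (ι := Fin 2 × Fin 2) (constantCoeff_pser_ne_zero h)
    (y := fun x n m => zc (P x.1 j) m * zc (P x.2 b) n)
    (y' := fun x n m => zc (P a x.2) n * zc (P i x.1) m)
    (fun x n m hn => by simp only [zc_of_neg _ hn, mul_zero])
    (fun x n m hn => by simp only [zc_of_neg _ hn, zero_mul])
    (fun x => numer (Complex.exp h) (i, a) x) (fun x => numer (Complex.exp h) x (j, b))
  simp only [← RC_eq hh, Fintype.sum_prod_type] at key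
  rw [forall_comm, key, co_ext_iff, one_smul, one_smul]
  simp only [co_sum, ent_vtx, add_smul, mul_smul, co_add, co_cst_smul, co_var₁_smul, co_var₂_smul,
    co_ser₁_mul_ser₂, co_ser₂_mul_ser₁]
  constructor
  · intro H n m
    simpa using H m (n - 1)
  · intro H m n
    simpa using H (n + 1) m

lemma exp_mul_natCast (x : ℂ) (m : ℕ) : Complex.exp (x * m) = Complex.exp x ^ m := by
  rw [mul_comm, Complex.exp_nat_mul]

lemma diag_sum_eq (hh : h.re < 0) (κ : ℂ) (s t : ℤ → A) (x y : Fin 2 × Fin 2)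
    (hs : ∀ n < 0, s n = 0) (ht : ∀ n < 0, t n = 0)
    (g : A → A → A) (hg : ∀ a, g 0 a = 0) (hg' : ∀ a, g a 0 = 0) (B : BiSeries A)
    (hB : ∀ n m, co B n m = g (s n) (t m)) (α β : ℤ) :
    ∑ m ∈ range ((min α β).toNat + 1),
        (κ ^ m * RC h x y m) • g (s (α - m)) (t (β - m)) =
      co (diagSer (PowerSeries.rescale κ (pser (Complex.exp h) (taylorSeries (fProd (Complex.exp h))))) •
        ((vtx (Complex.exp h) (Complex.exp_ne_zero h) 1 (diagVar κ)).ent x y • B)) α β := by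
  rw [ent_vtx, ← diagSer_rescale_add, smul_smul, ← map_mul, ← map_mul, co_diagSer_smul]
  rcases lt_or_ge (min α β) 0 with hm | hm
  · rw [zsum_of_neg hm]
    refine Finset.sum_eq_zero fun m _ => ?_
    rcases min_lt_iff.1 hm with h' | h'
    · rw [hs _ (by omega), hg, smul_zero]
    · rw [ht _ (by omega), hg', smul_zero]
  · obtain ⟨n, hn⟩ := Int.eq_ofNat_of_zero_le hm
    rw [hn, zsum_natCast, Int.toNat_natCast]
    refine Finset.sum_congr rfl fun m _ => ?_
    rw [hB, Int.toNat_natCast, PowerSeries.coeff_rescale, RC_eq hh]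

lemma rll_pm_iff (hh : h.re < 0) (k : ℂ) (P M : Fin 2 → Fin 2 → A⟦X⟧) :
    (∀ (i a j b : Fin 2) (α β : ℤ),
      ∑ kk : Fin 2, ∑ c : Fin 2, ∑ m ∈ range ((min α β).toNat + 1),
        (Complex.exp (-(h * k) * (m : ℂ)) * RC h (i, a) (kk, c) m) •
          (zc (P kk j) (α - m) * zc (M c b) (β - m)) =
      ∑ kk : Fin 2, ∑ c : Fin 2, ∑ m ∈ range ((min α β).toNat + 1),
        (Complex.exp ((h * k) * (m : ℂ)) * RC h (kk, c) (j, b) m) •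
          (zc (M a c) (β - m) * zc (P i kk) (α - m))) ↔
    RLL (diagSer (PowerSeries.rescale (Complex.exp (h * k))⁻¹ (pser (Complex.exp h) (taylorSeries (fProd (Complex.exp h))))))
      (diagSer (PowerSeries.rescale (Complex.exp (h * k)) (pser (Complex.exp h) (taylorSeries (fProd (Complex.exp h))))))
      (vtx (Complex.exp h) (Complex.exp_ne_zero h) 1 (diagVar (Complex.exp (h * k))⁻¹))
      (vtx (Complex.exp h) (Complex.exp_ne_zero h) 1 (diagVar (Complex.exp (h * k))))
      (fun i j => ser₁ (P i j)) (fun i j => ser₂ (M i j)) := by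
  unfold RLL
  refine forall_congr' fun i => forall_congr' fun a => forall_congr' fun j => forall_congr' fun b => ?_
  rw [co_ext_iff]
  refine forall_congr' fun α => forall_congr' fun β => ?_
  have hz : ∀ (Q : A⟦X⟧), ∀ n < 0, zc Q n = 0 := fun Q n hn => zc_of_neg Q hn
  have e₁ := fun kk c => diag_sum_eq hh (Complex.exp (h * k))⁻¹ (zc (P kk j)) (zc (M c b))
    (i, a) (kk, c) (hz _) (hz _) (fun a b => a * b) (fun _ => zero_mul _) (fun _ => mul_zero _)
    (ser₁ (P kk j) * ser₂ (M c b)) (co_ser₁_mul_ser₂ _ _) α β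
  have e₂ := fun kk c => diag_sum_eq hh (Complex.exp (h * k)) (zc (P i kk)) (zc (M a c))
    (kk, c) (j, b) (hz _) (hz _) (fun a b => b * a) (fun _ => mul_zero _) (fun _ => zero_mul _)
    (ser₂ (M a c) * ser₁ (P i kk)) (co_ser₂_mul_ser₁ _ _) α β
  simp only [exp_mul_natCast, Complex.exp_neg (h * k), e₁, e₂, Finset.smul_sum, co_sum]

end Exchange

section SeriesInverse

variable {A B : Type*} [Ring A] [Ring B]

lemma seriesInv_succ (a : ℕ → A) (b : A) (n : ℕ) :
    seriesInv a b (n + 1) = -(b * ∑ j ∈ range (n + 1), a (n + 1 - j) * seriesInv a b j) := by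
  rw [seriesInv, Finset.sum_attach (range (n + 1)) fun j => a (n + 1 - j) * seriesInv a b j]

lemma map_seriesInv (g : A →+* B) (a : ℕ → A) (b : A) (n : ℕ) :
    g (seriesInv a b n) = seriesInv (fun n => g (a n)) (g b) n := by
  induction n using Nat.strong_induction_on with
  | _ n ih =>
    rcases n with _ | n
    · simp only [seriesInv]
    · rw [seriesInv_succ, seriesInv_succ, map_neg, map_mul, map_sum]
      refine congrArg _ (congrArg _ (Finset.sum_congr rfl fun j hj => ?_))
      rw [map_mul, ih j (by simpa using hj)]

lemma mul_mk_seriesInv {a : ℕ → A} {b : A} (h : a 0 * b = 1) :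
    PowerSeries.mk a * PowerSeries.mk (seriesInv a b) = 1 := by
  ext n
  rw [PowerSeries.coeff_mul, ← Finset.Nat.sum_antidiagonal_swap,
    Finset.Nat.sum_antidiagonal_eq_sum_range_succ_mk]
  simp only [Prod.swap, PowerSeries.coeff_mk, PowerSeries.coeff_one]
  rcases n with _ | n
  · simp [seriesInv, h]
  · rw [Nat.succ_eq_add_one, Finset.sum_range_succ, Nat.sub_self, seriesInv_succ, mul_neg,
      ← mul_assoc, h, one_mul]
    simp

lemma mk_seriesInv_mul {a : ℕ → A} {b : A} (h : a 0 * b = 1) (h' : b * a 0 = 1) :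
    PowerSeries.mk (seriesInv a b) * PowerSeries.mk a = 1 := by
  have hu : IsUnit (PowerSeries.mk a) := by
    rw [PowerSeries.isUnit_iff_constantCoeff, PowerSeries.constantCoeff_mk]
    exact ⟨⟨a 0, b, h, h'⟩, rfl⟩
  refine hu.mul_left_cancel ?_
  rw [← mul_assoc, mul_mk_seriesInv h, one_mul, mul_one]

end SeriesInverse

section Rescaling

variable {A : Type*} [Ring A] [Algebra ℂ A]

lemma smul_eq_smul_iff {c : ℂ} (hc : c ≠ 0) {x y : A} : c • x = c • y ↔ x = y :=
  ⟨fun h => by simpa [smul_smul, inv_mul_cancel₀ hc] using congrArg (c⁻¹ • ·) h, fun h => by rw [h]⟩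

lemma linRel_neg_index_iff {κ : ℂ} (hκ : κ ≠ 0) (r : ℂ) (u v : ℤ → ℤ → A) :
    LinRel r (fun n m => κ ^ m • u n (-m)) (fun n m => κ ^ m • v n (-m)) 0 ↔
      ∀ n m, κ • u (n - 1) m - u n (m + 1) = (κ * r⁻¹) • v (n - 1) m - r • v n (m + 1) := by
  have key : ∀ n m, ((κ ^ (-m - 1) • u n (-(-m - 1)) - κ ^ (-m) • u (n - 1) (-(-m)) =
        r • κ ^ (-m - 1) • v n (-(-m - 1)) - r⁻¹ • κ ^ (-m) • v (n - 1) (-(-m)) + 0) ↔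
      κ • u (n - 1) m - u n (m + 1) = (κ * r⁻¹) • v (n - 1) m - r • v n (m + 1)) := by
    intro n m
    have hz : κ ^ (-m - 1) ≠ 0 := zpow_ne_zero _ hκ
    have e : κ ^ (-m) = κ ^ (-m - 1) * κ := by rw [← zpow_add_one₀ hκ]; congr 1; ring
    rw [show -(-m - 1) = m + 1 by ring, neg_neg, e,
      ← smul_eq_smul_iff (neg_ne_zero.2 hz) (x := κ • u (n - 1) m - _)]
    constructor <;> intro h
    · linear_combination (norm := module) h
    · linear_combination (norm := module) h
  constructor
  · intro h n m
    exact (key n m).1 (h n (-m))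
  · intro h n m
    have := (key n (-m)).2 (h n (-m))
    rwa [neg_neg] at this

lemma linRel_neg_iff {κ : ℂ} (hκ : κ ≠ 0) (r : ℂ) (u v : ℤ → ℤ → A) :
    LinRel r (fun n m => -(κ ^ m • u n m)) (fun n m => -(κ ^ m • v n m)) 0 ↔
      ∀ n m, κ⁻¹ • u (n + 1) m - u n (m + 1) = (κ⁻¹ * r) • v (n + 1) m - r⁻¹ • v n (m + 1) := by
  have key : ∀ n m, ((-(κ ^ m • u (n + 1) m) - -(κ ^ (m + 1) • u n (m + 1)) =
        r • -(κ ^ m • v (n + 1) m) - r⁻¹ • -(κ ^ (m + 1) • v n (m + 1)) + 0) ↔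
      κ⁻¹ • u (n + 1) m - u n (m + 1) = (κ⁻¹ * r) • v (n + 1) m - r⁻¹ • v n (m + 1)) := by
    intro n m
    have hz : κ ^ (m + 1) ≠ 0 := zpow_ne_zero _ hκ
    have e : κ ^ m = κ ^ (m + 1) * κ⁻¹ := by rw [zpow_add_one₀ hκ, mul_inv_cancel_right₀ hκ]
    rw [e, ← smul_eq_smul_iff (neg_ne_zero.2 hz) (x := κ⁻¹ • u (n + 1) m - _)]
    constructor <;> intro h
    · linear_combination (norm := module) h
    · linear_combination (norm := module) h
  constructor
  · intro h n m
    have := h (n + 1) (m + 1)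
    simp only [add_sub_cancel_right] at this
    exact (key n m).1 this
  · intro h n m
    have := (key (n - 1) (m - 1)).2 (h _ _)
    simp only [sub_add_cancel] at this
    exact this

lemma quadForm_iff {κ q : ℂ} (hκ : κ ≠ 0) (hq : q ≠ 0) (w : ℤ → ℤ → A) :
    (∀ n m, quadForm q (fun i j => κ ^ (i + j) • w (-i) (-j))
        (fun i j => κ ^ (i + j) • w (-i) (-j)) n m = 0) ↔
      ∀ a b, w (a + 1) b - q ^ 2 • w a (b + 1) = q ^ 2 • w b (a + 1) - w (b + 1) a := by
  have key : ∀ a b, (quadForm q (fun i j => κ ^ (i + j) • w (-i) (-j))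
        (fun i j => κ ^ (i + j) • w (-i) (-j)) (-a) (-b) = 0 ↔
      w (a + 1) b - q ^ 2 • w a (b + 1) = q ^ 2 • w b (a + 1) - w (b + 1) a) := by
    intro a b
    have hz : κ ^ (-a - b - 1) ≠ 0 := zpow_ne_zero _ hκ
    have hc : q * (κ ^ (-a - b - 1))⁻¹ ≠ 0 := mul_ne_zero hq (inv_ne_zero hz)
    unfold quadForm
    beta_reduce
    rw [show -a + (-b - 1) = -a - b - 1 by ring, show -a - 1 + -b = -a - b - 1 by ring,
      show -b - 1 + -a = -a - b - 1 by ring, show -b + (-a - 1) = -a - b - 1 by ring,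
      neg_neg, neg_neg, show -(-b - 1) = b + 1 by ring, show -(-a - 1) = a + 1 by ring,
      ← smul_eq_smul_iff hc, smul_zero]
    simp only [smul_add, smul_sub, smul_smul]
    rw [show q * (κ ^ (-a - b - 1))⁻¹ * (q * κ ^ (-a - b - 1)) = q ^ 2 by field_simp,
      show q * (κ ^ (-a - b - 1))⁻¹ * (q⁻¹ * κ ^ (-a - b - 1)) = 1 by field_simp, one_smul,
      one_smul, ← sub_eq_zero (a := w (a + 1) b - _), ← neg_eq_zero]
    constructor <;> intro h <;> rw [← h] <;> abel
  constructor
  · intro h a b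
    exact (key a b).1 (h _ _)
  · intro h n m
    have := (key (-n) (-m)).2 (h _ _)
    rwa [neg_neg, neg_neg] at this

end Rescaling

lemma ser_comm_iff {A : Type*} [Ring A] (K L : A⟦X⟧) :
    ser₁ K * ser₂ L = ser₂ L * ser₁ K ↔ ∀ a b, zc K a * zc L b = zc L b * zc K a := by
  rw [co_ext_iff]
  exact forall_congr' fun a => forall_congr' fun b => by rw [co_ser₁_mul_ser₂, co_ser₂_mul_ser₁]

section CurrentModes

variable {A : Type*} [Ring A] [Algebra ℂ A]

lemma ser_exchange_iff (c : ℂ⟦X⟧) (K L : A⟦X⟧) :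
    ser₂ L * ser₁ K = diagSer c • (ser₁ K * ser₂ L) ↔
      ∀ a b : ℕ, zc L a * zc K b =
        ∑ m ∈ range (min a b + 1), coeff m c • (zc K ((b : ℤ) - m) * zc L ((a : ℤ) - m)) := by
  have key : ∀ a b : ℕ, co (ser₂ L * ser₁ K) b a = co (diagSer c • (ser₁ K * ser₂ L)) b a ↔
      zc L a * zc K b =
        ∑ m ∈ range (min a b + 1), coeff m c • (zc K ((b : ℤ) - m) * zc L ((a : ℤ) - m)) := by
    intro a b
    rw [co_ser₂_mul_ser₁, co_diagSer_smul, ← Nat.cast_min, zsum_natCast, min_comm]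
    simp only [co_ser₁_mul_ser₂, Int.toNat_natCast]
  rw [co_ext_iff]
  constructor
  · exact fun h a b => (key a b).1 (h b a)
  · intro h n m
    rcases lt_or_ge n 0 with hn | hn
    · rw [co_of_neg_left _ hn, co_of_neg_left _ hn]
    rcases lt_or_ge m 0 with hm | hm
    · rw [co_of_neg_right _ _ hm, co_of_neg_right _ _ hm]
    lift n to ℕ using hn
    lift m to ℕ using hm
    exact (key m n).2 (h m n)

/-- The modes of the first current, dilated and with reversed indices. -/
def dilE (ρ : ℂ) (e : ℤ → A) (n : ℤ) : A := ρ⁻¹ ^ n • e (-n)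

/-- The modes of the second current, dilated and with reversed indices. -/
def dilF (ρ : ℂ) (f : ℤ → A) (n : ℤ) : A := ρ ^ n • f (-n)

lemma reflect_dilE {ρ : ℂ} (hρ : ρ ≠ 0) (e : ℤ → A) (m : ℤ) :
    reflect (ρ * ρ)⁻¹ (dilE ρ e) m = -(ρ⁻¹ ^ m • e m) := by
  unfold reflect dilE
  rw [neg_neg, smul_smul, zpow_neg, mul_inv, mul_zpow,
    mul_inv_cancel_right₀ (zpow_ne_zero _ (inv_ne_zero hρ))]

lemma reflect_dilF {ρ : ℂ} (hρ : ρ ≠ 0) (f : ℤ → A) (m : ℤ) :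
    reflect (ρ * ρ) (dilF ρ f) m = -(ρ ^ m • f m) := by
  unfold reflect dilF
  rw [neg_neg, smul_smul, zpow_neg, mul_zpow, mul_inv_cancel_right₀ (zpow_ne_zero _ hρ)]

lemma exch_dil_iff {ρ : ℂ} (hρ : ρ ≠ 0) (r : ℂ) (K : A⟦X⟧) (e f : ℤ → A) :
    Exch r K (dilE ρ e) (dilF ρ f) ↔
      (∀ n m, ρ⁻¹ • (zc K (n - 1) * e m) - zc K n * e (m + 1) =
        (ρ⁻¹ * r⁻¹) • (e m * zc K (n - 1)) - r • (e (m + 1) * zc K n)) ∧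
      ∀ n m, (ρ * r⁻¹) • (zc K (n - 1) * f m) - r • (zc K n * f (m + 1)) =
        ρ • (f m * zc K (n - 1)) - f (m + 1) * zc K n := by
  have h1 := linRel_neg_index_iff (inv_ne_zero hρ) r (fun n m => zc K n * e m)
    fun n m => e m * zc K n
  have h2 := linRel_neg_index_iff hρ r (fun n m => f m * zc K n) fun n m => zc K n * f m
  simp only [Exch, dilE, dilF, mul_smul_comm, smul_mul_assoc]
  rw [h1, h2]
  exact and_congr Iff.rfl (forall_congr' fun n => forall_congr' fun m => eq_comm)

lemma exch_reflect_dil_iff {ρ : ℂ} (hρ : ρ ≠ 0) (r : ℂ) (K : A⟦X⟧) (e f : ℤ → A) :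
    Exch r K (reflect (ρ * ρ)⁻¹ (dilE ρ e)) (reflect (ρ * ρ) (dilF ρ f)) ↔
      (∀ n m, ρ • (zc K (n + 1) * e m) - zc K n * e (m + 1) =
        (ρ * r) • (e m * zc K (n + 1)) - r⁻¹ • (e (m + 1) * zc K n)) ∧
      ∀ n m, (ρ⁻¹ * r) • (zc K (n + 1) * f m) - r⁻¹ • (zc K n * f (m + 1)) =
        ρ⁻¹ • (f m * zc K (n + 1)) - f (m + 1) * zc K n := by
  have h1 := linRel_neg_iff (inv_ne_zero hρ) r (fun n m => zc K n * e m) fun n m => e m * zc K n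
  have h2 := linRel_neg_iff hρ r (fun n m => f m * zc K n) fun n m => zc K n * f m
  simp only [Exch, reflect_dilE hρ, reflect_dilF hρ, mul_neg, neg_mul, mul_smul_comm,
    smul_mul_assoc]
  rw [h1, h2, inv_inv]
  exact and_congr Iff.rfl (forall_congr' fun n => forall_congr' fun m => eq_comm)

lemma quadForm_dilE_iff {ρ q : ℂ} (hρ : ρ ≠ 0) (hq : q ≠ 0) (e : ℤ → A) :
    (∀ n m, quadForm q (fun i j => dilE ρ e i * dilE ρ e j)
        (fun i j => dilE ρ e i * dilE ρ e j) n m = 0) ↔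
      ∀ a b, e (a + 1) * e b - q ^ 2 • (e a * e (b + 1)) =
        q ^ 2 • (e b * e (a + 1)) - e (b + 1) * e a := by
  rw [← quadForm_iff (inv_ne_zero hρ) hq fun i j => e i * e j]
  simp only [dilE, mul_smul_comm, smul_mul_assoc, smul_smul, zpow_add₀ (inv_ne_zero hρ), mul_comm]

lemma quadForm_dilF_iff {ρ q : ℂ} (hρ : ρ ≠ 0) (hq : q ≠ 0) (f : ℤ → A) :
    (∀ n m, quadForm q (fun i j => dilF ρ f j * dilF ρ f i)
        (fun i j => dilF ρ f j * dilF ρ f i) n m = 0) ↔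
      ∀ a b, q ^ 2 • (f (a + 1) * f b) - f a * f (b + 1) =
        f b * f (a + 1) - q ^ 2 • (f (b + 1) * f a) := by
  have := quadForm_iff hρ hq fun i j => f j * f i
  have e : (fun i j => dilF ρ f j * dilF ρ f i) =
      fun i j => ρ ^ (i + j) • (f (-j) * f (-i)) := by
    ext i j
    simp only [dilF, mul_smul_comm, smul_mul_assoc, smul_smul, zpow_add₀ hρ]
  rw [e, this]
  refine ⟨fun H a b => ?_, fun H a b => ?_⟩
  · have := H a b
    linear_combination (norm := module) -this
  · have := H a b
    linear_combination (norm := module) -this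

lemma commutator_dil_iff {ρ : ℂ} (hρ : ρ ≠ 0) (θ : ℂ) (e f : ℤ → A) (ψ ψ' : A⟦X⟧) :
    (∀ n m, dilE ρ e n * dilF ρ f m - dilF ρ f m * dilE ρ e n =
        θ • ((ρ * ρ) ^ (m - n) • zc ψ' (-(n + m)) - zc ψ (n + m))) ↔
      ∀ a b, e a * f b - f b * e a =
        θ • ((ρ * ρ) ^ a • ρ⁻¹ ^ (a + b) • zc ψ' (a + b) -
          (ρ * ρ)⁻¹ ^ a • ρ⁻¹ ^ (-(a + b)) • zc ψ (-(a + b))) := by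
  have key : ∀ a b : ℤ, (dilE ρ e (-a) * dilF ρ f (-b) - dilF ρ f (-b) * dilE ρ e (-a) =
        θ • ((ρ * ρ) ^ (-b - -a) • zc ψ' (-(-a + -b)) - zc ψ (-a + -b))) ↔
      e a * f b - f b * e a =
        θ • ((ρ * ρ) ^ a • ρ⁻¹ ^ (a + b) • zc ψ' (a + b) -
          (ρ * ρ)⁻¹ ^ a • ρ⁻¹ ^ (-(a + b)) • zc ψ (-(a + b))) := by
    intro a b
    have hz : ρ ^ (a - b) ≠ 0 := zpow_ne_zero _ hρ
    have e1 : ρ⁻¹ ^ (-a) * ρ ^ (-b) = ρ ^ (a - b) := by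
      rw [inv_zpow', neg_neg, ← zpow_add₀ hρ]; rfl
    have e2 : (ρ * ρ) ^ (-b - -a) = ρ ^ (a - b) * (ρ * ρ) ^ a * ρ⁻¹ ^ (a + b) := by
      rw [inv_zpow', mul_zpow, mul_zpow]
      simp only [← zpow_add₀ hρ]
      congr 1; ring
    have e3 : ρ ^ (a - b) * (ρ * ρ)⁻¹ ^ a * ρ⁻¹ ^ (-(a + b)) = 1 := by
      rw [inv_zpow', inv_zpow', mul_zpow, neg_neg]
      simp only [← zpow_add₀ hρ]
      rw [← zpow_zero ρ]; congr 1; ring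
    unfold dilE dilF
    rw [neg_neg, neg_neg, ← smul_eq_smul_iff hz (x := e a * f b - _), e2,
      show -(-a + -b) = a + b by ring, show -a + -b = -(a + b) by ring]
    simp only [smul_mul_smul_comm, mul_comm (ρ ^ (-b)), e1]
    have e4 : ∀ (z s t u v : ℂ) (P Q : A), z • θ • (s • t • P - u • v • Q) =
        θ • ((z * s * t) • P - (z * u * v) • Q) := fun z s t u v P Q => by module
    rw [e4, e3, one_smul, ← smul_sub]
  refine ⟨fun H a b => (key a b).1 (H _ _), fun H n m => ?_⟩
  have := (key (-n) (-m)).2 (H _ _)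
  simpa only [neg_neg] using this

end CurrentModes

section CurrentPresentation

variable {A : Type*} [Ring A] [Algebra ℂ A]

/-- The image of the series `k_i^+`. -/
def serKp (g : GlFA →ₐ[ℂ] A) (i : Fin 2) : A⟦X⟧ := PowerSeries.mk fun n => g (kpG i n)

/-- The image of the series `k_i^-`. -/
def serKm (g : GlFA →ₐ[ℂ] A) (i : Fin 2) : A⟦X⟧ := PowerSeries.mk fun n => g (kmG i n)

/-- The image of the series `k₂^+ (k₁^+)⁻¹`. -/
def serPsiP (g : GlFA →ₐ[ℂ] A) : A⟦X⟧ := serKp g 1 * PowerSeries.mk fun n => g (invKp1 n)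

/-- The image of the series `k₂^- (k₁^-)⁻¹`. -/
def serPsiM (g : GlFA →ₐ[ℂ] A) : A⟦X⟧ := serKm g 1 * PowerSeries.mk fun n => g (invKm1 n)

lemma zc_serKp (g : GlFA →ₐ[ℂ] A) (i : Fin 2) (n : ℤ) : zc (serKp g i) n = g (kpG i n) := by
  rcases lt_or_ge n 0 with hn | hn
  · rw [zc_of_neg _ hn, kpG, if_neg (by omega), map_zero]
  · lift n to ℕ using hn
    rw [zc_natCast, serKp, PowerSeries.coeff_mk]

lemma zc_serKm (g : GlFA →ₐ[ℂ] A) (i : Fin 2) (n : ℤ) : zc (serKm g i) n = g (kmG i n) := by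
  rcases lt_or_ge n 0 with hn | hn
  · rw [zc_of_neg _ hn, kmG, if_neg (by omega), map_zero]
  · lift n to ℕ using hn
    rw [zc_natCast, serKm, PowerSeries.coeff_mk]

lemma exp_eq_zpow_half (h k : ℂ) (n : ℤ) :
    Complex.exp (-(h * k) / 2 * (n : ℂ)) = (Complex.exp (h * k / 2))⁻¹ ^ n := by
  rw [← Complex.exp_neg, ← Complex.exp_int_mul]; congr 1; ring

lemma map_AmSer (g : GlFA →ₐ[ℂ] A) (h k : ℂ) (c : ℤ) :
    g (AmSer h k c) = (Complex.exp (h * k / 2))⁻¹ ^ c • zc (serPsiM g) c := by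
  unfold AmSer
  rcases lt_or_ge c 0 with hc | hc
  · rw [zc_of_neg _ hc, if_neg (by omega), map_zero, smul_zero]
  · lift c to ℕ using hc
    rw [if_pos (by omega), map_smul, map_sum, exp_eq_zpow_half, zc_natCast, serPsiM,
      PowerSeries.coeff_mul, Finset.Nat.sum_antidiagonal_eq_sum_range_succ_mk]
    simp only [map_mul, Int.toNat_natCast, serKm, PowerSeries.coeff_mk]

lemma map_ApSer (g : GlFA →ₐ[ℂ] A) (h k : ℂ) (c : ℤ) :
    g (ApSer h k c) = (Complex.exp (h * k / 2))⁻¹ ^ c • zc (serPsiP g) c := by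
  unfold ApSer
  rcases lt_or_ge c 0 with hc | hc
  · rw [zc_of_neg _ hc, if_neg (by omega), map_zero, smul_zero]
  · lift c to ℕ using hc
    rw [if_pos (by omega), map_smul, map_sum, exp_eq_zpow_half, zc_natCast, serPsiP,
      PowerSeries.coeff_mul, Finset.Nat.sum_antidiagonal_eq_sum_range_succ_mk]
    simp only [map_mul, Int.toNat_natCast, serKp, PowerSeries.coeff_mk]

/-- The constant terms of the two diagonal series are mutually inverse. -/
def MutInv (g : GlFA →ₐ[ℂ] A) : Prop :=
  ∀ i, g (kpG i 0) * g (kmG i 0) = 1 ∧ g (kmG i 0) * g (kpG i 0) = 1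

theorem respects_glRel_iff {h : ℂ} (hh : h.re < 0) (k : ℂ) (g : GlFA →ₐ[ℂ] A) :
    (∀ a b, GlRel h k a b → g a = g b) ↔
      MutInv g ∧ CurrentRel (Complex.exp h) (Complex.exp (h * k / 2) * Complex.exp (h * k / 2))
        (taylorSeries (fProd (Complex.exp h)))
        (dilE (Complex.exp (h * k / 2)) fun n => g (eG n))
        (dilF (Complex.exp (h * k / 2)) fun n => g (fG n))
        (serKp g 0) (serKp g 1) (serKm g 0) (serKm g 1) (serPsiP g) (serPsiM g) := by
  have hρ := Complex.exp_ne_zero (h * k / 2)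
  have hq := Complex.exp_ne_zero h
  have c1 : Complex.exp (h * (-k / 2)) = (Complex.exp (h * k / 2))⁻¹ := by
    rw [← Complex.exp_neg]; congr 1; ring
  have c2 : Complex.exp (h * (k / 2)) = Complex.exp (h * k / 2) := by congr 1; ring
  have c3 : Complex.exp (-h) = (Complex.exp h)⁻¹ := Complex.exp_neg h
  have c4 : Complex.exp (2 * h) = Complex.exp h ^ 2 := by rw [two_mul, Complex.exp_add, sq]
  have d1 : Complex.exp (h * (-k / 2 - 1)) = (Complex.exp (h * k / 2))⁻¹ * (Complex.exp h)⁻¹ := by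
    rw [← c1, ← c3, ← Complex.exp_add]; congr 1; ring
  have d2 : Complex.exp (h * (-k / 2 + 1)) = (Complex.exp (h * k / 2))⁻¹ * Complex.exp h := by
    rw [← c1, ← Complex.exp_add]; congr 1; ring
  have d3 : Complex.exp (h * (k / 2 - 1)) = Complex.exp (h * k / 2) * (Complex.exp h)⁻¹ := by
    rw [← c3, ← Complex.exp_add]; congr 1; ring
  have d4 : Complex.exp (h * (k / 2 + 1)) = Complex.exp (h * k / 2) * Complex.exp h := by
    rw [← Complex.exp_add]; congr 1; ring
  have s1 : Complex.exp (h * k) = Complex.exp (h * k / 2) * Complex.exp (h * k / 2) := by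
    rw [← Complex.exp_add]; congr 1; ring
  have s2 : Complex.exp (h * -k) = (Complex.exp (h * k / 2) * Complex.exp (h * k / 2))⁻¹ := by
    rw [← s1, ← Complex.exp_neg]; congr 1; ring
  have t1 : Complex.exp (h * (k + 2)) =
      Complex.exp h ^ 2 * (Complex.exp (h * k / 2) * Complex.exp (h * k / 2)) := by
    rw [← s1, ← c4, ← Complex.exp_add]; congr 1; ring
  have t2 : Complex.exp (h * (-k + 2)) =
      Complex.exp h ^ 2 * (Complex.exp (h * k / 2) * Complex.exp (h * k / 2))⁻¹ := by
    rw [← s2, ← c4, ← Complex.exp_add]; congr 1; ring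
  have t3 : Complex.exp (h * (k - 2)) =
      (Complex.exp h)⁻¹ ^ 2 * (Complex.exp (h * k / 2) * Complex.exp (h * k / 2)) := by
    rw [← s1, inv_pow, ← c4, ← Complex.exp_neg, ← Complex.exp_add]; congr 1; ring
  have t4 : Complex.exp (h * (-k - 2)) =
      (Complex.exp h)⁻¹ ^ 2 * (Complex.exp (h * k / 2) * Complex.exp (h * k / 2))⁻¹ := by
    rw [← s2, inv_pow, ← c4, ← Complex.exp_neg, ← Complex.exp_add]; congr 1; ring
  have u1 : ∀ a : ℤ, Complex.exp (h * k * (a : ℂ)) =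
      (Complex.exp (h * k / 2) * Complex.exp (h * k / 2)) ^ a := by
    intro a; rw [← s1, ← Complex.exp_int_mul]; congr 1; ring
  have u2 : ∀ a : ℤ, Complex.exp (-(h * k) * (a : ℂ)) =
      (Complex.exp (h * k / 2) * Complex.exp (h * k / 2))⁻¹ ^ a := by
    intro a; rw [← s2, ← Complex.exp_int_mul]; congr 1; ring
  constructor
  · intro H
    refine ⟨fun i => ⟨?_, ?_⟩, ?_⟩
    · simpa only [map_mul, map_one] using H _ _ (GlRel.kpkm0 i)
    · simpa only [map_mul, map_one] using H _ _ (GlRel.kmkp0 i)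
    have hpp : ∀ i j, ser₁ (serKp g i) * ser₂ (serKp g j) = ser₂ (serKp g j) * ser₁ (serKp g i) := by
      intro i j
      rw [ser_comm_iff]
      intro a b
      simpa only [map_mul, zc_serKp] using H _ _ (GlRel.kpkp i j a b)
    have hmm : ∀ i j, ser₁ (serKm g i) * ser₂ (serKm g j) = ser₂ (serKm g j) * ser₁ (serKm g i) := by
      intro i j
      rw [ser_comm_iff]
      intro a b
      simpa only [map_mul, zc_serKm] using H _ _ (GlRel.kmkm i j a b)
    have hpm : ∀ i, ser₂ (serKm g i) * ser₁ (serKp g i) =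
        diagSer (rat (taylorSeries (fProd (Complex.exp h)))
          (Complex.exp (h * k / 2) * Complex.exp (h * k / 2))⁻¹
          (Complex.exp (h * k / 2) * Complex.exp (h * k / 2))) •
        (ser₁ (serKp g i) * ser₂ (serKm g i)) := by
      intro i
      rw [ser_exchange_iff]
      intro a b
      simpa only [map_mul, map_sum, map_smul, zc_serKm, zc_serKp, ratioCoeff_eq hh, s1, s2]
        using H _ _ (GlRel.kmkp_diag i a b)
    refine ⟨hpp _ _, hpp _ _, hpp _ _, hpp _ _, hmm _ _, hmm _ _, hmm _ _, hmm _ _, hpm _, ?_, ?_,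
      hpm _, ?_, ?_, ?_, ?_, ?_, ?_, ?_⟩
    · rw [ser_exchange_iff]
      intro a b
      simpa only [map_mul, map_sum, map_smul, zc_serKm, zc_serKp, ratioCoeff_eq hh, t3, t4]
        using H _ _ (GlRel.km2kp1 a b)
    · rw [ser_exchange_iff]
      intro a b
      simpa only [map_mul, map_sum, map_smul, zc_serKm, zc_serKp, ratioCoeff_eq hh, t1, t2]
        using H _ _ (GlRel.km1kp2 a b)
    · rw [exch_dil_iff hρ]
      refine ⟨fun n m => ?_, fun n m => ?_⟩
      · simpa only [map_mul, map_sub, map_smul, zc_serKp, c1, d1] using H _ _ (GlRel.kp1E n m)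
      · simpa only [map_mul, map_sub, map_smul, zc_serKp, c2, d3] using H _ _ (GlRel.kp1F n m)
    · rw [exch_dil_iff hρ]
      refine ⟨fun n m => ?_, fun n m => ?_⟩
      · simpa only [map_mul, map_sub, map_smul, zc_serKp, c1, c3, d2, inv_inv]
          using H _ _ (GlRel.kp2E n m)
      · simpa only [map_mul, map_sub, map_smul, zc_serKp, c2, c3, d4, inv_inv]
          using H _ _ (GlRel.kp2F n m)
    · rw [exch_reflect_dil_iff hρ]
      refine ⟨fun n m => ?_, fun n m => ?_⟩
      · simpa only [map_mul, map_sub, map_smul, zc_serKm, c2, d3, inv_inv]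
          using H _ _ (GlRel.km1E n m)
      · simpa only [map_mul, map_sub, map_smul, zc_serKm, c1, d1, inv_inv]
          using H _ _ (GlRel.km1F n m)
    · rw [exch_reflect_dil_iff hρ]
      refine ⟨fun n m => ?_, fun n m => ?_⟩
      · simpa only [map_mul, map_sub, map_smul, zc_serKm, c2, c3, d4, inv_inv]
          using H _ _ (GlRel.km2E n m)
      · simpa only [map_mul, map_sub, map_smul, zc_serKm, c1, c3, d2, inv_inv]
          using H _ _ (GlRel.km2F n m)
    · rw [quadForm_dilE_iff hρ hq]
      intro a b
      simpa only [map_mul, map_sub, map_smul, c4] using H _ _ (GlRel.EE a b)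
    · rw [quadForm_dilF_iff hρ hq]
      intro a b
      simpa only [map_mul, map_sub, map_smul, c4] using H _ _ (GlRel.FF a b)
    · rw [commutator_dil_iff hρ]
      intro a b
      simpa only [map_mul, map_sub, map_smul, map_AmSer, map_ApSer, c3, u1, u2]
        using H _ _ (GlRel.EF a b)
  · rintro ⟨H0, H⟩
    have e1 := (exch_dil_iff hρ _ _ _ _).1 H.exch₁
    have e2 := (exch_dil_iff hρ _ _ _ _).1 H.exch₂
    have e3 := (exch_reflect_dil_iff hρ _ _ _ _).1 H.exch₁'
    have e4 := (exch_reflect_dil_iff hρ _ _ _ _).1 H.exch₂'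
    simp only [zc_serKp, zc_serKm, inv_inv] at e1 e2 e3 e4
    intro a b hab
    cases hab with
    | kpkm0 i => simpa only [map_mul, map_one] using (H0 i).1
    | kmkp0 i => simpa only [map_mul, map_one] using (H0 i).2
    | kpkp i j a b =>
      have : ser₁ (serKp g i) * ser₂ (serKp g j) = ser₂ (serKp g j) * ser₁ (serKp g i) := by
        fin_cases i <;> fin_cases j
        exacts [H.pp11, H.pp12, H.pp21, H.pp22]
      simpa only [map_mul, zc_serKp] using (ser_comm_iff _ _).1 this a b
    | kmkm i j a b =>
      have : ser₁ (serKm g i) * ser₂ (serKm g j) = ser₂ (serKm g j) * ser₁ (serKm g i) := by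
        fin_cases i <;> fin_cases j
        exacts [H.mm11, H.mm12, H.mm21, H.mm22]
      simpa only [map_mul, zc_serKm] using (ser_comm_iff _ _).1 this a b
    | kmkp_diag i a b =>
      have : ser₂ (serKm g i) * ser₁ (serKp g i) =
          diagSer (rat (taylorSeries (fProd (Complex.exp h)))
            (Complex.exp (h * k / 2) * Complex.exp (h * k / 2))⁻¹
            (Complex.exp (h * k / 2) * Complex.exp (h * k / 2))) •
          (ser₁ (serKp g i) * ser₂ (serKm g i)) := by
        fin_cases i
        exacts [H.pm11, H.pm22]
      simpa only [map_mul, map_sum, map_smul, zc_serKm, zc_serKp, ratioCoeff_eq hh, s1, s2]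
        using (ser_exchange_iff _ _ _).1 this a b
    | km1kp2 a b =>
      simpa only [map_mul, map_sum, map_smul, zc_serKm, zc_serKp, ratioCoeff_eq hh, t1, t2]
        using (ser_exchange_iff _ _ _).1 H.pm21 a b
    | km2kp1 a b =>
      simpa only [map_mul, map_sum, map_smul, zc_serKm, zc_serKp, ratioCoeff_eq hh, t3, t4]
        using (ser_exchange_iff _ _ _).1 H.pm12 a b
    | kp1E n m => simpa only [map_mul, map_sub, map_smul, c1, d1] using e1.1 n m
    | kp1F n m => simpa only [map_mul, map_sub, map_smul, c2, d3] using e1.2 n m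
    | kp2E n m => simpa only [map_mul, map_sub, map_smul, c1, c3, d2] using e2.1 n m
    | kp2F n m => simpa only [map_mul, map_sub, map_smul, c2, c3, d4] using e2.2 n m
    | km1E n m => simpa only [map_mul, map_sub, map_smul, c2, d3] using e3.1 n m
    | km1F n m => simpa only [map_mul, map_sub, map_smul, c1, d1] using e3.2 n m
    | km2E n m => simpa only [map_mul, map_sub, map_smul, c2, c3, d4] using e4.1 n m
    | km2F n m => simpa only [map_mul, map_sub, map_smul, c1, c3, d2] using e4.2 n m
    | EE a b =>
      simpa only [map_mul, map_sub, map_smul, c4] using (quadForm_dilE_iff hρ hq _).1 H.ee a b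
    | FF a b =>
      simpa only [map_mul, map_sub, map_smul, c4] using (quadForm_dilF_iff hρ hq _).1 H.ff a b
    | EF a b =>
      simpa only [map_mul, map_sub, map_smul, map_AmSer, map_ApSer, c3, u1, u2]
        using (commutator_dil_iff hρ _ _ _ _ _).1 H.ef a b

end CurrentPresentation

section Bridge

lemma map_gaussMat {A B : Type*} [Ring A] [Ring B] (φ : A →+* B) (k₁ e f k₂ : A) (i j : Fin 2) :
    φ (gaussMat k₁ e f k₂ i j) = gaussMat (φ k₁) (φ e) (φ f) (φ k₂) i j := by
  unfold gaussMat; split_ifs <;> simp only [map_mul, map_add]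

variable {A : Type*} [Ring A] [Algebra ℂ A]

/-- The series `Σ_{n ≥ 0} x_n zⁿ`. -/
def curveEP (x : ℤ → A) : A⟦X⟧ := PowerSeries.mk fun n => cutGE 0 x n

/-- The series `-Σ_{n ≥ 1} σ⁻ⁿ x_{-n} z⁻ⁿ`. -/
def curveEM (σ : ℂ) (x : ℤ → A) : A⟦X⟧ := PowerSeries.mk fun n => -(σ⁻¹ ^ (n : ℤ) • cutLT 0 x (-n))

/-- The series `Σ_{n ≥ 1} y_n zⁿ`. -/
def curveFP (y : ℤ → A) : A⟦X⟧ := PowerSeries.mk fun n => cutGE 1 y n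

/-- The series `-Σ_{n ≥ 0} σⁿ y_{-n} z⁻ⁿ`. -/
def curveFM (σ : ℂ) (y : ℤ → A) : A⟦X⟧ := PowerSeries.mk fun n => -(σ ^ (n : ℤ) • cutLT 1 y (-n))

omit [Algebra ℂ A] in
lemma zc_curveEP (x : ℤ → A) (n : ℤ) : zc (curveEP x) n = cutGE 0 x n := by
  rw [curveEP, zc_mk]
  split_ifs with hn
  · rw [Int.toNat_of_nonneg hn]
  · rw [cutGE, if_neg hn]

omit [Algebra ℂ A] in
lemma zc_curveFP (x : ℤ → A) (n : ℤ) : zc (curveFP x) n = cutGE 1 x n := by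
  rw [curveFP, zc_mk]
  split_ifs with hn
  · rw [Int.toNat_of_nonneg hn]
  · rw [cutGE, if_neg (by omega)]

lemma zc_curveEM (σ : ℂ) (x : ℤ → A) (n : ℤ) :
    zc (curveEM σ x) n = -(σ⁻¹ ^ n • cutLT 0 x (-n)) := by
  rw [curveEM, zc_mk]
  split_ifs with hn
  · rw [Int.toNat_of_nonneg hn]
  · rw [cutLT, if_pos (by omega), smul_zero, neg_zero]

lemma zc_curveFM (σ : ℂ) (x : ℤ → A) (n : ℤ) :
    zc (curveFM σ x) n = -(σ ^ n • cutLT 1 x (-n)) := by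
  rw [curveFM, zc_mk]
  split_ifs with hn
  · rw [Int.toNat_of_nonneg hn]
  · rw [cutLT, if_pos (by omega), smul_zero, neg_zero]

theorem respects_rsRel_iff {h : ℂ} (hh : h.re < 0) (k : ℂ) (g : RSFA →ₐ[ℂ] A)
    {P M : Fin 2 → Fin 2 → A⟦X⟧} (hP : ∀ i j n, zc (P i j) n = g (lpG i j n))
    (hM : ∀ i j n, zc (M i j) n = g (lmG i j n)) :
    (∀ a b, RSRel h k a b → g a = g b) ↔
      (zc (P 0 1) 0 = 0 ∧ zc (M 1 0) 0 = 0) ∧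
      (∀ i, zc (P i i) 0 * zc (M i i) 0 = 1 ∧ zc (M i i) 0 * zc (P i i) 0 = 1) ∧
      RLL 1 1 (vtx (Complex.exp h) (Complex.exp_ne_zero h) var₂ var₁)
        (vtx (Complex.exp h) (Complex.exp_ne_zero h) var₂ var₁)
        (fun i j => ser₁ (P i j)) (fun i j => ser₂ (P i j)) ∧
      RLL 1 1 (vtx (Complex.exp h) (Complex.exp_ne_zero h) var₁ var₂)
        (vtx (Complex.exp h) (Complex.exp_ne_zero h) var₁ var₂)
        (fun i j => ser₁ (M i j)) (fun i j => ser₂ (M i j)) ∧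
      RLL (diagSer (PowerSeries.rescale (Complex.exp (h * k))⁻¹
          (pser (Complex.exp h) (taylorSeries (fProd (Complex.exp h))))))
        (diagSer (PowerSeries.rescale (Complex.exp (h * k))
          (pser (Complex.exp h) (taylorSeries (fProd (Complex.exp h))))))
        (vtx (Complex.exp h) (Complex.exp_ne_zero h) 1 (diagVar (Complex.exp (h * k))⁻¹))
        (vtx (Complex.exp h) (Complex.exp_ne_zero h) 1 (diagVar (Complex.exp (h * k))))
        (fun i j => ser₁ (P i j)) (fun i j => ser₂ (M i j)) := by
  rw [← rll_pp_iff hh, ← rll_mm_iff hh, ← rll_pm_iff hh]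
  simp only [hP, hM]
  constructor
  · intro H
    refine ⟨⟨?_, ?_⟩, fun i => ⟨?_, ?_⟩, fun i a j b α β => ?_, fun i a j b α β => ?_,
      fun i a j b α β => ?_⟩
    · simpa only [map_zero] using H _ _ RSRel.p120
    · simpa only [map_zero] using H _ _ RSRel.m210
    · simpa only [map_mul, map_one] using H _ _ (RSRel.diagPM i)
    · simpa only [map_mul, map_one] using H _ _ (RSRel.diagMP i)
    · simpa only [map_sum, map_smul, map_mul] using H _ _ (RSRel.RLLpp i a j b α β)
    · simpa only [map_sum, map_smul, map_mul] using H _ _ (RSRel.RLLmm i a j b α β)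
    · simpa only [map_sum, map_smul, map_mul] using H _ _ (RSRel.RLLpm i a j b α β)
  · rintro ⟨⟨h1, h2⟩, h3, h4, h5, h6⟩ _ _ (_ | _ | i | i | ⟨i, a, j, b, α, β⟩ |
      ⟨i, a, j, b, α, β⟩ | ⟨i, a, j, b, α, β⟩)
    · simpa only [map_zero] using h1
    · simpa only [map_zero] using h2
    · simpa only [map_mul, map_one] using (h3 i).1
    · simpa only [map_mul, map_one] using (h3 i).2
    · simpa only [map_sum, map_smul, map_mul] using h4 i a j b α β
    · simpa only [map_sum, map_smul, map_mul] using h5 i a j b α β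
    · simpa only [map_sum, map_smul, map_mul] using h6 i a j b α β

/-- The matrix `L⁺` assembled from the images of the current generators. -/
def matP (ρ : ℂ) (g : GlFA →ₐ[ℂ] A) : Fin 2 → Fin 2 → A⟦X⟧ :=
  gaussMat (serKp g 0) (curveEP (dilE ρ fun n => g (eG n))) (curveFP (dilF ρ fun n => g (fG n)))
    (serKp g 1)

/-- The matrix `L⁻` assembled from the images of the current generators. -/
def matM (ρ : ℂ) (g : GlFA →ₐ[ℂ] A) : Fin 2 → Fin 2 → A⟦X⟧ :=
  gaussMat (serKm g 0) (curveEM (ρ * ρ) (dilE ρ fun n => g (eG n)))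
    (curveFM (ρ * ρ) (dilF ρ fun n => g (fG n))) (serKm g 1)

/-- The Gauss decomposition relates the two families of generators. -/
def Compat (ρ : ℂ) (g₁ : RSFA →ₐ[ℂ] A) (g₂ : GlFA →ₐ[ℂ] A) : Prop :=
  (∀ i j n, zc (matP ρ g₂ i j) n = g₁ (lpG i j n)) ∧
    ∀ i j n, zc (matM ρ g₂ i j) n = g₁ (lmG i j n)

lemma isSMulRegular_one : IsSMulRegular (BiSeries A) (1 : Scal) := fun x y h => by
  simpa using h

lemma isUnit_vtx_α {q : ℂ} (hq : q ≠ 0) (κ : ℂ) : IsUnit (vtx q hq 1 (diagVar κ)).α := by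
  change IsUnit (cst q * 1 - cst q⁻¹ * diagVar κ)
  rw [← diagSer_rescale_linear]
  refine isUnit_diagSer ?_
  rw [constantCoeff_rescale]
  simpa using hq

lemma isUnit_vtx_β {q : ℂ} (hq : q ≠ 0) (κ : ℂ) : IsUnit (vtx q hq 1 (diagVar κ)).β :=
  IsUnit.of_mul_eq_one _ (geom_mul κ)

theorem rll_iff_gaussRel {q σ : ℂ} (hq : q ≠ 0) {fs : ℂ⟦X⟧} (h0 : constantCoeff fs = 1)
    {K e f L K' e' f' L' : A⟦X⟧} (hK : IsUnit K) (hK' : IsUnit K') :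
    (RLL 1 1 (vtx q hq var₂ var₁) (vtx q hq var₂ var₁) (fun i j => ser₁ (gaussMat K e f L i j))
        (fun i j => ser₂ (gaussMat K e f L i j)) ↔
      GaussRel 1 1 (vtx q hq var₂ var₁) (vtx q hq var₂ var₁) (ser₁ K) (ser₁ e) (ser₁ f)
        (ser₁ L) (ser₂ K) (ser₂ e) (ser₂ f) (ser₂ L)) ∧
    (RLL 1 1 (vtx q hq var₁ var₂) (vtx q hq var₁ var₂) (fun i j => ser₁ (gaussMat K e f L i j))
        (fun i j => ser₂ (gaussMat K e f L i j)) ↔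
      GaussRel 1 1 (vtx q hq var₁ var₂) (vtx q hq var₁ var₂) (ser₁ K) (ser₁ e) (ser₁ f)
        (ser₁ L) (ser₂ K) (ser₂ e) (ser₂ f) (ser₂ L)) ∧
    (RLL (diagSer (PowerSeries.rescale σ⁻¹ (pser q fs))) (diagSer (PowerSeries.rescale σ (pser q fs)))
        (vtx q hq 1 (diagVar σ⁻¹)) (vtx q hq 1 (diagVar σ))
        (fun i j => ser₁ (gaussMat K e f L i j)) (fun i j => ser₂ (gaussMat K' e' f' L' i j)) ↔
      GaussRel (diagSer (PowerSeries.rescale σ⁻¹ (pser q fs)))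
        (diagSer (PowerSeries.rescale σ (pser q fs)))
        (vtx q hq 1 (diagVar σ⁻¹)) (vtx q hq 1 (diagVar σ)) (ser₁ K) (ser₁ e) (ser₁ f) (ser₁ L)
        (ser₂ K') (ser₂ e') (ser₂ f') (ser₂ L')) := by
  have hp : ∀ κ : ℂ, IsUnit (diagSer (PowerSeries.rescale κ (pser q fs))) := fun κ => by
    refine isUnit_diagSer ?_
    rw [constantCoeff_rescale, constantCoeff_pser h0]
    exact inv_ne_zero hq
  simp only [map_gaussMat]
  refine ⟨⟨fun H => ?_, fun H => ?_⟩, ⟨fun H => ?_, fun H => ?_⟩, ⟨fun H => ?_, fun H => ?_⟩⟩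
  · exact GaussRel.of_RLL H (hK.map _) (hK.map _) isSMulRegular_one isSMulRegular_one
      (regular_sub₁₂ hq) (regular_sub₁₂ hq) regular_var₁₂ regular_var₁₂
  · exact GaussRel.to_RLL H regular_var₁₂ regular_var₁₂
  · exact GaussRel.of_RLL H (hK.map _) (hK.map _) isSMulRegular_one isSMulRegular_one
      (regular_sub₂₁ (inv_ne_zero hq)) (regular_sub₂₁ (inv_ne_zero hq)) regular_var₂₁ regular_var₂₁
  · exact GaussRel.to_RLL H regular_var₂₁ regular_var₂₁
  · exact GaussRel.of_RLL H (hK.map _) (hK'.map _) ((hp _).isSMulRegular _) ((hp _).isSMulRegular _)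
      ((isUnit_vtx_α hq _).isSMulRegular _) ((isUnit_vtx_α hq _).isSMulRegular _)
      ((isUnit_vtx_β hq _).isSMulRegular _) ((isUnit_vtx_β hq _).isSMulRegular _)
  · exact GaussRel.to_RLL H ((isUnit_vtx_β hq _).isSMulRegular _)
      ((isUnit_vtx_β hq _).isSMulRegular _)

lemma serKp_eq {g : GlFA →ₐ[ℂ] A} (hg : MutInv g) :
    IsUnit (serKp g 0) ∧ serKp g 1 = serPsiP g * serKp g 0 := by
  have h1 : (serKp g 0) * (PowerSeries.mk fun n => g (invKp1 n)) = 1 := by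
    simp only [invKp1, serKp, ← AlgHom.coe_toRingHom, map_seriesInv]
    exact mul_mk_seriesInv (hg 0).1
  have h2 : (PowerSeries.mk fun n => g (invKp1 n)) * serKp g 0 = 1 := by
    simp only [invKp1, serKp, ← AlgHom.coe_toRingHom, map_seriesInv]
    exact mk_seriesInv_mul (hg 0).1 (hg 0).2
  exact ⟨⟨⟨_, _, h1, h2⟩, rfl⟩, by rw [serPsiP, mul_assoc, h2, mul_one]⟩

lemma serKm_eq {g : GlFA →ₐ[ℂ] A} (hg : MutInv g) :
    IsUnit (serKm g 0) ∧ serKm g 1 = serPsiM g * serKm g 0 := by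
  have h1 : (serKm g 0) * (PowerSeries.mk fun n => g (invKm1 n)) = 1 := by
    simp only [invKm1, serKm, ← AlgHom.coe_toRingHom, map_seriesInv]
    exact mul_mk_seriesInv (hg 0).2
  have h2 : (PowerSeries.mk fun n => g (invKm1 n)) * serKm g 0 = 1 := by
    simp only [invKm1, serKm, ← AlgHom.coe_toRingHom, map_seriesInv]
    exact mk_seriesInv_mul (hg 0).2 (hg 0).1
  exact ⟨⟨⟨_, _, h1, h2⟩, rfl⟩, by rw [serPsiM, mul_assoc, h2, mul_one]⟩

lemma constantCoeff_mat (ρ : ℂ) (g : GlFA →ₐ[ℂ] A) :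
    (zc (matP ρ g 0 1) 0 = 0 ∧ zc (matM ρ g 1 0) 0 = 0) ∧
      ∀ i, zc (matP ρ g i i) 0 = g (kpG i 0) ∧ zc (matM ρ g i i) 0 = g (kmG i 0) := by
  have a1 : constantCoeff (curveFP (dilF ρ fun n => g (fG n))) = 0 := by
    rw [← zc_zero_index, zc_curveFP, cutGE, if_neg (by norm_num)]
  have a2 : constantCoeff (curveEM (ρ * ρ) (dilE ρ fun n => g (eG n))) = 0 := by
    rw [← zc_zero_index, zc_curveEM, cutLT, if_pos (by norm_num), smul_zero, neg_zero]
  refine ⟨?_, ?_⟩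
  · simp [matP, matM, gaussMat, zc_zero_index, a1, a2]
  · intro i
    rw [← zc_serKp, ← zc_serKm]
    fin_cases i <;> simp [matP, matM, gaussMat, zc_zero_index, a1, a2]

theorem respects_iff_of_compat {h : ℂ} (hh : h.re < 0) (k : ℂ) {g₁ : RSFA →ₐ[ℂ] A}
    {g₂ : GlFA →ₐ[ℂ] A} (hc : Compat (Complex.exp (h * k / 2)) g₁ g₂) :
    (∀ a b, RSRel h k a b → g₁ a = g₁ b) ↔ ∀ a b, GlRel h k a b → g₂ a = g₂ b := by
  have hρ := Complex.exp_ne_zero (h * k / 2)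
  have hσ := mul_ne_zero hρ hρ
  have hq := Complex.exp_ne_zero h
  have s1 : Complex.exp (h * k) = Complex.exp (h * k / 2) * Complex.exp (h * k / 2) := by
    rw [← Complex.exp_add]; congr 1; ring
  have h0 := constantCoeff_taylorSeries_fProd (Complex.exp h)
  have hfe := taylorSeries_fProd_functional (norm_exp_lt_one hh)
  rw [respects_glRel_iff hh, respects_rsRel_iff hh k g₁ hc.1 hc.2, s1]
  obtain ⟨z1, z2⟩ := constantCoeff_mat (Complex.exp (h * k / 2)) g₂
  simp only [z1, z2, true_and]
  refine and_congr_right fun (hg : MutInv g₂) => ?_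
  obtain ⟨uP, lP⟩ := serKp_eq hg
  obtain ⟨uM, lM⟩ := serKm_eq hg
  have key := fun rP rM => currentRel_iff hq hσ h0 hfe (zc_curveEP _) (zc_curveEM _ _)
    (zc_curveFP _) (zc_curveFM _ _) uP uM lP rP lM rM (x := dilE (Complex.exp (h * k / 2))
      fun n => g₂ (eG n)) (y := dilF (Complex.exp (h * k / 2)) fun n => g₂ (fG n))
  unfold matP matM
  rw [(rll_iff_gaussRel (σ := 1) (K' := 1) (e' := 0) (f' := 0) (L' := 1) hq h0 uP isUnit_one).1, 
    (rll_iff_gaussRel (σ := 1) (K' := 1) (e' := 0) (f' := 0) (L' := 1) hq h0 uM isUnit_one).2.1,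
    (rll_iff_gaussRel hq h0 uP uM).2.2]
  constructor
  · intro H
    have cP : ser₁ (serKp g₂ 0) * ser₂ (serKp g₂ 1) = ser₂ (serKp g₂ 1) * ser₁ (serKp g₂ 0) :=
      regular_var₁₂ (by have := H.1.h12; rwa [one_mul] at this)
    have cM : ser₁ (serKm g₂ 0) * ser₂ (serKm g₂ 1) = ser₂ (serKm g₂ 1) * ser₁ (serKm g₂ 0) :=
      regular_var₂₁ (by have := H.2.1.h12; rwa [one_mul] at this)
    exact (key (comm_psi uP lP (comm_of_ser cP)) (comm_psi uM lM (comm_of_ser cM))).2 H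
  · intro H
    exact (key (comm_psi uP lP (comm_of_ser H.pp12)) (comm_psi uM lM (comm_of_ser H.mm12))).1 H

end Bridge

lemma gaussMat_eq_iff {B : Type*} [Ring B] {k₁ e f k₂ c : B} {l : Fin 2 → Fin 2 → B}
    (h : l 0 0 * c = 1) (h' : c * l 0 0 = 1) :
    (∀ i j, gaussMat k₁ e f k₂ i j = l i j) ↔
      k₁ = l 0 0 ∧ e = l 1 0 * c ∧ f = c * l 0 1 ∧ k₂ = l 1 1 - l 1 0 * (c * l 0 1) := by
  simp only [Fin.forall_fin_two, gaussMat]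
  simp only [↓reduceIte, Fin.isValue, one_ne_zero]
  constructor
  · rintro ⟨⟨rfl, h2⟩, h3, h4⟩
    refine ⟨rfl, ?_, ?_, ?_⟩
    · rw [← h3, mul_assoc, h, mul_one]
    · rw [← h2, ← mul_assoc, h', one_mul]
    · rw [← h4, ← h2, ← h3, ← mul_assoc c, h', one_mul, add_sub_cancel_right]
  · rintro ⟨rfl, rfl, rfl, rfl⟩
    refine ⟨⟨rfl, ?_⟩, ?_, ?_⟩
    · rw [← mul_assoc, h, one_mul]
    · rw [mul_assoc, h', mul_one]
    · rw [mul_assoc (l 1 0), h', mul_one, ← mul_assoc, sub_add_cancel]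

lemma PowerSeries.coeff_mul_eq_sum_range {B : Type*} [Ring B] (P Q : B⟦X⟧) (n : ℕ) :
    coeff n (P * Q) = ∑ j ∈ range (n + 1), coeff j P * coeff (n - j) Q := by
  rw [PowerSeries.coeff_mul, Finset.Nat.sum_antidiagonal_eq_sum_range_succ_mk]

section Modes

variable {A : Type*} [Ring A] [Algebra ℂ A] (g : RSFA →ₐ[ℂ] A)

lemma coeff_gaussE (a c : ℕ → RSFA) (n : ℕ) :
    coeff n ((PowerSeries.mk fun n => g (a n)) * PowerSeries.mk fun n => g (c n)) =
      g (∑ j ∈ range (n + 1), a j * c (n - j)) := by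
  simp only [PowerSeries.coeff_mul_eq_sum_range, PowerSeries.coeff_mk, map_sum, map_mul]

lemma coeff_gaussF (c : ℕ → RSFA) (b : ℤ → RSFA) (n : ℕ) :
    coeff n ((PowerSeries.mk fun n => g (c n)) * PowerSeries.mk fun n => g (b n)) =
      g (∑ j ∈ range (n + 1), c j * b ((n : ℤ) - j)) := by
  simp only [PowerSeries.coeff_mul_eq_sum_range, PowerSeries.coeff_mk, map_sum, map_mul]
  refine Finset.sum_congr rfl fun j hj => ?_
  rw [Nat.cast_sub (by simpa [Nat.lt_succ_iff] using hj)]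

lemma coeff_gaussK (a c : ℕ → RSFA) (b d : ℤ → RSFA) (n : ℕ) :
    coeff n ((PowerSeries.mk fun n => g (d n)) - (PowerSeries.mk fun n => g (a n)) *
        ((PowerSeries.mk fun n => g (c n)) * PowerSeries.mk fun n => g (b n))) =
      g (d n - ∑ i ∈ range (n + 1), ∑ j ∈ range (n + 1 - i), a i * c j * b ((n : ℤ) - i - j)) := by
  rw [map_sub, PowerSeries.coeff_mk, PowerSeries.coeff_mul_eq_sum_range, map_sub, map_sum]
  refine congrArg _ (Finset.sum_congr rfl fun i hi => ?_)
  have hi : i ≤ n := by simpa [Nat.lt_succ_iff] using hi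
  rw [coeff_gaussF, PowerSeries.coeff_mk, ← map_mul, Finset.mul_sum, Nat.cast_sub hi,
    Nat.succ_sub hi]
  simp only [mul_assoc]

lemma zc_eq_lpG_iff (P : A⟦X⟧) (i j : Fin 2) :
    (∀ n, zc P n = g (lpG i j n)) ↔ P = PowerSeries.mk fun n => g (lpG i j n) := by
  have key : ∀ n, zc (PowerSeries.mk fun n => g (lpG i j n)) n = g (lpG i j n) := fun n => by
    rcases lt_or_ge n 0 with hn | hn
    · rw [zc_of_neg _ hn, lpG, if_neg (by omega), map_zero]
    · lift n to ℕ using hn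
      rw [zc_natCast, PowerSeries.coeff_mk]
  exact ⟨fun h => zc_ext fun n => (h n).trans (key n).symm, fun h n => by rw [h, key]⟩

lemma zc_eq_lmG_iff (P : A⟦X⟧) (i j : Fin 2) :
    (∀ n, zc P n = g (lmG i j n)) ↔ P = PowerSeries.mk fun n => g (lmG i j n) := by
  have key : ∀ n, zc (PowerSeries.mk fun n => g (lmG i j n)) n = g (lmG i j n) := fun n => by
    rcases lt_or_ge n 0 with hn | hn
    · rw [zc_of_neg _ hn, lmG, if_neg (by omega), map_zero]
    · lift n to ℕ using hn
      rw [zc_natCast, PowerSeries.coeff_mk]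
  exact ⟨fun h => zc_ext fun n => (h n).trans (key n).symm, fun h n => by rw [h, key]⟩

lemma curve_modes {ρ : ℂ} (hρ : ρ ≠ 0) (e f : ℤ → A) (n : ℕ) :
    coeff n (curveEP (dilE ρ e)) = ρ⁻¹ ^ n • e (-n) ∧
    coeff n (curveEM (ρ * ρ) (dilE ρ e)) = (if n = 0 then 0 else -(ρ⁻¹ ^ n • e n)) ∧
    coeff n (curveFP (dilF ρ f)) = (if n = 0 then 0 else ρ ^ n • f (-n)) ∧
    coeff n (curveFM (ρ * ρ) (dilF ρ f)) = -(ρ ^ n • f n) := by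
  have hn : (1 : ℤ) ≤ n ↔ n ≠ 0 := by omega
  refine ⟨?_, ?_, ?_, ?_⟩
  · simp [← zc_natCast, zc_curveEP, cutGE, dilE]
  · rw [← zc_natCast, zc_curveEM, cutLT, dilE]
    rcases eq_or_ne n 0 with rfl | h
    · simp
    · rw [if_neg (by omega), if_neg h, smul_smul, neg_neg, zpow_neg, mul_inv, mul_zpow,
        mul_inv_cancel_right₀ (zpow_ne_zero _ (inv_ne_zero hρ)), zpow_natCast]
  · rw [← zc_natCast, zc_curveFP, cutGE, dilF, zpow_natCast]
    simp only [hn, ite_not]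
  · rw [← zc_natCast, zc_curveFM, cutLT, if_neg (by omega), dilF, smul_smul, neg_neg, zpow_neg,
      mul_zpow, mul_inv_cancel_right₀ (zpow_ne_zero _ hρ), zpow_natCast]

variable {g}

theorem compat_iff {ρ : ℂ} (hρ : ρ ≠ 0) {g₂ : GlFA →ₐ[ℂ] A}
    (hd : g (lpG 0 0 0) * g (lmG 0 0 0) = 1) (hd' : g (lmG 0 0 0) * g (lpG 0 0 0) = 1) :
    Compat ρ g g₂ ↔
      ((∀ n : ℕ, g₂ (kpG 0 n) = g (lpG 0 0 n)) ∧
        (∀ n : ℕ, ρ⁻¹ ^ n • g₂ (eG (-n)) = g (epRS n)) ∧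
        (∀ n : ℕ, (if n = 0 then 0 else ρ ^ n • g₂ (fG (-n))) = g (fpRS n)) ∧
        ∀ n : ℕ, g₂ (kpG 1 n) = g (kk2p n)) ∧
      (∀ n : ℕ, g₂ (kmG 0 n) = g (lmG 0 0 n)) ∧
        (∀ n : ℕ, (if n = 0 then 0 else -(ρ⁻¹ ^ n • g₂ (eG n))) = g (emRS n)) ∧
        (∀ n : ℕ, -(ρ ^ n • g₂ (fG n)) = g (fmRS n)) ∧
        ∀ n : ℕ, g₂ (kmG 1 n) = g (kk2m n) := by
  have hp : (PowerSeries.mk fun n => g (lpG 0 0 n)) * (PowerSeries.mk fun n => g (invLp11 n)) = 1 ∧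
      (PowerSeries.mk fun n => g (invLp11 n)) * (PowerSeries.mk fun n => g (lpG 0 0 n)) = 1 := by
    simp only [invLp11, ← AlgHom.coe_toRingHom, map_seriesInv]
    exact ⟨mul_mk_seriesInv hd, mk_seriesInv_mul hd hd'⟩
  have hm : (PowerSeries.mk fun n => g (lmG 0 0 n)) * (PowerSeries.mk fun n => g (invLm11 n)) = 1 ∧
      (PowerSeries.mk fun n => g (invLm11 n)) * (PowerSeries.mk fun n => g (lmG 0 0 n)) = 1 := by
    simp only [invLm11, ← AlgHom.coe_toRingHom, map_seriesInv]
    exact ⟨mul_mk_seriesInv hd', mk_seriesInv_mul hd' hd⟩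
  simp only [Compat, zc_eq_lpG_iff, zc_eq_lmG_iff, matP, matM]
  rw [gaussMat_eq_iff (l := fun i j => PowerSeries.mk fun n => g (lpG i j n)) hp.1 hp.2,
    gaussMat_eq_iff (l := fun i j => PowerSeries.mk fun n => g (lmG i j n)) hm.1 hm.2]
  have cm := curve_modes hρ (fun n => g₂ (eG n)) (fun n => g₂ (fG n))
  have e1 : ∀ n, coeff n ((PowerSeries.mk fun n => g (lpG 1 0 n)) *
      PowerSeries.mk fun n => g (invLp11 n)) = g (epRS n) := coeff_gaussE g _ _
  have e2 : ∀ n, coeff n ((PowerSeries.mk fun n => g (invLp11 n)) *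
      PowerSeries.mk fun n => g (lpG 0 1 n)) = g (fpRS n) := coeff_gaussF g _ _
  have e3 : ∀ n, coeff n ((PowerSeries.mk fun n => g (lpG 1 1 n)) -
      (PowerSeries.mk fun n => g (lpG 1 0 n)) * ((PowerSeries.mk fun n => g (invLp11 n)) *
      PowerSeries.mk fun n => g (lpG 0 1 n))) = g (kk2p n) := coeff_gaussK g _ _ _ _
  have e4 : ∀ n, coeff n ((PowerSeries.mk fun n => g (lmG 1 0 n)) *
      PowerSeries.mk fun n => g (invLm11 n)) = g (emRS n) := coeff_gaussE g _ _
  have e5 : ∀ n, coeff n ((PowerSeries.mk fun n => g (invLm11 n)) *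
      PowerSeries.mk fun n => g (lmG 0 1 n)) = g (fmRS n) := coeff_gaussF g _ _
  have e6 : ∀ n, coeff n ((PowerSeries.mk fun n => g (lmG 1 1 n)) -
      (PowerSeries.mk fun n => g (lmG 1 0 n)) * ((PowerSeries.mk fun n => g (invLm11 n)) *
      PowerSeries.mk fun n => g (lmG 0 1 n))) = g (kk2m n) := coeff_gaussK g _ _ _ _
  simp only [PowerSeries.ext_iff, e1, e2, e3, e4, e5, e6, (cm _).1, (cm _).2.1, (cm _).2.2.1,
    (cm _).2.2.2, serKp, serKm, PowerSeries.coeff_mk]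

end Modes

section Correspondence

variable {A B : Type*} [Ring A] [Algebra ℂ A] [Ring B] [Algebra ℂ B] {ρ : ℂ}

lemma kpG_natCast (i : Fin 2) (n : ℕ) : kpG i n = FreeAlgebra.ι ℂ (GlGen.Kp i n) := by simp [kpG]

lemma kmG_natCast (i : Fin 2) (n : ℕ) : kmG i n = FreeAlgebra.ι ℂ (GlGen.Km i n) := by simp [kmG]

lemma lpG_natCast (i j : Fin 2) (n : ℕ) : lpG i j n = FreeAlgebra.ι ℂ (RSGen.p i j n) := by
  simp [lpG]

lemma lmG_natCast (i j : Fin 2) (n : ℕ) : lmG i j n = FreeAlgebra.ι ℂ (RSGen.m i j n) := by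
  simp [lmG]

lemma Compat.map {g₁ : RSFA →ₐ[ℂ] A} {g₂ : GlFA →ₐ[ℂ] A} (hc : Compat ρ g₁ g₂)
    (hρ : ρ ≠ 0) (hd : g₁ (lpG 0 0 0) * g₁ (lmG 0 0 0) = 1)
    (hd' : g₁ (lmG 0 0 0) * g₁ (lpG 0 0 0) = 1) (φ : A →ₐ[ℂ] B) :
    Compat ρ (φ.comp g₁) (φ.comp g₂) := by
  rw [compat_iff hρ hd hd'] at hc
  rw [compat_iff hρ (by simp only [AlgHom.comp_apply, ← map_mul, hd, map_one])
    (by simp only [AlgHom.comp_apply, ← map_mul, hd', map_one])]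
  obtain ⟨⟨h1, h2, h3, h4⟩, h5, h6, h7, h8⟩ := hc
  simp only [AlgHom.comp_apply, h1, ← h2, ← h3, h4, h5, ← h6, ← h7, h8, map_smul, map_neg,
    apply_ite φ, map_zero, implies_true, and_self]

lemma Compat.left_unique {g₁ g₁' : RSFA →ₐ[ℂ] A} {g₂ : GlFA →ₐ[ℂ] A} (h : Compat ρ g₁ g₂)
    (h' : Compat ρ g₁' g₂) : g₁ = g₁' := by
  refine FreeAlgebra.hom_ext (funext fun x => ?_)
  cases x with
  | p i j n => simpa only [Function.comp_apply, lpG_natCast] using (h.1 i j n).symm.trans (h'.1 i j n)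
  | m i j n => simpa only [Function.comp_apply, lmG_natCast] using (h.2 i j n).symm.trans (h'.2 i j n)

lemma Compat.right_unique {g₁ : RSFA →ₐ[ℂ] A} {g₂ g₂' : GlFA →ₐ[ℂ] A} (h : Compat ρ g₁ g₂)
    (h' : Compat ρ g₁ g₂') (hρ : ρ ≠ 0) (hd : g₁ (lpG 0 0 0) * g₁ (lmG 0 0 0) = 1)
    (hd' : g₁ (lmG 0 0 0) * g₁ (lpG 0 0 0) = 1) : g₂ = g₂' := by
  obtain ⟨⟨h1, h2, h3, h4⟩, h5, h6, h7, h8⟩ := (compat_iff hρ hd hd').1 h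
  obtain ⟨⟨k1, k2, k3, k4⟩, k5, k6, k7, k8⟩ := (compat_iff hρ hd hd').1 h'
  refine FreeAlgebra.hom_ext (funext fun x => ?_)
  cases x with
  | E n =>
    change g₂ (eG n) = g₂' (eG n)
    rcases le_or_gt n 0 with hn | hn
    · obtain ⟨m, rfl⟩ : ∃ m : ℕ, n = -m := ⟨n.natAbs, by omega⟩
      exact (smul_eq_smul_iff (pow_ne_zero _ (inv_ne_zero hρ))).1 ((h2 m).trans (k2 m).symm)
    · lift n to ℕ using hn.le
      have := (h6 n).trans (k6 n).symm
      rw [if_neg (by omega), if_neg (by omega), neg_inj] at this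
      exact (smul_eq_smul_iff (pow_ne_zero _ (inv_ne_zero hρ))).1 this
  | F n =>
    change g₂ (fG n) = g₂' (fG n)
    rcases lt_or_ge n 0 with hn | hn
    · obtain ⟨m, rfl⟩ : ∃ m : ℕ, n = -m := ⟨n.natAbs, by omega⟩
      have := (h3 m).trans (k3 m).symm
      rw [if_neg (by omega), if_neg (by omega)] at this
      exact (smul_eq_smul_iff (pow_ne_zero _ hρ)).1 this
    · lift n to ℕ using hn
      exact (smul_eq_smul_iff (pow_ne_zero _ hρ)).1 (neg_inj.1 ((h7 n).trans (k7 n).symm))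
  | Kp i n =>
    revert i
    simp only [Function.comp_apply, ← kpG_natCast, Fin.forall_fin_two]
    exact ⟨(h1 n).trans (k1 n).symm, (h4 n).trans (k4 n).symm⟩
  | Km i n =>
    revert i
    simp only [Function.comp_apply, ← kmG_natCast, Fin.forall_fin_two]
    exact ⟨(h5 n).trans (k5 n).symm, (h8 n).trans (k8 n).symm⟩

/-- The images of the matrix generators determined by those of the current generators. -/
def rsHom (ρ : ℂ) (g : GlFA →ₐ[ℂ] A) : RSFA →ₐ[ℂ] A :=
  FreeAlgebra.lift ℂ fun
    | .p i j n => coeff n (matP ρ g i j)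
    | .m i j n => coeff n (matM ρ g i j)

lemma compat_rsHom (ρ : ℂ) (g : GlFA →ₐ[ℂ] A) : Compat ρ (rsHom ρ g) g := by
  refine ⟨fun i j => (zc_eq_lpG_iff _ _ _ _).2 ?_, fun i j => (zc_eq_lmG_iff _ _ _ _).2 ?_⟩ <;>
    ext n <;> simp [lpG_natCast, lmG_natCast, rsHom]

/-- The images of the current generators determined by those of the matrix generators. -/
def glHom (ρ : ℂ) (g : RSFA →ₐ[ℂ] A) : GlFA →ₐ[ℂ] A :=
  FreeAlgebra.lift ℂ fun
    | .E n => if n ≤ 0 then ρ ^ n.natAbs • g (epRS n.natAbs) else -(ρ ^ n.natAbs • g (emRS n.natAbs))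
    | .F n => if n < 0 then ρ⁻¹ ^ n.natAbs • g (fpRS n.natAbs)
        else -(ρ⁻¹ ^ n.natAbs • g (fmRS n.natAbs))
    | .Kp i n => g (if i = 0 then lpG 0 0 n else kk2p n)
    | .Km i n => g (if i = 0 then lmG 0 0 n else kk2m n)

lemma compat_glHom (hρ : ρ ≠ 0) {g : RSFA →ₐ[ℂ] A}
    (hd : g (lpG 0 0 0) * g (lmG 0 0 0) = 1) (hd' : g (lmG 0 0 0) * g (lpG 0 0 0) = 1)
    (h0 : g (lpG 0 1 0) = 0) (h0' : g (lmG 1 0 0) = 0) : Compat ρ g (glHom ρ g) := by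
  have s1 : ∀ (n : ℕ) (x : A), ρ⁻¹ ^ n • ρ ^ n • x = x := fun n x => by
    rw [smul_smul, ← mul_pow, inv_mul_cancel₀ hρ, one_pow, one_smul]
  have s2 : ∀ (n : ℕ) (x : A), ρ ^ n • ρ⁻¹ ^ n • x = x := fun n x => by
    rw [smul_smul, ← mul_pow, mul_inv_cancel₀ hρ, one_pow, one_smul]
  rw [compat_iff hρ hd hd']
  refine ⟨⟨fun n => ?_, fun n => ?_, fun n => ?_, fun n => ?_⟩, fun n => ?_, fun n => ?_,
    fun n => ?_, fun n => ?_⟩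
  · simp [kpG_natCast, glHom]
  · simp [eG, glHom, s1, -inv_pow]
  · rcases eq_or_ne n 0 with rfl | hn
    · simp [fpRS, h0]
    · simp [fG, glHom, hn, Nat.pos_of_ne_zero hn, s2, -inv_pow]
  · simp [kpG_natCast, glHom]
  · simp [kmG_natCast, glHom]
  · rcases eq_or_ne n 0 with rfl | hn
    · simp [emRS, h0']
    · simp [eG, glHom, hn, s1, -inv_pow]
  · simp [fG, glHom, s2, (Int.natCast_nonneg n).not_gt, -inv_pow]
  · simp [kmG_natCast, glHom]

end Correspondence

end Proof

/-- The Ding–Frenkel isomorphism `ψ' : U'_h(ĝl₂)_k ≃ U_h(ĝl₂)_k`.  In terms of the Gauss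
decomposition `L^±(z) = [[1,0],[e^±(z),1]]·diag(k₁^±(z),k₂^±(z))·[[1,f^±(z)],[0,1]]`, it
sends, coefficientwise, `k₁^±(z)` and `k₂^±(z)` to the like-named series, `e^+(z)` to
`Σ_{n≤0} E[n]q^{kn/2}z^{−n}`, `e^−(z)` to `−Σ_{n≥1} E[n]q^{−kn/2}z^{−n}`, `f^+(z)` to
`Σ_{n≤−1} F[n]q^{−kn/2}z^{−n}`, and `f^−(z)` to `−Σ_{n≥0} F[n]q^{kn/2}z^{−n}`
(equivalently `ψ'[e^+(zq^{k/2}) − e^−(zq^{−k/2})] = E(z)` and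
`ψ'[f^+(zq^{−k/2}) − f^−(zq^{k/2})] = F(z)`). -/
theorem DingFrenkel_isomorphism (h k : ℂ) (hh : h.re < 0) :
    ∃ ψ : Uhgl2RS h k ≃ₐ[ℂ] Uhgl2 h k,
      (∀ n : ℕ, ψ (rsMk h k (lpG 0 0 (n : ℤ))) = glMk h k (kpG 0 (n : ℤ))) ∧
      (∀ n : ℕ, ψ (rsMk h k (lmG 0 0 (n : ℤ))) = glMk h k (kmG 0 (n : ℤ))) ∧
      (∀ n : ℕ, ψ (rsMk h k (kk2p n)) = glMk h k (kpG 1 (n : ℤ))) ∧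
      (∀ n : ℕ, ψ (rsMk h k (kk2m n)) = glMk h k (kmG 1 (n : ℤ))) ∧
      (∀ n : ℕ, ψ (rsMk h k (epRS n)) =
        glMk h k (Complex.exp (-(h * k) / 2 * (n : ℂ)) • eG (-(n : ℤ)))) ∧
      (∀ n : ℕ, 1 ≤ n → ψ (rsMk h k (emRS n)) =
        glMk h k (-(Complex.exp (-(h * k) / 2 * (n : ℂ))) • eG (n : ℤ))) ∧
      (∀ n : ℕ, 1 ≤ n → ψ (rsMk h k (fpRS n)) =
        glMk h k (Complex.exp ((h * k) / 2 * (n : ℂ)) • fG (-(n : ℤ)))) ∧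
      (∀ n : ℕ, ψ (rsMk h k (fmRS n)) =
        glMk h k (-(Complex.exp ((h * k) / 2 * (n : ℂ))) • fG (n : ℤ))) := by
  have hρ := Complex.exp_ne_zero (h * k / 2)
  set ρ := Complex.exp (h * k / 2) with hρ_def
  have rrel : ∀ a b, RSRel h k a b → rsMk h k a = rsMk h k b := fun a b hab =>
    RingQuot.mkAlgHom_rel ℂ hab
  have grel : ∀ a b, GlRel h k a b → glMk h k a = glMk h k b := fun a b hab =>
    RingQuot.mkAlgHom_rel ℂ hab
  have rd : rsMk h k (lpG 0 0 0) * rsMk h k (lmG 0 0 0) = 1 := by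
    simpa only [map_mul, map_one] using rrel _ _ (RSRel.diagPM 0)
  have rd' : rsMk h k (lmG 0 0 0) * rsMk h k (lpG 0 0 0) = 1 := by
    simpa only [map_mul, map_one] using rrel _ _ (RSRel.diagMP 0)
  have c₁ : Compat ρ (rsHom ρ (glMk h k)) (glMk h k) := compat_rsHom _ _
  have c₂ : Compat ρ (rsMk h k) (glHom ρ (rsMk h k)) := compat_glHom hρ rd rd'
    (by simpa only [map_zero] using rrel _ _ RSRel.p120)
    (by simpa only [map_zero] using rrel _ _ RSRel.m210)
  have w₁ := (respects_iff_of_compat hh k c₁).2 grel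
  have w₂ := (respects_iff_of_compat hh k c₂).1 rrel
  let ψ : Uhgl2RS h k →ₐ[ℂ] Uhgl2 h k := RingQuot.liftAlgHom ℂ ⟨rsHom ρ (glMk h k), w₁⟩
  let φ : Uhgl2 h k →ₐ[ℂ] Uhgl2RS h k := RingQuot.liftAlgHom ℂ ⟨glHom ρ (rsMk h k), w₂⟩
  have hψ : ψ.comp (rsMk h k) = rsHom ρ (glMk h k) :=
    AlgHom.ext fun x => RingQuot.liftAlgHom_mkAlgHom_apply _ _ _ _
  have hφ : φ.comp (glMk h k) = glHom ρ (rsMk h k) :=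
    AlgHom.ext fun x => RingQuot.liftAlgHom_mkAlgHom_apply _ _ _ _
  have d : rsHom ρ (glMk h k) (lpG 0 0 0) * rsHom ρ (glMk h k) (lmG 0 0 0) = 1 := by
    simpa only [map_mul, map_one] using w₁ _ _ (RSRel.diagPM 0)
  have d' : rsHom ρ (glMk h k) (lmG 0 0 0) * rsHom ρ (glMk h k) (lpG 0 0 0) = 1 := by
    simpa only [map_mul, map_one] using w₁ _ _ (RSRel.diagMP 0)
  have i₁ : ψ.comp φ = AlgHom.id ℂ _ := by
    refine RingQuot.ringQuot_ext' _ _ _ ?_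
    change (ψ.comp φ).comp (glMk h k) = (AlgHom.id ℂ _).comp (glMk h k)
    rw [AlgHom.comp_assoc, hφ, AlgHom.id_comp]
    have := c₂.map hρ rd rd' ψ
    rw [hψ] at this
    exact this.right_unique c₁ hρ d d'
  have i₂ : φ.comp ψ = AlgHom.id ℂ _ := by
    refine RingQuot.ringQuot_ext' _ _ _ ?_
    change (φ.comp ψ).comp (rsMk h k) = (AlgHom.id ℂ _).comp (rsMk h k)
    rw [AlgHom.comp_assoc, hψ, AlgHom.id_comp]
    have := c₁.map hρ d d' φ
    rw [hφ] at this
    exact this.left_unique c₂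
  have x₁ : ∀ n : ℕ, Complex.exp (-(h * k) / 2 * (n : ℂ)) = ρ⁻¹ ^ n := fun n => by
    rw [hρ_def, ← Complex.exp_neg, ← Complex.exp_nat_mul]; congr 1; ring
  have x₂ : ∀ n : ℕ, Complex.exp (h * k / 2 * (n : ℂ)) = ρ ^ n := fun n => by
    rw [hρ_def, ← Complex.exp_nat_mul]; congr 1; ring
  obtain ⟨⟨h1, h2, h3, h4⟩, h5, h6, h7, h8⟩ := (compat_iff hρ d d').1 c₁
  have hψ' : ∀ x, ψ (rsMk h k x) = rsHom ρ (glMk h k) x := fun x => DFunLike.congr_fun hψ x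
  refine ⟨AlgEquiv.ofAlgHom ψ φ i₁ i₂, ?_⟩
  simp only [AlgEquiv.ofAlgHom_apply, hψ', x₁, x₂, map_smul, neg_smul, map_neg]
  refine ⟨fun n => (h1 n).symm, fun n => (h5 n).symm, fun n => (h4 n).symm, fun n => (h8 n).symm,
    fun n => (h2 n).symm, fun n hn => ?_, fun n hn => ?_, fun n => (h7 n).symm⟩
  · rw [← h6, if_neg (by omega)]
  · rw [← h3, if_neg (by omega)]

end
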